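/- Let N ≤ d+2 and suppose that every standard N-partition of ℝ^d having exactly one region of infinite volume (i.e., every standard (N−1)-cluster in ℝ^d) is an isoperimetric cluster. Then every standard N-partition of ℝ^d is a locally isoperimetric partition. -/

import Mathlib

open MeasureTheory Metric Set Filter Bornology
open scoped ENNReal symmDiff Topology

noncomputable section

/-- Euclidean space `ℝ^d`. -/
abbrev Rd (d : ℕ) : Type := EuclideanSpace ℝ (Fin d)

/-- Divergence of a vector field on `ℝ^d`. -/
def vdiv {d : ℕ} (φ : Rd d → Rd d) (x : Rd d) : ℝ :=
  ∑ i : Fin d, fderiv ℝ φ x (EuclideanSpace.single i (1 : ℝ)) i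

/-- Relative perimeter of a set `E` in an open set `U`:
the supremum of `∫_E div φ` over `C¹` vector fields `φ` compactly supported in `U`
with `‖φ‖ ≤ 1`. -/
def perimOpen {d : ℕ} (E U : Set (Rd d)) : ℝ≥0∞ :=
  ⨆ (φ : Rd d → Rd d) (_ : ContDiff ℝ 1 φ) (_ : HasCompactSupport φ)
      (_ : tsupport φ ⊆ U) (_ : ∀ x, ‖φ x‖ ≤ 1),
    ENNReal.ofReal (∫ x in E, vdiv φ x)

/-- Relative perimeter of `E` in an arbitrary set `A`, extended (by outer regularity)
from the values on open sets; this is the Borel measure `|D1_E|` evaluated at `A`. -/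
def perim {d : ℕ} (E A : Set (Rd d)) : ℝ≥0∞ :=
  ⨅ (U : Set (Rd d)) (_ : IsOpen U) (_ : A ⊆ U), perimOpen E U

/-- Perimeter of a partition: half of the sum of the relative perimeters of the regions. -/
def partPerim {d N : ℕ} (E : Fin N → Set (Rd d)) (A : Set (Rd d)) : ℝ≥0∞ :=
  (∑ k, perim (E k) A) / 2

/-- An `N`-partition of `Ω`: measurable regions, pairwise disjoint in `Ω` up to null sets,
covering `Ω` up to a null set. Regions of measure zero are allowed (improper partitions). -/
def IsPartition {d N : ℕ} (Ω : Set (Rd d)) (E : Fin N → Set (Rd d)) : Prop :=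
  (∀ k, MeasurableSet (E k)) ∧
  (∀ k j, k ≠ j → volume (E k ∩ E j ∩ Ω) = 0) ∧
  volume (Ω \ ⋃ k, E k) = 0

/-- A locally isoperimetric `N`-partition of `Ω`. -/
def LocallyIsoperimetric {d N : ℕ} (Ω : Set (Rd d)) (E : Fin N → Set (Rd d)) : Prop :=
  IsPartition Ω E ∧
  ∀ B : Set (Rd d), IsCompact B → B ⊆ Ω →
    ∀ F : Fin N → Set (Rd d), IsPartition Ω F →
      (∀ k, volume ((E k ∆ F k) \ B) = 0) →
      (∀ k, volume (F k) = volume (E k)) →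
      partPerim E B ≤ partPerim F B

/-- The north pole of the unit sphere `S^d ⊆ ℝ^{d+1}`. -/
def northPole (d : ℕ) : Rd (d + 1) := EuclideanSpace.single (Fin.last d) 1

/-- Stereographic projection `S^d \ {north pole} → ℝ^d`. -/
def stereoProj (d : ℕ) (y : Rd (d + 1)) : Rd d :=
  (1 - y (Fin.last d))⁻¹ • (WithLp.equiv 2 (Fin d → ℝ)).symm (fun i => y i.castSucc)

/-- A standard `N`-partition of `ℝ^d`: the image, under a stereographic projection of the
unit sphere `S^d ⊆ ℝ^{d+1}`, of the open Voronoi partition of `S^d` determined by `N`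
pairwise equidistant points of `S^d` (up to Lebesgue-null modifications of the regions;
quantifying over all equidistant configurations accounts for the sphere isometry moving
the projection point to the north pole). -/
def IsStandardPartition {d N : ℕ} (E : Fin N → Set (Rd d)) : Prop :=
  ∃ p : Fin N → Rd (d + 1),
    Function.Injective p ∧
    (∀ k, ‖p k‖ = 1) ∧
    (∀ i j i' j' : Fin N, i ≠ j → i' ≠ j' → dist (p i) (p j) = dist (p i') (p j')) ∧
    ∀ k, volume (E k ∆
      (stereoProj d '' {y : Rd (d + 1) | ‖y‖ = 1 ∧ y ≠ northPole d ∧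
        ∀ j, j ≠ k → dist y (p k) < dist y (p j)})) = 0


/-! ### Basic facts on the perimeter -/

structure IsTest {d : ℕ} (U : Set (Rd d)) (φ : Rd d → Rd d) : Prop where
  cd : ContDiff ℝ 1 φ
  cs : HasCompactSupport φ
  ts : tsupport φ ⊆ U

lemma vdiv_cont {d : ℕ} {φ : Rd d → Rd d} (h : ContDiff ℝ 1 φ) : Continuous (vdiv φ) := by
  unfold vdiv
  have := h.continuous_fderiv (by norm_num)
  fun_prop

lemma vdiv_eq_zero {d : ℕ} {φ : Rd d → Rd d} {x : Rd d} (h : x ∉ tsupport φ) : vdiv φ x = 0 := by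
  unfold vdiv
  have : fderiv ℝ φ x = 0 := by
    by_contra h0
    exact h (support_fderiv_subset ℝ (by simpa using h0))
  simp [this]

lemma vdiv_cs {d : ℕ} {φ : Rd d → Rd d} (h : HasCompactSupport φ) : HasCompactSupport (vdiv φ) := by
  refine HasCompactSupport.intro h ?_
  intro x hx
  exact vdiv_eq_zero hx

lemma vdiv_int {d : ℕ} {φ : Rd d → Rd d} {U} (h : IsTest U φ) : Integrable (vdiv φ) :=
  (vdiv_cont h.cd).integrable_of_hasCompactSupport (vdiv_cs h.cs)

lemma perimOpen_le {d : ℕ} {E U : Set (Rd d)} {c : ℝ≥0∞}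
    (h : ∀ φ, IsTest U φ → (∀ x, ‖φ x‖ ≤ 1) → ENNReal.ofReal (∫ x in E, vdiv φ x) ≤ c) :
    perimOpen E U ≤ c := by
  unfold perimOpen
  refine iSup_le fun φ => iSup_le fun h1 => iSup_le fun h2 => iSup_le fun h3 => iSup_le fun h4 => ?_
  exact h φ ⟨h1, h2, h3⟩ h4

lemma le_perimOpen {d : ℕ} {E U : Set (Rd d)} {φ} (h : IsTest U φ) (hb : ∀ x, ‖φ x‖ ≤ 1) :
    ENNReal.ofReal (∫ x in E, vdiv φ x) ≤ perimOpen E U := by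
  unfold perimOpen
  exact le_iSup_of_le φ <| le_iSup_of_le h.cd <| le_iSup_of_le h.cs <| le_iSup_of_le h.ts <|
    le_iSup_of_le hb le_rfl

lemma vdiv_const_smul {d : ℕ} {φ : Rd d → Rd d} (h : Differentiable ℝ φ) (c : ℝ) (x) :
    vdiv (fun x => c • φ x) x = c * vdiv φ x := by
  unfold vdiv
  rw [fderiv_fun_const_smul (h x)]
  simp [Finset.mul_sum]

lemma vdiv_add {d : ℕ} {φ ψ : Rd d → Rd d} (h : Differentiable ℝ φ) (h' : Differentiable ℝ ψ) (x) :
    vdiv (fun x => φ x + ψ x) x = vdiv φ x + vdiv ψ x := by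
  unfold vdiv
  rw [fderiv_fun_add (h x) (h' x)]
  simp [Finset.sum_add_distrib]

lemma IsTest.const_smul {d : ℕ} {U} {φ : Rd d → Rd d} (h : IsTest U φ) (c : ℝ) :
    IsTest U (fun x => c • φ x) := by
  refine ⟨h.cd.const_smul c, ?_, ?_⟩
  · exact h.cs.smul_left (f := fun _ => c)
  · exact (tsupport_smul_subset_right (fun _ => c) φ).trans h.ts

lemma IsTest.add {d : ℕ} {U} {φ ψ : Rd d → Rd d} (h : IsTest U φ) (h' : IsTest U ψ) :
    IsTest U (fun x => φ x + ψ x) := by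
  refine ⟨h.cd.add h'.cd, h.cs.add h'.cs, ?_⟩
  exact (tsupport_add φ ψ).trans (union_subset h.ts h'.ts)

lemma IsTest.mono {d : ℕ} {U V} {φ : Rd d → Rd d} (h : IsTest U φ) (hUV : U ⊆ V) : IsTest V φ :=
  ⟨h.cd, h.cs, h.ts.trans hUV⟩

lemma le_mul_perimOpen {d : ℕ} {E U : Set (Rd d)} {φ} (h : IsTest U φ) {C : ℝ} (hC : 0 < C)
    (hb : ∀ x, ‖φ x‖ ≤ C) :
    ENNReal.ofReal (∫ x in E, vdiv φ x) ≤ ENNReal.ofReal C * perimOpen E U := by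
  have h1 := le_perimOpen (E := E) (h.const_smul C⁻¹) (by
    intro x
    rw [norm_smul, norm_inv, Real.norm_of_nonneg hC.le, inv_mul_le_iff₀ hC]
    simpa using hb x)
  simp_rw [vdiv_const_smul (h.cd.differentiable (by norm_num))] at h1
  rw [integral_const_mul] at h1
  calc _ = ENNReal.ofReal C * ENNReal.ofReal (C⁻¹ * ∫ x in E, vdiv φ x) := by
        rw [← ENNReal.ofReal_mul hC.le]; congr 1; field_simp
    _ ≤ _ := by gcongr

lemma perimOpen_mono {d : ℕ} {E U V : Set (Rd d)} (h : U ⊆ V) : perimOpen E U ≤ perimOpen E V :=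
  perimOpen_le fun _ hφ hb => le_perimOpen (hφ.mono h) hb

lemma perimOpen_congr {d : ℕ} {E F U : Set (Rd d)} (hE : MeasurableSet E) (hF : MeasurableSet F)
    (h : volume ((E ∆ F) ∩ U) = 0) :
    perimOpen E U = perimOpen F U := by
  unfold perimOpen
  refine iSup_congr fun φ => iSup_congr fun h1 => iSup_congr fun h2 => iSup_congr fun h3 =>
    iSup_congr fun h4 => ?_
  congr 1
  rw [← integral_indicator hE, ← integral_indicator hF]
  apply integral_congr_ae
  have : ∀ᵐ x, x ∉ (E ∆ F) ∩ U := measure_eq_zero_iff_ae_notMem.1 h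
  filter_upwards [this] with x hx
  by_cases hU : x ∈ U
  · have : x ∉ E ∆ F := fun h => hx ⟨h, hU⟩
    rw [Set.mem_symmDiff] at this
    by_cases hxE : x ∈ E <;> by_cases hxF : x ∈ F <;> simp_all
  · have : vdiv φ x = 0 := vdiv_eq_zero (fun h => hU (h3 h))
    by_cases hxE : x ∈ E <;> by_cases hxF : x ∈ F <;> simp [hxE, hxF, this]

lemma perim_univ {d : ℕ} (E : Set (Rd d)) : perim E univ = perimOpen E univ := by
  unfold perim
  apply le_antisymm
  · exact iInf_le_of_le univ (iInf_le_of_le isOpen_univ (iInf_le_of_le (subset_refl _) le_rfl))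
  · refine le_iInf fun U => le_iInf fun _ => le_iInf fun h => perimOpen_mono h

lemma vdiv_smul {d : ℕ} {u : Rd d → ℝ} {φ : Rd d → Rd d} {x} (hu : DifferentiableAt ℝ u x)
    (h : DifferentiableAt ℝ φ x) :
    vdiv (fun x => u x • φ x) x = u x * vdiv φ x + fderiv ℝ u x (φ x) := by
  unfold vdiv
  rw [fderiv_fun_smul hu h]
  simp only [add_apply, smul_apply,
    ContinuousLinearMap.smulRight_apply, PiLp.add_apply, PiLp.smul_apply, smul_eq_mul,
    Finset.sum_add_distrib, Finset.mul_sum]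
  congr 1
  conv_rhs => rw [← (EuclideanSpace.basisFun (Fin d) ℝ).sum_repr (φ x)]
  simp [map_sum, mul_comm]

lemma int_vdiv {d : ℕ} {φ : Rd d → Rd d} (h1 : ContDiff ℝ 1 φ) (h2 : HasCompactSupport φ) :
    ∫ x, vdiv φ x = 0 := by
  unfold vdiv
  have hc := h1.continuous_fderiv (by norm_num)
  have hint : ∀ i : Fin d, Integrable
      (fun x => fderiv ℝ φ x (EuclideanSpace.single i (1 : ℝ)) i) := by
    intro i
    apply Continuous.integrable_of_hasCompactSupport (by fun_prop)
    refine HasCompactSupport.intro h2 ?_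
    intro x hx
    have : fderiv ℝ φ x = 0 := by
      by_contra h0
      exact hx (support_fderiv_subset ℝ (by simpa using h0))
    simp [this]
  rw [integral_finsetSum _ (fun i _ => hint i)]
  apply Finset.sum_eq_zero
  intro i _
  have hd : Differentiable ℝ φ := h1.differentiable (by norm_num)
  have hf : ∀ x, fderiv ℝ φ x (EuclideanSpace.single i (1 : ℝ)) i
      = fderiv ℝ (fun x => φ x i) x (EuclideanSpace.single i (1 : ℝ)) := by
    intro x
    have := ((EuclideanSpace.proj (𝕜 := ℝ) i).hasFDerivAt.comp x (hd x).hasFDerivAt).fderiv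
    have h' : (fun x => φ x i) = (EuclideanSpace.proj (𝕜 := ℝ) i) ∘ φ := rfl
    rw [h', this]; rfl
  simp_rw [hf]
  have hint' := hint i
  simp_rw [hf] at hint'
  have := integral_mul_fderiv_eq_neg_fderiv_mul_of_integrable (μ := (volume : Measure (Rd d)))
    (f := fun _ : Rd d => (1:ℝ)) (g := fun x => φ x i) (v := EuclideanSpace.single i (1 : ℝ))
    (by simp) (by simpa using hint') ?_ ?_ ?_
  · simpa using this
  · simp only [one_mul]
    apply Continuous.integrable_of_hasCompactSupport
    · have := h1.continuous; fun_prop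
    · exact HasCompactSupport.intro h2 (fun x hx => by simp [image_eq_zero_of_notMem_tsupport hx])
  · intro x _; fun_prop
  · intro x _; fun_prop

/-! ### Additivity of the perimeter -/

lemma exists_cutoff {d : ℕ} {B U : Set (Rd d)} (hB : IsClosed B) (hU : IsOpen U) (h : B ⊆ U) :
    ∃ η : Rd d → ℝ, ContDiff ℝ (⊤ : ℕ∞) η ∧ (∀ᶠ x in 𝓝ˢ B, η x = 1) ∧ tsupport η ⊆ U ∧
      ∀ x, η x ∈ Icc (0:ℝ) 1 := by
  obtain ⟨f, h0, h1, hf⟩ := exists_contMDiffMap_zero_one_nhds_of_isClosed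
    (modelWithCornersSelf ℝ (Rd d)) (n := (⊤ : ℕ∞)) hU.isClosed_compl hB
    (by rw [disjoint_compl_left_iff_subset]; exact h)
  refine ⟨f, f.contMDiff.contDiff, h1, ?_, hf⟩
  intro x hx
  by_contra hxU
  have h2 : ∀ᶠ y in 𝓝 x, f y = 0 := h0.filter_mono (nhds_le_nhdsSet hxU)
  exact (notMem_tsupport_iff_eventuallyEq.2 h2) hx

lemma perim_add_le {d : ℕ} (E : Set (Rd d)) {B V : Set (Rd d)} (hV : IsOpen V)
    (h : B ⊆ V) : perim E B + perimOpen E (V \ B) ≤ perimOpen E V := by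
  have key : ∀ φ, IsTest (V \ B) φ → (∀ x, ‖φ x‖ ≤ 1) →
      perim E B + ENNReal.ofReal (∫ x in E, vdiv φ x) ≤ perimOpen E V := by
    intro φ hφ hb
    have hW : IsOpen (V ∩ (tsupport φ)ᶜ) := hV.inter (isClosed_tsupport φ).isOpen_compl
    have hBW : B ⊆ V ∩ (tsupport φ)ᶜ := fun x hx => ⟨h hx, fun hx' => (hφ.ts hx').2 hx⟩
    have h1 : perim E B ≤ perimOpen E (V ∩ (tsupport φ)ᶜ) :=
      iInf_le_of_le _ (iInf_le_of_le hW (iInf_le_of_le hBW le_rfl))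
    refine (add_le_add_left h1 _).trans ?_
    by_cases hneg : ∫ x in E, vdiv φ x ≤ 0
    · rw [ENNReal.ofReal_of_nonpos hneg, add_zero]
      exact perimOpen_mono inter_subset_left
    push Not at hneg
    by_cases htop : perimOpen E V = ⊤
    · simp [htop]
    have hlt : ENNReal.ofReal (∫ x in E, vdiv φ x) ≤ perimOpen E V :=
      le_perimOpen (hφ.mono sdiff_subset) hb
    rw [add_comm]
    refine (ENNReal.le_sub_iff_add_le_left (by simp) hlt).1 ?_
    apply perimOpen_le
    intro ψ hψ hb'
    rw [ENNReal.le_sub_iff_add_le_left (by simp) hlt]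
    have hψ' := hψ.mono (V := V) inter_subset_left
    have hφ' := hφ.mono (V := V) sdiff_subset
    have h3 := le_perimOpen (E := E) (hφ'.add hψ') (by
      intro x
      by_cases hx : x ∈ tsupport φ
      · have : ψ x = 0 := image_eq_zero_of_notMem_tsupport (fun hx' => (hψ.ts hx').2 hx)
        simpa [this] using hb x
      · have : φ x = 0 := image_eq_zero_of_notMem_tsupport hx
        simpa [this] using hb' x)
    simp_rw [vdiv_add (hφ.cd.differentiable (by norm_num)) (hψ.cd.differentiable (by norm_num))] at h3
    rw [integral_add (vdiv_int hφ).integrableOn (vdiv_int hψ).integrableOn] at h3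
    by_cases hneg' : ∫ x in E, vdiv ψ x ≤ 0
    · rw [ENNReal.ofReal_of_nonpos hneg', add_zero]
      exact hlt
    · push Not at hneg'
      rwa [ENNReal.ofReal_add hneg.le hneg'.le] at h3
  by_cases hp : perim E B ≤ perimOpen E V
  · by_cases htop : perim E B = ⊤
    · rw [htop] at hp ⊢; simpa using hp
    rw [← ENNReal.le_sub_iff_add_le_left htop hp]
    apply perimOpen_le
    intro φ hφ hb
    rw [ENNReal.le_sub_iff_add_le_left htop hp]
    exact key φ hφ hb
  · have h0 : perim E B ≤ perimOpen E V :=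
      iInf_le_of_le V (iInf_le_of_le hV (iInf_le_of_le h le_rfl))
    exact absurd h0 hp

lemma perimOpen_le_add' {d : ℕ} (E : Set (Rd d)) {B V U : Set (Rd d)} (hB : IsClosed B)
    (hU : IsOpen U) (h : B ⊆ U) :
    perimOpen E V ≤ perimOpen E U + perimOpen E (V \ B) := by
  apply perimOpen_le
  intro φ hφ hb
  obtain ⟨η, h1, h2, h3, h4⟩ := exists_cutoff hB hU h
  have h1' : ContDiff ℝ 1 η := h1.of_le (by exact_mod_cast le_top)
  have hd := hφ.cd.differentiable (by norm_num)
  have t1 : IsTest U (fun x => η x • φ x) := by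
    refine ⟨h1'.smul hφ.cd, hφ.cs.smul_left (f := η), ?_⟩
    exact (tsupport_smul_subset_left η φ).trans h3
  have t2 : IsTest (V \ B) (fun x => (1 - η x) • φ x) := by
    refine ⟨(contDiff_const.sub h1').smul hφ.cd, hφ.cs.smul_left (f := fun x => 1 - η x), ?_⟩
    intro x hx
    refine ⟨hφ.ts (tsupport_smul_subset_right (fun x => 1 - η x) φ hx), fun hxB => ?_⟩
    have h5 : ∀ᶠ y in 𝓝 x, (fun x => (1 - η x) • φ x) y = 0 := by
      filter_upwards [h2.filter_mono (nhds_le_nhdsSet hxB)] with y hy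
      simp [hy]
    exact (notMem_tsupport_iff_eventuallyEq.2 h5) hx
  have n1 := le_perimOpen (E := E) t1 (by
    intro x
    rw [norm_smul, Real.norm_of_nonneg (h4 x).1]
    exact mul_le_one₀ (h4 x).2 (norm_nonneg _) (hb x))
  have n2 := le_perimOpen (E := E) t2 (by
    intro x
    rw [norm_smul, Real.norm_of_nonneg (by linarith [(h4 x).2])]
    exact mul_le_one₀ (by linarith [(h4 x).1]) (norm_nonneg _) (hb x))
  refine le_trans ?_ (add_le_add n1 n2)
  refine le_trans (le_of_eq ?_) ENNReal.ofReal_add_le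
  rw [← integral_add (vdiv_int t1).integrableOn (vdiv_int t2).integrableOn]
  congr 2
  ext x
  rw [← vdiv_add (t1.cd.differentiable (by norm_num)) (t2.cd.differentiable (by norm_num))]
  congr 1
  ext y : 1
  rw [← add_smul]; simp

lemma perimOpen_eq_add {d : ℕ} (E : Set (Rd d)) {B V : Set (Rd d)} (hB : IsClosed B)
    (hV : IsOpen V) (h : B ⊆ V) : perimOpen E V = perim E B + perimOpen E (V \ B) := by
  apply le_antisymm _ (perim_add_le E hV h)
  unfold perim
  simp_rw [ENNReal.iInf_add]
  refine le_iInf fun U => le_iInf fun hU => le_iInf fun h => ?_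
  exact perimOpen_le_add' E hB hU h

/-- locality: comparison on `V'` with finite perimeter gives comparison on `B`. -/
lemma perim_le_of_perimOpen_le {d N : ℕ} {E F : Fin N → Set (Rd d)} {B V : Set (Rd d)}
    (hB : IsClosed B) (hV : IsOpen V) (h : B ⊆ V)
    (hE : ∀ k, MeasurableSet (E k)) (hF : ∀ k, MeasurableSet (F k))
    (hEF : ∀ k, volume ((E k ∆ F k) \ B) = 0) (hfin : ∀ k, perimOpen (E k) V ≠ ⊤) {δ : ℝ≥0∞}
    (hle : ∑ k, perimOpen (E k) V ≤ ∑ k, perimOpen (F k) V + δ) :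
    ∑ k, perim (E k) B ≤ ∑ k, perim (F k) B + δ := by
  simp_rw [fun k => perimOpen_eq_add (E k) hB hV h, fun k => perimOpen_eq_add (F k) hB hV h] at hle
  have hEF' : ∀ k, perimOpen (F k) (V \ B) = perimOpen (E k) (V \ B) := by
    intro k
    refine (perimOpen_congr (hE k) (hF k) (measure_mono_null ?_ (hEF k))).symm
    exact fun x hx => ⟨hx.1, hx.2.2⟩
  simp_rw [hEF', Finset.sum_add_distrib] at hle
  rw [add_right_comm] at hle
  refine (ENNReal.add_le_add_iff_right ?_).1 hle
  simp only [ne_eq, ENNReal.sum_eq_top, Finset.mem_univ, true_and, not_exists]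
  intro k hk
  exact hfin k (top_le_iff.1 (hk ▸ perimOpen_mono sdiff_subset))

lemma perimOpen_le_of_perim_le {d N : ℕ} {E F : Fin N → Set (Rd d)} {B V : Set (Rd d)}
    (hB : IsClosed B) (hV : IsOpen V) (h : B ⊆ V)
    (hE : ∀ k, MeasurableSet (E k)) (hF : ∀ k, MeasurableSet (F k))
    (hEF : ∀ k, volume ((E k ∆ F k) \ B) = 0)
    (hle : ∑ k, perim (E k) B ≤ ∑ k, perim (F k) B) :
    ∑ k, perimOpen (E k) V ≤ ∑ k, perimOpen (F k) V := by
  simp_rw [fun k => perimOpen_eq_add (E k) hB hV h, fun k => perimOpen_eq_add (F k) hB hV h]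
  have hEF' : ∀ k, perimOpen (F k) (V \ B) = perimOpen (E k) (V \ B) := by
    intro k
    refine (perimOpen_congr (hE k) (hF k) (measure_mono_null ?_ (hEF k))).symm
    exact fun x hx => ⟨hx.1, hx.2.2⟩
  simp_rw [hEF', Finset.sum_add_distrib]
  gcongr

/-! ### Perimeter of the image under a diffeomorphism -/

lemma contDiff_clm_det {d : ℕ} : ContDiff ℝ (⊤ : ℕ∞) (fun A : Rd d →L[ℝ] Rd d => A.det) := by
  have h : (fun A : Rd d →L[ℝ] Rd d => A.det) = fun A => ∑ σ : Equiv.Perm (Fin d),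
      ((Equiv.Perm.sign σ : ℤ) : ℝ) * ∏ i, A (EuclideanSpace.single i (1:ℝ)) (σ i) := by
    ext A
    rw [ContinuousLinearMap.det, ← LinearMap.det_toMatrix
      (EuclideanSpace.basisFun (Fin d) ℝ).toBasis, Matrix.det_apply']
    simp [LinearMap.toMatrix_apply]
  rw [h]
  apply ContDiff.sum
  intro σ _
  apply ContDiff.mul contDiff_const
  apply contDiff_prod
  intro i _
  have : (fun A : Rd d →L[ℝ] Rd d => A (EuclideanSpace.single i (1:ℝ)) (σ i)) =
    ((EuclideanSpace.proj (𝕜 := ℝ) (σ i)).comp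
      (ContinuousLinearMap.apply ℝ (Rd d) (EuclideanSpace.single i (1:ℝ)))) := by
    ext A; rfl
  rw [this]
  exact ContinuousLinearMap.contDiff _

lemma int_mul_vdiv {d : ℕ} {u : Rd d → ℝ} {φ : Rd d → Rd d} (hu : ContDiff ℝ 1 u)
    (hφ : ContDiff ℝ 1 φ) (hc : HasCompactSupport φ) :
    ∫ x, u x * vdiv φ x = - ∫ x, fderiv ℝ u x (φ x) := by
  have h := int_vdiv (φ := fun x => u x • φ x) (hu.smul hφ) (hc.smul_left (f := u))
  simp_rw [fun x => vdiv_smul (hu.differentiable (by norm_num) x) (hφ.differentiable (by norm_num) x)]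
    at h
  rw [integral_add] at h
  · linarith
  · have := vdiv_cont hφ
    apply Continuous.integrable_of_hasCompactSupport (by have := hu.continuous; fun_prop)
    exact (vdiv_cs hc).mul_left
  · apply Continuous.integrable_of_hasCompactSupport
    · have := hu.continuous_fderiv (by norm_num)
      have := hφ.continuous
      fun_prop
    · exact HasCompactSupport.intro hc (fun x hx => by simp [image_eq_zero_of_notMem_tsupport hx])

structure DiffeoOn {d : ℕ} (Φ Θ : Rd d → Rd d) (U W : Set (Rd d)) : Prop where
  li : Function.LeftInverse Θ Φ
  ri : Function.RightInverse Θ Φ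
  oU : IsOpen U
  oW : IsOpen W
  im : Φ '' U = W
  cΦ : ContDiffOn ℝ 2 Φ U
  cΘ : ContDiffOn ℝ 2 Θ W

namespace DiffeoOn
variable {d : ℕ} {Φ Θ : Rd d → Rd d} {U W : Set (Rd d)}

lemma mem (h : DiffeoOn Φ Θ U W) {x} : Φ x ∈ W ↔ x ∈ U := by
  rw [← h.im]
  exact h.li.injective.mem_set_image

lemma mem' (h : DiffeoOn Φ Θ U W) {y} : Θ y ∈ U ↔ y ∈ W := by
  rw [← h.mem, h.ri]

lemma cdA (h : DiffeoOn Φ Θ U W) {x} (hx : x ∈ U) : ContDiffAt ℝ 2 Φ x :=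
  h.cΦ.contDiffAt (h.oU.mem_nhds hx)

lemma cdA' (h : DiffeoOn Φ Θ U W) {x} (hx : x ∈ W) : ContDiffAt ℝ 2 Θ x :=
  h.cΘ.contDiffAt (h.oW.mem_nhds hx)

lemma fd (h : DiffeoOn Φ Θ U W) {x} (hx : x ∈ U) : HasFDerivAt Φ (fderiv ℝ Φ x) x :=
  ((h.cdA hx).differentiableAt (by norm_num)).hasFDerivAt

lemma fd' (h : DiffeoOn Φ Θ U W) {x} (hx : x ∈ W) : HasFDerivAt Θ (fderiv ℝ Θ x) x :=
  ((h.cdA' hx).differentiableAt (by norm_num)).hasFDerivAt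

lemma symm (h : DiffeoOn Φ Θ U W) : DiffeoOn Θ Φ W U :=
  ⟨h.ri, h.li, h.oW, h.oU, by rw [← h.im, image_image]; simp [h.li _], h.cΘ, h.cΦ⟩

lemma comp_id (h : DiffeoOn Φ Θ U W) {x} (hx : x ∈ U) :
    (fderiv ℝ Θ (Φ x)).comp (fderiv ℝ Φ x) = ContinuousLinearMap.id ℝ _ := by
  have h1 := (h.fd' (h.mem.2 hx)).comp x (h.fd hx)
  have h2 : Θ ∘ Φ = id := by ext1 x; exact h.li x
  rw [h2] at h1
  exact h1.unique (hasFDerivAt_id x)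

lemma det_ne (h : DiffeoOn Φ Θ U W) {x} (hx : x ∈ U) : (fderiv ℝ Φ x).det ≠ 0 := by
  intro h0
  have h1 := congrArg (fun A : Rd d →L[ℝ] Rd d => A.det) (h.comp_id hx)
  simp only [ContinuousLinearMap.det] at h1 h0
  rw [ContinuousLinearMap.toLinearMap_comp, LinearMap.det_comp, h0] at h1
  simp at h1

lemma cv (h : DiffeoOn Φ Θ U W) {S : Set (Rd d)} (hS : MeasurableSet S) (hSU : S ⊆ U)
    (g : Rd d → ℝ) :
    ∫ y in Φ '' S, g y = ∫ x in S, |(fderiv ℝ Φ x).det| * g (Φ x) := by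
  rw [integral_image_eq_integral_abs_det_fderiv_smul volume hS
    (fun x hx => (h.fd (hSU hx)).hasFDerivWithinAt) h.li.injective.injOn]
  simp

lemma cJ (h : DiffeoOn Φ Θ U W) {x} (hx : x ∈ U) :
    ContDiffAt ℝ 1 (fun x => |(fderiv ℝ Φ x).det|) x := by
  have h1 : ContDiffAt ℝ 1 (fderiv ℝ Φ) x := (h.cdA hx).fderiv_right (by norm_num)
  have h2 : ContDiffAt ℝ 1 (fun x => (fderiv ℝ Φ x).det) x :=
    (contDiff_clm_det.of_le (by exact_mod_cast le_top)).contDiffAt.comp x h1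
  exact (contDiffAt_abs (h.det_ne hx)).comp x h2

/-- the Piola transform -/
def piola (Φ Θ φ : Rd d → Rd d) (x : Rd d) : Rd d :=
  |(fderiv ℝ Φ x).det| • fderiv ℝ Θ (Φ x) (φ (Φ x))

lemma compSupp (h : DiffeoOn Φ Θ U W) {K : Set (Rd d)} (hK : IsCompact K) (hKW : K ⊆ W) :
    IsCompact (Θ '' K) ∧ Θ '' K ⊆ U :=
  ⟨hK.image_of_continuousOn (h.cΘ.continuousOn.mono hKW), by
    rintro _ ⟨y, hy, rfl⟩; exact h.mem'.2 (hKW hy)⟩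

lemma piola_test (h : DiffeoOn Φ Θ U W) {φ} (hφ : IsTest W φ) : IsTest U (piola Φ Θ φ) := by
  obtain ⟨hL, hLU⟩ := h.compSupp hφ.cs hφ.ts
  have hz : ∀ x, x ∉ Θ '' (tsupport φ) → piola Φ Θ φ x = 0 := by
    intro x hx
    have : φ (Φ x) = 0 := image_eq_zero_of_notMem_tsupport (fun h' => hx ⟨_, h', h.li x⟩)
    simp [piola, this]
  have hts : tsupport (piola Φ Θ φ) ⊆ Θ '' (tsupport φ) := by
    apply closure_minimal _ hL.isClosed
    intro x hx
    by_contra h'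
    exact hx (hz x h')
  refine ⟨?_, HasCompactSupport.intro hL hz, hts.trans hLU⟩
  rw [contDiff_iff_contDiffAt]
  intro x
  by_cases hx : x ∈ U
  · have h1 : ContDiffAt ℝ 1 (fderiv ℝ Θ) (Φ x) := (h.cdA' (h.mem.2 hx)).fderiv_right (by norm_num)
    have h2 : ContDiffAt ℝ 1 Φ x := (h.cdA hx).of_le (by norm_num)
    exact (h.cJ hx).smul ((h1.comp x h2).clm_apply (hφ.cd.contDiffAt.comp x h2))
  · have : piola Φ Θ φ =ᶠ[𝓝 x] fun _ => 0 := by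
      filter_upwards [hL.isClosed.isOpen_compl.mem_nhds (fun h' => hx (hLU h'))] with y hy
      exact hz y hy
    exact contDiffAt_const.congr_of_eventuallyEq this

lemma piola_weak (h : DiffeoOn Φ Θ U W) {φ} (hφ : IsTest W φ) {u : Rd d → ℝ}
    (hu : ContDiff ℝ 2 u) (huc : HasCompactSupport u) (huU : tsupport u ⊆ U) :
    ∫ x, u x * vdiv (piola Φ Θ φ) x = ∫ x in U, |(fderiv ℝ Φ x).det| * (u x * vdiv φ (Φ x)) := by
  have ht := h.piola_test hφ
  rw [int_mul_vdiv (hu.of_le (by norm_num)) ht.cd ht.cs]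
  set w : Rd d → ℝ := fun y => u (Θ y) with hw
  obtain ⟨hL, hLW⟩ := h.symm.compSupp huc huU
  have hwz : ∀ y, y ∉ Φ '' tsupport u → w y = 0 := by
    intro y hy
    have : u (Θ y) = 0 := image_eq_zero_of_notMem_tsupport (f := u) (fun h' => hy ⟨_, h', h.ri y⟩)
    exact this
  have hwc : ContDiff ℝ 1 w := by
    rw [contDiff_iff_contDiffAt]
    intro y
    by_cases hy : y ∈ W
    · exact (hu.of_le (by norm_num)).contDiffAt.comp y ((h.cdA' hy).of_le (by norm_num))
    · have : w =ᶠ[𝓝 y] fun _ => 0 := by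
        filter_upwards [hL.isClosed.isOpen_compl.mem_nhds (fun h' => hy (hLW h'))] with y hy
        exact hwz y hy
      exact contDiffAt_const.congr_of_eventuallyEq this
  have e1 : ∫ x, fderiv ℝ u x (piola Φ Θ φ x) = ∫ y, fderiv ℝ w y (φ y) := by
    have a1 : ∫ y, fderiv ℝ w y (φ y) = ∫ y in W, fderiv ℝ w y (φ y) := by
      rw [setIntegral_eq_integral_of_forall_compl_eq_zero]
      intro y hy
      rw [image_eq_zero_of_notMem_tsupport (fun h' => hy (hφ.ts h'))]; simp
    have a2 : ∫ x, fderiv ℝ u x (piola Φ Θ φ x) = ∫ x in U, fderiv ℝ u x (piola Φ Θ φ x) := by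
      rw [setIntegral_eq_integral_of_forall_compl_eq_zero]
      intro y hy
      rw [image_eq_zero_of_notMem_tsupport (fun h' => hy (ht.ts h'))]; simp
    rw [a1, a2, ← h.im, h.cv h.oU.measurableSet subset_rfl]
    apply setIntegral_congr_fun h.oU.measurableSet
    intro x hx
    have hy := h.mem.2 hx
    have : fderiv ℝ w (Φ x) = (fderiv ℝ u x).comp (fderiv ℝ Θ (Φ x)) := by
      have h1 : HasFDerivAt u (fderiv ℝ u x) (Θ (Φ x)) := by
        rw [h.li]; exact (hu.differentiable (by norm_num) x).hasFDerivAt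
      exact (h1.comp (Φ x) (h.fd' hy)).fderiv
    simp only [this, piola]
    simp
  rw [e1, ← int_mul_vdiv hwc hφ.cd hφ.cs, ← setIntegral_eq_integral_of_forall_compl_eq_zero
    (s := W), ← h.im, h.cv h.oU.measurableSet subset_rfl]
  · simp [hw, h.li _]
  · intro y hy
    rw [vdiv_eq_zero (fun h' => hy (hφ.ts h'))]; simp

lemma piola_ae (h : DiffeoOn Φ Θ U W) {φ} (hφ : IsTest W φ) :
    ∀ᵐ x, x ∈ U → vdiv (piola Φ Θ φ) x = |(fderiv ℝ Φ x).det| * vdiv φ (Φ x) := by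
  have ht := h.piola_test hφ
  have hJc : ContinuousOn (fun x => |(fderiv ℝ Φ x).det| * vdiv φ (Φ x)) U := by
    intro x hx
    apply ContinuousAt.continuousWithinAt
    exact (h.cJ hx).continuousAt.mul ((vdiv_cont hφ.cd).continuousAt.comp (h.fd hx).continuousAt)
  have hc : ContinuousOn (fun x => vdiv (piola Φ Θ φ) x - |(fderiv ℝ Φ x).det| * vdiv φ (Φ x)) U :=
    (vdiv_cont ht.cd).continuousOn.sub hJc
  have := h.oU.ae_eq_zero_of_integral_contDiff_smul_eq_zero (μ := volume)
    (hc.locallyIntegrableOn h.oU.measurableSet) ?_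
  · filter_upwards [this] with x hx hxU
    linarith [hx hxU]
  intro u hu huc huU
  simp only [smul_eq_mul, mul_sub]
  have hw := h.piola_weak hφ (hu.of_le (WithTop.coe_le_coe.2 (le_top : (2:ℕ∞) ≤ ⊤))) huc huU
  have e : ∫ x in U, |(fderiv ℝ Φ x).det| * (u x * vdiv φ (Φ x))
    = ∫ x, u x * (|(fderiv ℝ Φ x).det| * vdiv φ (Φ x)) := by
    refine Eq.trans ?_ (setIntegral_eq_integral_of_forall_compl_eq_zero (s := U) ?_)
    · apply setIntegral_congr_fun h.oU.measurableSet
      intro x _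
      simp only
      ring
    · intro y hy
      rw [image_eq_zero_of_notMem_tsupport (fun h' => hy (huU h'))]; simp
  rw [integral_sub, hw, e, sub_self]
  · apply Continuous.integrable_of_hasCompactSupport
    · exact hu.continuous.mul (vdiv_cont ht.cd)
    · exact huc.mul_right
  · have hi : IntegrableOn (fun x => u x * (|(fderiv ℝ Φ x).det| * vdiv φ (Φ x))) (tsupport u) :=
      (hu.continuous.continuousOn.mul (hJc.mono huU)).integrableOn_compact huc
    rw [integrableOn_iff_integrable_of_support_subset] at hi
    · exact hi
    · intro x hx
      apply subset_tsupport
      intro h0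
      simp [h0] at hx

lemma perimOpen_image_le (h : DiffeoOn Φ Θ U W) {C : ℝ} (hC : 0 < C)
    (hb : ∀ x ∈ U, ∀ v, |(fderiv ℝ Φ x).det| * ‖fderiv ℝ Θ (Φ x) v‖ ≤ C * ‖v‖)
    {F : Set (Rd d)} (hF : MeasurableSet F) (hF' : MeasurableSet (Φ '' F)) :
    perimOpen (Φ '' F) W ≤ ENNReal.ofReal C * perimOpen F U := by
  apply perimOpen_le
  intro φ hφ hφ1
  have ht := h.piola_test hφ
  refine le_trans (le_of_eq ?_) (le_mul_perimOpen ht hC ?_)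
  · congr 1
    have e1 : ∫ x in Φ '' F, vdiv φ x = ∫ x in Φ '' (F ∩ U), vdiv φ x := by
      apply setIntegral_eq_of_subset_of_forall_sdiff_eq_zero hF' (image_mono inter_subset_left)
      rintro _ ⟨⟨x, hx, rfl⟩, hx'⟩
      apply vdiv_eq_zero
      intro h'
      exact hx' ⟨x, ⟨hx, h.mem.1 (hφ.ts h')⟩, rfl⟩
    have e2 : ∫ x in F, vdiv (piola Φ Θ φ) x = ∫ x in F ∩ U, vdiv (piola Φ Θ φ) x := by
      apply setIntegral_eq_of_subset_of_forall_sdiff_eq_zero hF inter_subset_left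
      rintro x ⟨hx, hx'⟩
      apply vdiv_eq_zero
      intro h'
      exact hx' ⟨hx, ht.ts h'⟩
    have hm := hF.inter h.oU.measurableSet
    rw [e1, e2, h.cv hm inter_subset_right]
    apply setIntegral_congr_ae hm
    filter_upwards [h.piola_ae hφ] with x hx hxU
    exact (hx hxU.2).symm
  · intro x
    by_cases hx : x ∈ U
    · simp only [piola, norm_smul, norm_abs_eq_norm, Real.norm_eq_abs]
      refine (hb x hx _).trans ?_
      have := hφ1 (Φ x)
      nlinarith
    · rw [image_eq_zero_of_notMem_tsupport (fun h' => hx (ht.ts h'))]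
      simpa using hC.le
end DiffeoOn

/-! ### Slicing bound for sets cut by quadratic inequalities -/

lemma ordConn_int {S : Set ℝ} (hS : S.OrdConnected) {g : ℝ → ℝ} (hg : ContDiff ℝ 1 g)
    (hc : HasCompactSupport g) (hb : ∀ x, |g x| ≤ 1) : |∫ x in S, deriv g x| ≤ 2 := by
  obtain ⟨M, hM⟩ := hc.isCompact.isBounded.subset_closedBall 0
  have hM' : tsupport g ⊆ Icc (-M) M := by
    intro x hx; have := hM hx; rw [mem_closedBall, Real.dist_eq, sub_zero] at this
    exact abs_le.1 this
  have hS' : (S ∩ Icc (-M) M).OrdConnected := hS.inter ordConnected_Icc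
  have e0 : ∫ x in S, deriv g x = ∫ x in S ∩ Icc (-M) M, deriv g x := by
    apply setIntegral_eq_of_subset_of_forall_sdiff_eq_zero hS.measurableSet inter_subset_left
    rintro x ⟨hx, hx'⟩
    have : x ∉ tsupport g := fun h => hx' ⟨hx, hM' h⟩
    by_contra h0
    exact this (support_deriv_subset h0)
  rw [e0]
  generalize hT : S ∩ Icc (-M) M = T at *
  rcases T.eq_empty_or_nonempty with h | h
  · simp [h]
  have hTM : T ⊆ Icc (-M) M := hT ▸ inter_subset_right
  have bA : BddAbove T := bddAbove_Icc.mono hTM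
  have bB : BddBelow T := bddBelow_Icc.mono hTM
  have h1 : T ⊆ Icc (sInf T) (sSup T) := fun x hx => ⟨csInf_le bB hx, le_csSup bA hx⟩
  have h2 : Ioo (sInf T) (sSup T) ⊆ T := by
    rintro x ⟨hx1, hx2⟩
    obtain ⟨a, ha, ha'⟩ := exists_lt_of_csInf_lt h hx1
    obtain ⟨b, hb, hb'⟩ := exists_lt_of_lt_csSup h hx2
    exact hS'.out ha hb ⟨ha'.le, hb'.le⟩
  have h3 : sInf T ≤ sSup T := csInf_le_csSup h bB bA
  have hae : T =ᵐ[volume] Ioc (sInf T) (sSup T) := by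
    have e1 : T ≤ᵐ[volume] Icc (sInf T) (sSup T) := h1.eventuallyLE
    have e2 : Ioo (sInf T) (sSup T) ≤ᵐ[volume] T := h2.eventuallyLE
    exact (e1.trans Ioc_ae_eq_Icc.symm.le).antisymm (Ioo_ae_eq_Ioc.symm.le.trans e2)
  rw [setIntegral_congr_set hae, ← intervalIntegral.integral_of_le h3,
    intervalIntegral.integral_deriv_eq_sub (fun x _ => hg.differentiable (by norm_num) x)
    ((hg.continuous_deriv (by norm_num)).intervalIntegrable _ _)]
  have := abs_le.1 (hb (sSup T))
  have := abs_le.1 (hb (sInf T))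
  rw [abs_le]; constructor <;> linarith

lemma quad_mid {α β γ x y z : ℝ} (hxy : x ≤ y) (hyz : y ≤ z)
    (hx : 0 < α * x ^ 2 + β * x + γ) (hz : 0 < α * z ^ 2 + β * z + γ)
    (hh : -β / (2 * α) ≤ x ∨ z ≤ -β / (2 * α)) : 0 < α * y ^ 2 + β * y + γ := by
  by_cases hα : 0 < α
  · rcases hh with h | h
    · rw [div_le_iff₀ (by positivity)] at h
      nlinarith [mul_nonneg (sub_nonneg.2 hxy) hα.le, mul_nonneg (mul_nonneg (sub_nonneg.2 hxy) (sub_nonneg.2 hxy)) hα.le, mul_nonneg (sub_nonneg.2 hxy) (by linarith : 0 ≤ 2 * α * x + β)]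
    · rw [le_div_iff₀ (by positivity)] at h
      nlinarith [mul_nonneg (mul_nonneg (sub_nonneg.2 hyz) (sub_nonneg.2 hyz)) hα.le, mul_nonneg (sub_nonneg.2 hyz) (by linarith : 0 ≤ -(2 * α * z + β))]
  · push Not at hα
    rcases hxy.eq_or_lt with h | h
    · subst h; exact hx
    rcases hyz.eq_or_lt with h' | h'
    · subst h'; exact hz
    have key : (z - x) * (α * y ^ 2 + β * y + γ) = (z - y) * (α * x ^ 2 + β * x + γ)
      + (y - x) * (α * z ^ 2 + β * z + γ) + (-α) * ((y - x) * (z - y) * (z - x)) := by ring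
    have : 0 < (z - x) * (α * y ^ 2 + β * y + γ) := by
      rw [key]
      have a1 : 0 < z - y := by linarith
      have a2 : 0 < y - x := by linarith
      have a3 : 0 < z - x := by linarith
      have a4 : 0 ≤ -α := by linarith
      positivity
    exact (pos_iff_pos_of_mul_pos this).1 (by linarith)

lemma line_bound {N : ℕ} (α β γ : Fin N → ℝ) {g : ℝ → ℝ} (hg : ContDiff ℝ 1 g)
    (hc : HasCompactSupport g) (hb : ∀ x, |g x| ≤ 1) :
    |∫ x in {s | ∀ j, 0 < α j * s ^ 2 + β j * s + γ j}, deriv g x| ≤ 2 ^ N * 2 := by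
  classical
  set T : (Fin N → Bool) → Set ℝ := fun b => {s | ∀ j, 0 < α j * s ^ 2 + β j * s + γ j ∧
    (b j = true ↔ -β j / (2 * α j) < s)} with hT
  have hU : {s | ∀ j, 0 < α j * s ^ 2 + β j * s + γ j} = ⋃ b, T b := by
    ext s
    simp only [mem_ofPred_eq, mem_iUnion, hT]
    constructor
    · intro h
      exact ⟨fun j => decide (-β j / (2 * α j) < s), fun j => ⟨h j, by simp⟩⟩
    · rintro ⟨b, h⟩ j
      exact (h j).1
  have hO : ∀ b, (T b).OrdConnected := by
    intro b
    refine ⟨fun x hx z hz y hy j => ?_⟩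
    have h1 := hx j
    have h2 := hz j
    constructor
    · apply quad_mid hy.1 hy.2 h1.1 h2.1
      by_cases hbj : b j = true
      · left; exact (h1.2.1 hbj).le
      · right; exact not_lt.1 (fun h => hbj (h2.2.2 h))
    · constructor
      · intro h; exact (h1.2.1 h).trans_le hy.1
      · intro h; exact h2.2.2 (h.trans_le hy.2)
  rw [hU, integral_iUnion_fintype (fun b => (hO b).measurableSet)]
  · refine (Finset.abs_sum_le_sum_abs _ _).trans ?_
    refine (Finset.sum_le_sum (fun b _ => ordConn_int (hO b) hg hc hb)).trans ?_
    simp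
  · intro b b' hbb
    rw [Function.onFun, Set.disjoint_left]
    intro s hs hs'
    apply hbb
    ext j
    have h1 := (hs j).2
    have h2 := (hs' j).2
    rw [Bool.eq_iff_iff, h1, h2]
  · intro b
    exact ((hg.continuous_deriv (by norm_num)).integrable_of_hasCompactSupport hc.deriv).integrableOn

def QuadCut {d : ℕ} (N : ℕ) (E : Set (Rd d)) : Prop :=
  ∀ x v : Rd d, ∃ α β γ : Fin N → ℝ, ∀ s : ℝ, x + s • v ∈ E ↔
    ∀ j, 0 < α j * s ^ 2 + β j * s + γ j

lemma slice_bound {N d : ℕ} {E : Set (Rd (d + 1))} (hE : MeasurableSet E) (hq : QuadCut N E)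
    {R : ℝ} (hR : 0 < R) {φ : Rd (d + 1) → Rd (d + 1)} (hφ : IsTest (ball 0 R) φ)
    (hb : ∀ x, ‖φ x‖ ≤ 1) (i : Fin (d + 1)) :
    |∫ x in E, fderiv ℝ φ x (EuclideanSpace.single i (1:ℝ)) i| ≤ 2 ^ N * 2 * (2 * R) ^ d := by
  set h : Rd (d + 1) → ℝ := fun x => fderiv ℝ φ x (EuclideanSpace.single i (1:ℝ)) i with hh
  have hcont : Continuous h := by
    have := hφ.cd.continuous_fderiv (by norm_num)
    fun_prop
  have hz : ∀ x, x ∉ tsupport φ → h x = 0 := by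
    intro x hx
    have : fderiv ℝ φ x = 0 := by
      by_contra h0
      exact hx (support_fderiv_subset ℝ (by simpa using h0))
    simp [hh, this]
  have hint : Integrable h :=
    hcont.integrable_of_hasCompactSupport (HasCompactSupport.intro hφ.cs hz)
  set e : ℝ × (Fin d → ℝ) ≃ᵐ Rd (d + 1) :=
    (MeasurableEquiv.piFinSuccAbove (fun _ : Fin (d + 1) => ℝ) i).symm.trans
      (MeasurableEquiv.toLp 2 (Fin (d + 1) → ℝ)) with he
  have hem : MeasurePreserving e volume volume :=
    (EuclideanSpace.volume_preserving_symm_measurableEquiv_toLp _).symm.comp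
    (volume_preserving_piFinSuccAbove (fun _ : Fin (d + 1) => ℝ) i).symm
  have hea : ∀ s y j, e (s, y) j = (i.insertNth s y : Fin (d + 1) → ℝ) j := by
    intro s y j; rfl
  have hei : ∀ s y, e (s, y) = e (0, y) + s • EuclideanSpace.single i (1:ℝ) := by
    intro s y
    ext j
    simp only [PiLp.add_apply, PiLp.smul_apply, hea]
    refine Fin.succAboveCases i ?_ (fun j => ?_) j
    · simp
    · simp
  have e1 : ∫ x in E, h x = ∫ y : Fin d → ℝ, ∫ s : ℝ, E.indicator h (e (s, y)) := by
    rw [← integral_indicator hE, ← hem.integral_comp e.measurableEmbedding, Measure.volume_eq_prod,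
      integral_prod_symm]
    exact (hem.integrable_comp_emb e.measurableEmbedding).2 (hint.indicator hE)
  have hin : ∀ y : Fin d → ℝ, |∫ s : ℝ, E.indicator h (e (s, y))| ≤ 2 ^ N * 2 := by
    intro y
    obtain ⟨α, β, γ, hq'⟩ := hq (e (0, y)) (EuclideanSpace.single i (1:ℝ))
    set g : ℝ → ℝ := fun s => φ (e (0, y) + s • EuclideanSpace.single i (1:ℝ)) i with hg
    have hgd : ∀ s, HasDerivAt g (h (e (s, y))) s := by
      intro s
      have h1 : HasFDerivAt φ (fderiv ℝ φ (e (s, y))) (e (0, y) + s • EuclideanSpace.single i (1:ℝ)) := by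
        rw [← hei]
        exact (hφ.cd.differentiable (by norm_num) _).hasFDerivAt
      have h2 : HasDerivAt (fun s : ℝ => e (0, y) + s • EuclideanSpace.single i (1:ℝ))
        (EuclideanSpace.single i (1:ℝ)) s := by
        have := ((hasDerivAt_id s).smul_const (EuclideanSpace.single i (1:ℝ) : Rd (d + 1))).const_add (e (0, y))
        rwa [one_smul] at this
      exact (EuclideanSpace.proj (𝕜 := ℝ) i).hasFDerivAt.comp_hasDerivAt s (h1.comp_hasDerivAt s h2)
    have hgc : ContDiff ℝ 1 g := by
      have h1 : ContDiff ℝ 1 (fun s : ℝ => φ (e (0, y) + s • EuclideanSpace.single i (1:ℝ))) :=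
        hφ.cd.comp (contDiff_const.add (contDiff_id.smul contDiff_const))
      exact (EuclideanSpace.proj (𝕜 := ℝ) i).contDiff.comp h1
    have hcs : HasCompactSupport g := by
      apply HasCompactSupport.intro (isCompact_Icc (a := -R) (b := R))
      intro s hs
      have : e (s, y) ∉ tsupport φ := by
        intro h'
        have h1 := hφ.ts h'
        rw [mem_ball_zero_iff] at h1
        have h2 := (PiLp.norm_apply_le (e (s, y)) i).trans h1.le
        rw [hea, Fin.insertNth_apply_same] at h2
        exact hs (abs_le.1 h2)
      simp only [hg, ← hei, image_eq_zero_of_notMem_tsupport this]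
      simp
    have hgb : ∀ s, |g s| ≤ 1 := fun s => (PiLp.norm_apply_le (φ _) i).trans (hb _)
    have := line_bound α β γ hgc hcs hgb
    convert this using 2
    rw [← integral_indicator]
    · congr 1
      ext s
      simp only [indicator, hei s y, hq', mem_ofPred_eq]
      split_ifs
      · rw [(hgd s).deriv, hei s y]
      · rfl
    · have : {s : ℝ | ∀ j, 0 < α j * s ^ 2 + β j * s + γ j} =
          ⋂ j, {s : ℝ | 0 < α j * s ^ 2 + β j * s + γ j} := by
        ext s; simp
      rw [this]
      refine MeasurableSet.iInter fun j => ?_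
      exact (isOpen_lt continuous_const (by fun_prop)).measurableSet
  have hout : ∀ y : Fin d → ℝ, y ∉ Icc (fun _ => -R) (fun _ => R) →
      ∫ s : ℝ, E.indicator h (e (s, y)) = 0 := by
    intro y hy
    have : ∀ s, E.indicator h (e (s, y)) = 0 := by
      intro s
      have : e (s, y) ∉ tsupport φ := by
        intro h'
        have h1 := hφ.ts h'
        rw [mem_ball_zero_iff] at h1
        have h2 : ∀ j, |y j| ≤ R := by
          intro j
          have h2 := (PiLp.norm_apply_le (e (s, y)) (i.succAbove j)).trans h1.le
          rwa [hea, Fin.insertNth_apply_succAbove] at h2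
        exact hy ⟨fun j => (abs_le.1 (h2 j)).1, fun j => (abs_le.1 (h2 j)).2⟩
      simp [indicator, hz _ this]
    simp [this]
  rw [e1, ← setIntegral_eq_integral_of_forall_compl_eq_zero hout]
  have := norm_setIntegral_le_of_norm_le_const (μ := volume)
    (s := Icc (fun _ : Fin d => -R) (fun _ => R))
    (f := fun y => ∫ s : ℝ, E.indicator h (e (s, y))) (C := 2 ^ N * 2) isCompact_Icc.measure_lt_top
    (fun y _ => hin y)
  refine this.trans (le_of_eq ?_)
  rw [measureReal_def, Real.volume_Icc_pi]
  simp only [sub_neg_eq_add, Finset.prod_const, Finset.card_univ, Fintype.card_fin,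
    ENNReal.toReal_pow]
  rw [ENNReal.toReal_ofReal (by linarith), two_mul R]

lemma quad_perim {N d : ℕ} {E : Set (Rd (d + 1))} (hE : MeasurableSet E) (hq : QuadCut N E)
    {R : ℝ} (hR : 0 < R) :
    perimOpen E (ball 0 R) ≤ ENNReal.ofReal ((d + 1) * (2 ^ N * 2 * 2 ^ d) * R ^ d) := by
  apply perimOpen_le
  intro φ hφ hb
  apply ENNReal.ofReal_le_ofReal
  unfold vdiv
  rw [integral_finsetSum]
  · refine (Finset.sum_le_sum (fun i _ => (le_abs_self _).trans (slice_bound hE hq hR hφ hb i))).trans ?_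
    simp [mul_pow]
    apply le_of_eq; ring
  · intro i _
    apply Integrable.integrableOn
    apply Continuous.integrable_of_hasCompactSupport
    · have := hφ.cd.continuous_fderiv (by norm_num)
      fun_prop
    · refine HasCompactSupport.intro hφ.cs (fun x hx => ?_)
      have : fderiv ℝ φ x = 0 := by
        by_contra h0
        exact hx (support_fderiv_subset ℝ (by simpa using h0))
      simp [this]

/-! ### Cells -/

def pa {d : ℕ} (q : Rd (d + 1)) : Rd d := WithLp.toLp 2 (fun i => q i.castSucc)
def pb {d : ℕ} (q : Rd (d + 1)) : ℝ := q (Fin.last d)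

lemma inner_split {d : ℕ} (y q : Rd (d + 1)) :
    inner ℝ y q = inner ℝ (pa y) (pa q) + pb y * pb q := by
  simp only [PiLp.inner_apply, Fin.sum_univ_castSucc, pa, pb, RCLike.inner_apply, conj_trivial]
  ring

lemma norm_split {d : ℕ} (y : Rd (d + 1)) : ‖y‖ ^ 2 = ‖pa y‖ ^ 2 + pb y ^ 2 := by
  rw [← real_inner_self_eq_norm_sq, inner_split, real_inner_self_eq_norm_sq]; ring

lemma ext_split {d : ℕ} {y q : Rd (d + 1)} (h1 : pa y = pa q) (h2 : pb y = pb q) : y = q := by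
  ext i
  refine Fin.lastCases h2 (fun j => ?_) i
  exact congrArg (fun v : Rd d => v j) h1

def mkP {d : ℕ} (a : Rd d) (b : ℝ) : Rd (d + 1) :=
  WithLp.toLp 2 (Fin.lastCases b (fun i => a i) : Fin (d + 1) → ℝ)

@[simp] lemma pa_mk {d : ℕ} (a : Rd d) (b : ℝ) : pa (mkP a b) = a := by
  ext i; simp [pa, mkP]
@[simp] lemma pb_mk {d : ℕ} (a : Rd d) (b : ℝ) : pb (mkP a b) = b := by
  simp [pb, mkP]

lemma pa_sub {d : ℕ} (y q : Rd (d + 1)) : pa (y - q) = pa y - pa q := by ext i; simp [pa]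
lemma pb_sub {d : ℕ} (y q : Rd (d + 1)) : pb (y - q) = pb y - pb q := by simp [pb]
lemma pa_smul {d : ℕ} (c : ℝ) (q : Rd (d + 1)) : pa (c • q) = c • pa q := by ext i; simp [pa]
lemma pb_smul {d : ℕ} (c : ℝ) (q : Rd (d + 1)) : pb (c • q) = c * pb q := by simp [pb]

lemma pole_mk {d : ℕ} : northPole d = mkP 0 1 := by
  apply ext_split
  · ext i; simp [pa, northPole, mkP]
  · simp [pb, northPole, mkP]

lemma stereo_eq {d : ℕ} (y : Rd (d + 1)) : stereoProj d y = (1 - pb y)⁻¹ • pa y := rfl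

def ff {d : ℕ} (q : Rd (d + 1)) (x : Rd d) : ℝ := 2 * inner ℝ x (pa q) + (‖x‖ ^ 2 - 1) * pb q

def cell {d N : ℕ} (p : Fin N → Rd (d + 1)) (k : Fin N) : Set (Rd d) :=
  {x | ∀ j, j ≠ k → ff (p j) x < ff (p k) x}

lemma pb_lt_one {d : ℕ} {y : Rd (d + 1)} (hy : ‖y‖ = 1) (hn : y ≠ northPole d) : pb y < 1 := by
  have h := norm_split y
  rw [hy] at h
  by_contra h1
  push Not at h1
  apply hn
  rw [pole_mk]
  have h2 : pb y = 1 := by nlinarith [sq_nonneg ‖pa y‖]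
  have h3 : ‖pa y‖ ^ 2 = 0 := by rw [h2] at h; linarith
  apply ext_split
  · simpa using h3
  · simpa using h2

lemma ff_stereo {d : ℕ} {y : Rd (d + 1)} (hy : ‖y‖ = 1) (hn : y ≠ northPole d) (q : Rd (d + 1)) :
    ff q (stereoProj d y) = 2 / (1 - pb y) * inner ℝ y q := by
  have h1 := pb_lt_one hy hn
  have h := norm_split y
  rw [hy] at h
  have h0 : (1 - pb y) ≠ 0 := by linarith
  rw [ff, stereo_eq, inner_split, norm_smul, mul_pow, inner_smul_left]
  have : ‖pa y‖ ^ 2 = (1 - pb y) * (1 + pb y) := by linarith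
  rw [this, norm_inv, inv_pow, Real.norm_eq_abs, sq_abs]
  simp
  field_simp
  ring

lemma voronoi_iff {d : ℕ} {y p q : Rd (d + 1)} (hp : ‖p‖ = 1) (hq : ‖q‖ = 1) :
    dist y p < dist y q ↔ inner ℝ y q < inner ℝ y p := by
  rw [dist_eq_norm, dist_eq_norm, ← sq_lt_sq₀ (norm_nonneg _) (norm_nonneg _),
    norm_sub_sq_real, norm_sub_sq_real, hp, hq]
  constructor <;> intro h <;> linarith

lemma stereo_surj {d : ℕ} (x : Rd d) : ∃ y : Rd (d + 1), ‖y‖ = 1 ∧ y ≠ northPole d ∧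
    stereoProj d y = x := by
  have h0 : (0:ℝ) < 1 + ‖x‖ ^ 2 := by positivity
  refine ⟨(1 + ‖x‖ ^ 2)⁻¹ • mkP ((2:ℝ) • x) (‖x‖ ^ 2 - 1), ?_, ?_, ?_⟩
  · set y := (1 + ‖x‖ ^ 2)⁻¹ • mkP ((2:ℝ) • x) (‖x‖ ^ 2 - 1) with hy
    have h2 : ‖y‖ ^ 2 = 1 := by
      rw [norm_split y, hy, pa_smul, pb_smul, pa_mk, pb_mk, norm_smul, norm_smul, norm_inv,
        Real.norm_of_nonneg h0.le]
      simp only [Real.norm_ofNat]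
      field_simp; ring
    rcases sq_eq_one_iff.1 h2 with h | h
    · exact h
    · have := norm_nonneg y; linarith
  · intro h
    have := congrArg pb h
    rw [pole_mk, pb_smul, pb_mk, pb_mk] at this
    field_simp at this
    linarith
  · rw [stereo_eq, pb_smul, pa_smul, pa_mk, pb_mk, smul_smul, smul_smul]
    have h1 : 1 - (1 + ‖x‖ ^ 2)⁻¹ * (‖x‖ ^ 2 - 1) = 2 * (1 + ‖x‖ ^ 2)⁻¹ := by field_simp; ring
    rw [h1]
    have : ((2 * (1 + ‖x‖ ^ 2)⁻¹)⁻¹ * ((1 + ‖x‖ ^ 2)⁻¹ * 2)) = 1 := by field_simp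
    rw [← mul_assoc] at this
    rw [this, one_smul]

lemma cell_eq {d N : ℕ} {p : Fin N → Rd (d + 1)} (hp : ∀ k, ‖p k‖ = 1) (k : Fin N) :
    stereoProj d '' {y : Rd (d + 1) | ‖y‖ = 1 ∧ y ≠ northPole d ∧
        ∀ j, j ≠ k → dist y (p k) < dist y (p j)} = cell p k := by
  have key : ∀ y : Rd (d + 1), ‖y‖ = 1 → y ≠ northPole d →
      (stereoProj d y ∈ cell p k ↔ ∀ j, j ≠ k → dist y (p k) < dist y (p j)) := by
    intro y hy hn
    have h1 := pb_lt_one hy hn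
    refine forall_congr' fun j => imp_congr_right fun _ => ?_
    rw [ff_stereo hy hn, ff_stereo hy hn, voronoi_iff (hp k) (hp j)]
    exact mul_lt_mul_iff_right₀ (div_pos two_pos (by linarith))
  ext x
  constructor
  · rintro ⟨y, ⟨h1, h2, h3⟩, rfl⟩
    exact (key y h1 h2).2 h3
  · intro hx
    obtain ⟨y, h1, h2, rfl⟩ := stereo_surj x
    exact ⟨y, ⟨h1, h2, (key y h1 h2).1 hx⟩, rfl⟩

lemma ff_cont {d : ℕ} (q : Rd (d + 1)) : Continuous (ff q) := by unfold ff; fun_prop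

lemma cell_open {d N : ℕ} (p : Fin N → Rd (d + 1)) (k : Fin N) : IsOpen (cell p k) := by
  have : cell p k = ⋂ j, {x | j ≠ k → ff (p j) x < ff (p k) x} := by ext x; simp [cell]
  rw [this]
  refine isOpen_iInter_of_finite fun j => ?_
  by_cases h : j = k
  · simp [h]
  · simp only [ne_eq, h, not_false_eq_true, forall_const]
    exact isOpen_lt (ff_cont _) (ff_cont _)

lemma cell_meas {d N : ℕ} (p : Fin N → Rd (d + 1)) (k : Fin N) : MeasurableSet (cell p k) :=
  (cell_open p k).measurableSet

lemma cell_disj {d N : ℕ} (p : Fin N → Rd (d + 1)) {k j : Fin N} (h : k ≠ j) {x}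
    (hk : x ∈ cell p k) (hj : x ∈ cell p j) : False :=
  lt_asymm (hk j h.symm) (hj k h)

lemma cell_quad {d N : ℕ} (p : Fin N → Rd (d + 1)) (k : Fin N) : QuadCut N (cell p k) := by
  classical
  intro x v
  refine ⟨fun j => if j = k then 0 else ‖v‖ ^ 2 * (pb (p k) - pb (p j)),
    fun j => if j = k then 0 else 2 * inner ℝ v (pa (p k) - pa (p j)) +
      2 * inner ℝ x v * (pb (p k) - pb (p j)),
    fun j => if j = k then 1 else ff (p k) x - ff (p j) x, fun s => ?_⟩
  refine forall_congr' fun j => ?_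
  by_cases h : j = k
  · simp [h]
  · simp only [ne_eq, h, not_false_eq_true, forall_const, if_false]
    rw [← sub_pos]
    apply iff_of_eq
    congr 1
    simp only [ff, inner_add_left, inner_smul_left, norm_add_sq_real, norm_smul, inner_smul_right,
      inner_sub_right, mul_pow, Real.norm_eq_abs, sq_abs, conj_trivial]
    ring

def goodP {d N : ℕ} (p : Fin N → Rd (d + 1)) : Prop :=
  Function.Injective p ∧ (∀ k, ‖p k‖ = 1) ∧
    (∀ i j i' j' : Fin N, i ≠ j → i' ≠ j' → dist (p i) (p j) = dist (p i') (p j'))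

lemma goodP.std {d N : ℕ} {p : Fin N → Rd (d + 1)} (h : goodP p) :
    IsStandardPartition (cell p) := by
  refine ⟨p, h.1, h.2.1, h.2.2, fun k => ?_⟩
  rw [cell_eq h.2.1]
  simp

lemma std_cell {d N : ℕ} {E : Fin N → Set (Rd d)} (h : IsStandardPartition E) :
    ∃ p : Fin N → Rd (d + 1), goodP p ∧ ∀ k, volume (E k ∆ cell p k) = 0 := by
  obtain ⟨p, h1, h2, h3, h4⟩ := h
  refine ⟨p, ⟨h1, h2, h3⟩, fun k => ?_⟩
  rw [← cell_eq h2]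
  exact h4 k

/-! ### Boundedness of cells, cluster minimality -/

lemma quad_dom {d : ℕ} (a : Rd d) {β : ℝ} (hβ : 0 < β) :
    ∀ᶠ R in atTop, ∀ x : Rd d, R ≤ ‖x‖ → 2 * inner ℝ x a < (‖x‖ ^ 2 - 1) * β := by
  filter_upwards [eventually_gt_atTop (1:ℝ), eventually_gt_atTop ((2 * ‖a‖ + β) / β)] with R h1 h2 x hx
  have h3 := real_inner_le_norm x a
  rw [div_lt_iff₀ hβ] at h2
  have h4 : 2 * ‖a‖ + β < ‖x‖ * β := by nlinarith
  nlinarith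

lemma ff_sub {d : ℕ} (p q : Rd (d + 1)) (x : Rd d) :
    ff p x - ff q x = 2 * inner ℝ x (pa p - pa q) + (‖x‖ ^ 2 - 1) * (pb p - pb q) := by
  simp only [ff, inner_sub_right]; ring

lemma ff_dom {d : ℕ} {p q : Rd (d + 1)} (h : pb p < pb q) :
    ∀ᶠ R in atTop, ∀ x : Rd d, R ≤ ‖x‖ → ff p x < ff q x := by
  filter_upwards [quad_dom (pa p - pa q) (sub_pos.2 h)] with R hR x hx
  have := hR x hx
  have := ff_sub p q x
  nlinarith

lemma cell_bdd {d N : ℕ} {p : Fin N → Rd (d + 1)} {k j : Fin N} (h : pb (p k) < pb (p j)) :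
    ∀ᶠ R in atTop, cell p k ⊆ ball 0 R := by
  filter_upwards [ff_dom h] with R hR x hx
  by_contra hxR
  rw [mem_ball_zero_iff, not_lt] at hxR
  have h1 := hx j (by rintro rfl; exact lt_irrefl _ h)
  exact lt_asymm h1 (hR x hxR)

lemma cell_cobdd {d N : ℕ} {p : Fin N → Rd (d + 1)} {k : Fin N}
    (h : ∀ j, j ≠ k → pb (p j) < pb (p k)) :
    ∀ᶠ R in atTop, (ball 0 R)ᶜ ⊆ cell p k := by
  have : ∀ᶠ R in atTop, ∀ j, j ≠ k → ∀ x : Rd d, R ≤ ‖x‖ → ff (p j) x < ff (p k) x := by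
    rw [eventually_all]
    intro j
    by_cases hj : j = k
    · simp [hj]
    · filter_upwards [ff_dom (h j hj)] with R hR _ using hR
  filter_upwards [this] with R hR x hx j hj
  rw [mem_compl_iff, mem_ball_zero_iff, not_lt] at hx
  exact hR j hj x hx

def Hyp (d N : ℕ) : Prop := ∀ E : Fin N → Set (Rd d),
      IsPartition Set.univ E → IsStandardPartition E →
      (∃! i : Fin N, volume (E i) = ⊤) →
      ∀ F : Fin N → Set (Rd d), IsPartition Set.univ F →
        (∀ k, volume (E k) ≠ ⊤ → volume (F k) = volume (E k)) →
        partPerim E Set.univ ≤ partPerim F Set.univ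

lemma volume_top_of_compl {d : ℕ} {S : Set (Rd (d + 1))} {R : ℝ} (h : (ball 0 R)ᶜ ⊆ S) :
    volume S = ⊤ := by
  have h1 : volume (univ : Set (Rd (d + 1))) = ⊤ := measure_univ_of_isAddLeftInvariant _
  have h2 : (univ : Set (Rd (d + 1))) ⊆ ball 0 R ∪ S := by
    intro x _
    by_cases hx : x ∈ ball 0 R
    · exact Or.inl hx
    · exact Or.inr (h hx)
  have h3 := (measure_mono h2).trans (measure_union_le (μ := volume) _ _)
  rw [h1, top_le_iff, ENNReal.add_eq_top] at h3
  exact h3.resolve_left measure_ball_lt_top.ne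

lemma perimOpen_zero_of_disj {d : ℕ} {E U : Set (Rd d)} (h : Disjoint E U) : perimOpen E U = 0 := by
  apply le_antisymm _ (zero_le)
  apply perimOpen_le
  intro φ hφ _
  rw [setIntegral_eq_zero_of_forall_eq_zero]
  · simp
  · intro x hx
    exact vdiv_eq_zero (fun h' => (Set.disjoint_left.1 h) hx (hφ.ts h'))

lemma perimOpen_zero_of_sub {d : ℕ} {E U : Set (Rd d)} (h : U ⊆ E) : perimOpen E U = 0 := by
  apply le_antisymm _ (zero_le)
  apply perimOpen_le
  intro φ hφ _
  rw [setIntegral_eq_integral_of_forall_compl_eq_zero, int_vdiv hφ.cd hφ.cs]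
  · simp
  · intro x hx
    exact vdiv_eq_zero (fun h' => hx (h (hφ.ts h')))

lemma cell_perim_ball {d N : ℕ} (p : Fin N → Rd (d + 1 + 1)) (k : Fin N) (R : ℝ) :
    perimOpen (cell p k) (ball 0 R) ≠ ⊤ := by
  have h := quad_perim (cell_meas p k) (cell_quad p k) (R := max R 1) (by positivity)
  exact ((perimOpen_mono (ball_subset_ball (le_max_left R 1))).trans_lt
    (h.trans_lt ENNReal.ofReal_lt_top)).ne

lemma cell_perim_univ {d N : ℕ} {p : Fin N → Rd (d + 1 + 1)} {k₁ : Fin N}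
    (h : ∀ j, j ≠ k₁ → pb (p j) < pb (p k₁)) (k : Fin N) : perimOpen (cell p k) univ ≠ ⊤ := by
  obtain ⟨R, hR⟩ := (cell_cobdd h).exists
  have h1 := perimOpen_le_add' (cell p k) (V := univ) (B := closedBall 0 R) (U := ball 0 (R + 1))
    isClosed_closedBall isOpen_ball (closedBall_subset_ball (by linarith))
  have hs : univ \ closedBall (0 : Rd (d + 1)) R ⊆ cell p k₁ := by
    intro x hx
    apply hR
    exact fun h' => hx.2 (ball_subset_closedBall h')
  have h2 : perimOpen (cell p k) (univ \ closedBall 0 R) = 0 := by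
    by_cases hk : k = k₁
    · subst hk; exact perimOpen_zero_of_sub hs
    · apply perimOpen_zero_of_disj
      rw [Set.disjoint_left]
      intro x hx hx'
      exact cell_disj p hk hx (hs hx')
  rw [h2, add_zero] at h1
  exact (h1.trans_lt (cell_perim_ball p k _).lt_top).ne

lemma cluster_min {d N : ℕ} (hyp : Hyp (d + 1) N) {p : Fin N → Rd (d + 1 + 1)} (hp : goodP p)
    (hpart : IsPartition univ (cell p)) {k₁ : Fin N}
    (h : ∀ j, j ≠ k₁ → pb (p j) < pb (p k₁)) {B : Set (Rd (d + 1))} (hB : IsClosed B)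
    {F : Fin N → Set (Rd (d + 1))} (hF : IsPartition univ F)
    (hEF : ∀ k, volume ((cell p k ∆ F k) \ B) = 0)
    (hv : ∀ k, k ≠ k₁ → volume (F k) = volume (cell p k)) :
    ∑ k, perim (cell p k) B ≤ ∑ k, perim (F k) B := by
  obtain ⟨R, hR⟩ := (cell_cobdd h).exists
  have htop : volume (cell p k₁) = ⊤ := volume_top_of_compl hR
  have hfin : ∀ k, k ≠ k₁ → volume (cell p k) ≠ ⊤ := by
    intro k hk
    obtain ⟨R, hR⟩ := (cell_bdd (h k hk)).exists
    exact ((measure_mono hR).trans_lt measure_ball_lt_top).ne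
  have h1 := hyp (cell p) hpart hp.std ⟨k₁, htop, fun k hk => by
    by_contra h'; exact hfin k h' hk⟩ F hF (fun k hk => hv k (by rintro rfl; exact hk htop))
  unfold partPerim at h1
  simp only [perim_univ] at h1
  have h2 : ∑ k, perimOpen (cell p k) univ ≤ ∑ k, perimOpen (F k) univ + 0 := by
    rw [add_zero]
    have := mul_le_mul_left h1 2
    rwa [ENNReal.div_mul_cancel (by norm_num) (by norm_num),
      ENNReal.div_mul_cancel (by norm_num) (by norm_num)] at this
  have := perim_le_of_perimOpen_le hB isOpen_univ (subset_univ _) (cell_meas p) hF.1 hEF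
    (cell_perim_univ h) h2
  rwa [add_zero] at this

/-! ### The inversion -/

def sg {d : ℕ} (z : Rd d) (x : Rd d) : Rd d :=
  EuclideanGeometry.inversion z (Real.sqrt (1 + ‖z‖ ^ 2)) x

def lam {d : ℕ} (z x : Rd d) : ℝ := (1 + ‖z‖ ^ 2) / ‖x - z‖ ^ 2

lemma sg_rad {d : ℕ} (z : Rd d) : Real.sqrt (1 + ‖z‖ ^ 2) ≠ 0 := by positivity

lemma sg_inv {d : ℕ} (z : Rd d) : Function.Involutive (sg z) :=
  EuclideanGeometry.inversion_involutive z (sg_rad z)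

lemma sg_ne {d : ℕ} {z x : Rd d} : sg z x ≠ z ↔ x ≠ z :=
  (EuclideanGeometry.inversion_eq_center (sg_rad z)).not

lemma lam_eq {d : ℕ} (z x : Rd d) : (Real.sqrt (1 + ‖z‖ ^ 2) / dist x z) ^ 2 = lam z x := by
  rw [div_pow, Real.sq_sqrt (by positivity), dist_eq_norm, lam]

lemma sg_eq {d : ℕ} (z x : Rd d) : sg z x = lam z x • (x - z) + z := by
  rw [sg, EuclideanGeometry.inversion_def]
  simp only [vsub_eq_sub, vadd_eq_add, lam_eq]

lemma lam_pos {d : ℕ} {z x : Rd d} (h : x ≠ z) : 0 < lam z x := by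
  have : 0 < ‖x - z‖ := norm_pos_iff.2 (sub_ne_zero.2 h)
  unfold lam; positivity

lemma sg_image {d : ℕ} (z : Rd d) (S : Set (Rd d)) : sg z '' S = sg z ⁻¹' S :=
  congrFun (sg_inv z).image_eq_preimage_symm S

lemma sg_norm {d : ℕ} {z x : Rd d} (h : x ≠ z) : 1 + ‖sg z x‖ ^ 2 = lam z x * (1 + ‖x‖ ^ 2) := by
  have h0 : 0 < ‖x - z‖ := norm_pos_iff.2 (sub_ne_zero.2 h)
  have hD := norm_sub_sq_real x z
  have hl : lam z x * ‖x - z‖ ^ 2 = 1 + ‖z‖ ^ 2 := by unfold lam; field_simp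
  rw [sg_eq, norm_add_sq_real, inner_smul_left, inner_sub_left, norm_smul, mul_pow,
    real_inner_self_eq_norm_sq, Real.norm_eq_abs, sq_abs]
  simp only [conj_trivial]
  have : lam z x ^ 2 * ‖x - z‖ ^ 2 = lam z x * (1 + ‖z‖ ^ 2) := by rw [← hl]; ring
  rw [this]
  rw [hD] at hl
  linear_combination -hl

/-- reflected point -/
def Qr {d : ℕ} (z : Rd d) : Rd (d + 1) ≃ₗᵢ[ℝ] Rd (d + 1) :=
  (Submodule.span ℝ {mkP z (-1)})ᗮ.reflection

lemma Qr_apply {d : ℕ} (z : Rd d) (p : Rd (d + 1)) :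
    Qr z p = p - (2 * (inner ℝ (pa p) z - pb p) / (1 + ‖z‖ ^ 2)) • mkP z (-1) := by
  rw [Qr, Submodule.reflection_orthogonal_apply, Submodule.reflection_singleton_apply]
  have : (‖mkP z (-1)‖ : ℝ) ^ 2 = 1 + ‖z‖ ^ 2 := by
    rw [norm_split, pa_mk, pb_mk]; ring
  simp only [RCLike.ofReal_real_eq_id, id, this]
  rw [inner_split, pa_mk, pb_mk, real_inner_comm, neg_sub, ← Nat.cast_smul_eq_nsmul ℝ, smul_smul]
  congr 2
  push_cast
  ring

lemma pa_Qr {d : ℕ} (z : Rd d) (p : Rd (d + 1)) :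
    pa (Qr z p) = pa p - (2 * (inner ℝ (pa p) z - pb p) / (1 + ‖z‖ ^ 2)) • z := by
  rw [Qr_apply, pa_sub, pa_smul, pa_mk]

lemma pb_Qr {d : ℕ} (z : Rd d) (p : Rd (d + 1)) : pb (Qr z p) = ff p z / (1 + ‖z‖ ^ 2) := by
  rw [Qr_apply, pb_sub, pb_smul, pb_mk, ff, real_inner_comm]
  have : (1 + ‖z‖ ^ 2) ≠ 0 := by positivity
  field_simp
  ring

lemma ff_sg {d : ℕ} {z x : Rd d} (h : x ≠ z) (p : Rd (d + 1)) :
    ff p (sg z x) = lam z x * ff (Qr z p) x := by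
  have h0 : 0 < ‖x - z‖ := norm_pos_iff.2 (sub_ne_zero.2 h)
  have hA : (1 + ‖z‖ ^ 2) ≠ 0 := by positivity
  have hD := norm_sub_sq_real x z
  have hl : lam z x * ‖x - z‖ ^ 2 = 1 + ‖z‖ ^ 2 := by unfold lam; field_simp
  have hn := sg_norm h
  have h1 : ‖sg z x‖ ^ 2 - 1 = lam z x * (1 + ‖x‖ ^ 2) - 2 := by linarith
  rw [ff, h1, ff, pa_Qr, pb_Qr, sg_eq, inner_add_left, inner_smul_left, inner_sub_left,
    inner_sub_right, inner_smul_right, ff, real_inner_comm z (pa p)]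
  simp only [conj_trivial]
  rw [hD] at hl
  field_simp
  linear_combination (2 * pb p - 2 * inner ℝ z (pa p)) * hl

lemma goodP.Qr {d N : ℕ} {p : Fin N → Rd (d + 1)} (h : goodP p) (z : Rd d) :
    goodP (fun k => Qr z (p k)) := by
  refine ⟨(_root_.Qr z).injective.comp h.1, fun k => ?_, fun i j i' j' h1 h2 => ?_⟩
  · simp [h.2.1 k]
  · simp only [LinearIsometryEquiv.dist_map]
    exact h.2.2 i j i' j' h1 h2

lemma cell_sg {d N : ℕ} (p : Fin N → Rd (d + 1)) {z x : Rd d} (h : x ≠ z) (k : Fin N) :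
    sg z x ∈ cell p k ↔ x ∈ cell (fun k => Qr z (p k)) k := by
  refine forall_congr' fun j => imp_congr_right fun _ => ?_
  rw [ff_sg h, ff_sg h]
  exact mul_lt_mul_iff_right₀ (lam_pos h)

lemma sg_cdA {d : ℕ} {z x : Rd d} (h : x ≠ z) : ContDiffAt ℝ 2 (sg z) x :=
  ContDiffAt.inversion contDiffAt_const contDiffAt_const contDiffAt_id h

lemma sg_fderiv {d : ℕ} {z x : Rd d} (h : x ≠ z) :
    fderiv ℝ (sg z) x = lam z x • ((Submodule.span ℝ {x - z})ᗮ.reflection : Rd d →L[ℝ] Rd d) := by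
  rw [← lam_eq]
  exact (EuclideanGeometry.hasFDerivAt_inversion h).fderiv

lemma sg_fderiv_norm {d : ℕ} {z x : Rd d} (h : x ≠ z) (v : Rd d) :
    ‖fderiv ℝ (sg z) x v‖ = lam z x * ‖v‖ := by
  rw [sg_fderiv h]
  have : ‖lam z x • (Submodule.span ℝ {x - z})ᗮ.reflection v‖ = lam z x * ‖v‖ := by
    rw [norm_smul, LinearIsometryEquiv.norm_map, Real.norm_of_nonneg (lam_pos h).le]
  exact this

lemma sg_det {d : ℕ} {z x : Rd d} (h : x ≠ z) :
    |(fderiv ℝ (sg z) x).det| = lam z x ^ d := by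
  rw [sg_fderiv h, ContinuousLinearMap.det]
  set L : Rd d →L[ℝ] Rd d := ((Submodule.span ℝ {x - z})ᗮ.reflection : Rd d →L[ℝ] Rd d) with hL
  have hdet : |LinearMap.det (L : Rd d →ₗ[ℝ] Rd d)| = 1 := by
    have h1 : (L : Rd d →ₗ[ℝ] Rd d) ∘ₗ (L : Rd d →ₗ[ℝ] Rd d) = LinearMap.id := by
      ext1 v
      exact (Submodule.span ℝ {x - z})ᗮ.reflection_reflection v
    have h2 := congrArg LinearMap.det h1
    rw [LinearMap.det_comp, LinearMap.det_id, ← sq, sq_eq_one_iff] at h2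
    rcases h2 with h2 | h2 <;> simp [h2]
  have : ((lam z x • L : Rd d →L[ℝ] Rd d) : Rd d →ₗ[ℝ] Rd d) = lam z x • (L : Rd d →ₗ[ℝ] Rd d) := rfl
  rw [this, LinearMap.det_smul, abs_mul, hdet, mul_one, abs_pow, abs_of_pos (lam_pos h)]
  simp

lemma sg_diffeo {d : ℕ} {z : Rd d} {U : Set (Rd d)} (hU : IsOpen U) (hz : z ∉ U) :
    DiffeoOn (sg z) (sg z) U (sg z '' U) := by
  have hne : ∀ x ∈ U, x ≠ z := by rintro x hx rfl; exact hz hx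
  have hne' : ∀ y ∈ sg z '' U, y ≠ z := by
    rintro _ ⟨x, hx, rfl⟩; exact sg_ne.2 (hne x hx)
  refine ⟨sg_inv z, sg_inv z, hU, ?_, rfl, ?_, ?_⟩
  · rw [isOpen_iff_mem_nhds]
    intro y hy
    have h1 : ContinuousAt (sg z) y := (sg_cdA (hne' y hy)).continuousAt
    rw [sg_image] at hy ⊢
    exact h1.preimage_mem_nhds (hU.mem_nhds hy)
  · exact fun x hx => (sg_cdA (hne x hx)).contDiffWithinAt
  · exact fun x hx => (sg_cdA (hne' x hx)).contDiffWithinAt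

lemma sg_meas {d : ℕ} (z : Rd d) : Measurable (sg z) := by
  have : sg z = fun x => lam z x • (x - z) + z := by ext1 x; exact sg_eq z x
  rw [this]
  unfold lam
  fun_prop

lemma sg_image_meas {d : ℕ} (z : Rd d) {S : Set (Rd d)} (hS : MeasurableSet S) :
    MeasurableSet (sg z '' S) := by
  rw [sg_image]; exact sg_meas z hS

lemma sg_null {d : ℕ} (z : Rd (d + 1)) {S : Set (Rd (d + 1))} (hS : volume S = 0) :
    volume (sg z '' S) = 0 := by
  have h1 : volume (sg z '' (S \ {z})) = 0 := by
    apply addHaar_image_eq_zero_of_differentiableOn_of_addHaar_eq_zero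
    · intro x hx
      exact ((sg_cdA hx.2).differentiableAt (by norm_num)).differentiableWithinAt
    · exact measure_mono_null sdiff_subset hS
  refine measure_mono_null (t := sg z '' (S \ {z}) ∪ {sg z z}) ?_ (measure_union_null h1 (by simp))
  rintro _ ⟨x, hx, rfl⟩
  by_cases hxz : x = z
  · right; simp [hxz]
  · left; exact ⟨x, ⟨hx, hxz⟩, rfl⟩

lemma cell_sg_ae {d N : ℕ} (p : Fin N → Rd (d + 1 + 1)) (z : Rd (d + 1)) (k : Fin N) :
    volume (cell (fun k => Qr z (p k)) k ∆ (sg z '' cell p k)) = 0 := by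
  refine measure_mono_null (t := {z}) ?_ (by simp)
  intro x hx
  by_contra h
  have h1 := cell_sg p (z := z) (x := x) h k
  rw [sg_image, mem_symmDiff, mem_preimage, h1] at hx
  tauto

lemma part_image {d N : ℕ} {E : Fin N → Set (Rd d)} (hE : IsPartition univ E) {Φ : Rd d → Rd d}
    (hΦ : Function.Bijective Φ) (hm : ∀ k, MeasurableSet (Φ '' E k))
    (hn : ∀ S, volume S = 0 → volume (Φ '' S) = 0) : IsPartition univ (fun k => Φ '' E k) := by
  refine ⟨hm, fun k j h => ?_, ?_⟩
  · rw [← image_inter hΦ.1, inter_univ]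
    apply hn
    have := hE.2.1 k j h
    rwa [inter_univ] at this
  · refine measure_mono_null ?_ (hn _ hE.2.2)
    intro y hy
    obtain ⟨x, rfl⟩ := hΦ.2 y
    refine ⟨x, ⟨mem_univ _, fun hx => hy.2 ?_⟩, rfl⟩
    obtain ⟨k, hk⟩ := mem_iUnion.1 hx
    exact mem_iUnion.2 ⟨k, x, hk, rfl⟩

lemma part_congr {d N : ℕ} {E F : Fin N → Set (Rd d)} (hE : IsPartition univ E)
    (hF : ∀ k, MeasurableSet (F k)) (h : ∀ k, volume (E k ∆ F k) = 0) : IsPartition univ F := by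
  refine ⟨hF, fun k j hkj => ?_, ?_⟩
  · refine measure_mono_null (t := (E k ∩ E j ∩ univ) ∪ (E k ∆ F k) ∪ (E j ∆ F j)) ?_
      (measure_union_null (measure_union_null (hE.2.1 k j hkj) (h k)) (h j))
    intro x hx
    simp only [mem_union, mem_inter_iff, mem_univ, mem_symmDiff] at *
    tauto
  · refine measure_mono_null (t := (univ \ ⋃ k, E k) ∪ ⋃ k, (E k ∆ F k)) ?_
      (measure_union_null hE.2.2 (measure_iUnion_null h))
    intro x hx
    by_cases h' : ∃ k, x ∈ E k
    · obtain ⟨k, hk⟩ := h'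
      right
      exact mem_iUnion.2 ⟨k, Or.inl ⟨hk, fun h => hx.2 (mem_iUnion.2 ⟨k, h⟩)⟩⟩
    · left
      exact ⟨mem_univ _, fun h => h' (mem_iUnion.1 h)⟩

lemma part_cell_Qr {d N : ℕ} {p : Fin N → Rd (d + 1 + 1)} (h : IsPartition univ (cell p))
    (z : Rd (d + 1)) : IsPartition univ (cell (fun k => Qr z (p k))) := by
  refine part_congr (part_image h (sg_inv z).bijective
    (fun k => sg_image_meas z (cell_meas p k)) (fun S => sg_null z)) (cell_meas _) (fun k => ?_)
  rw [symmDiff_comm]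
  exact cell_sg_ae p z k

/-! ### Asymptotics of the inversions -/

lemma lam_unif {d : ℕ} {a : Rd d} (ha : a ≠ 0) (R : ℝ) {ε : ℝ} (hε : 0 < ε) :
    ∀ᶠ s : ℝ in atTop, ∀ x : Rd d, ‖x‖ ≤ R → x ≠ s • a ∧ |lam (s • a) x - 1| ≤ ε := by
  have ha' : 0 < ‖a‖ := norm_pos_iff.2 ha
  have ht : Tendsto (fun s : ℝ => s * ‖a‖) atTop atTop := tendsto_id.atTop_mul_const ha'
  filter_upwards [eventually_gt_atTop 0, ht.eventually_ge_atTop (2 * R + 1), ht.eventually_ge_atTop 1,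
    ht.eventually_ge_atTop (4 * (R + 1) ^ 2 / ε)] with s hs h1 h2 h3 x hx
  have hR : 0 ≤ R := (norm_nonneg x).trans hx
  have hz : ‖s • a‖ = s * ‖a‖ := by rw [norm_smul, Real.norm_of_nonneg hs.le]
  set z := s • a
  rw [← hz] at h1 h2 h3
  have h4 : ‖z‖ - R ≤ ‖x - z‖ := by
    have := norm_sub_norm_le z x
    rw [norm_sub_rev] at this; linarith
  have h5 : ‖z‖ / 2 ≤ ‖x - z‖ := by linarith
  have h6 : 0 < ‖x - z‖ := by linarith
  refine ⟨fun h => by rw [h, sub_self, norm_zero] at h6; exact lt_irrefl _ h6, ?_⟩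
  have hD := norm_sub_sq_real x z
  have hi := abs_le.1 (abs_real_inner_le_norm x z)
  have e : lam z x - 1 = (1 + 2 * inner ℝ x z - ‖x‖ ^ 2) / ‖x - z‖ ^ 2 := by
    unfold lam
    rw [eq_div_iff (by positivity), sub_mul, div_mul_cancel₀ _ (by positivity), hD]; ring
  rw [e, abs_div, abs_of_pos (by positivity : 0 < ‖x - z‖ ^ 2), div_le_iff₀ (by positivity)]
  have h7 : |1 + 2 * inner ℝ x z - ‖x‖ ^ 2| ≤ (R + 1) ^ 2 * ‖z‖ := by
    have : ‖x‖ * ‖z‖ ≤ R * ‖z‖ := by gcongr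
    have : ‖x‖ ^ 2 ≤ R ^ 2 := by gcongr
    rw [abs_le]; constructor <;> nlinarith [sq_nonneg ‖x‖, sq_nonneg R]
  rw [div_le_iff₀ hε] at h3
  have h8 : (‖z‖ / 2) ^ 2 ≤ ‖x - z‖ ^ 2 := by gcongr
  nlinarith

lemma sg_ball {d : ℕ} {a : Rd d} (ha : a ≠ 0) {R : ℝ} (hR : 0 ≤ R) :
    ∀ᶠ s : ℝ in atTop, ∀ x : Rd d, ‖x‖ ≤ R → ‖sg (s • a) x‖ < R + 1 := by
  filter_upwards [lam_unif ha R (ε := 1 / (2 * (1 + R ^ 2))) (by positivity)] with s hs x hx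
  obtain ⟨h1, h2⟩ := hs x hx
  have h3 := sg_norm h1
  have h4 := (abs_le.1 h2).2
  have h5 : ‖x‖ ^ 2 ≤ R ^ 2 := by gcongr
  have h6 : lam (s • a) x * (1 + ‖x‖ ^ 2) ≤ (1 + 1 / (2 * (1 + R ^ 2))) * (1 + R ^ 2) := by
    have := lam_pos h1
    gcongr
    linarith
  have h7 : (1 + 1 / (2 * (1 + R ^ 2))) * (1 + R ^ 2) = 1 + R ^ 2 + 1 / 2 := by field_simp
  apply lt_of_pow_lt_pow_left₀ 2 (by positivity)
  nlinarith

def rho {d : ℕ} (a : Rd d) : Rd d ≃ₗᵢ[ℝ] Rd d := (Submodule.span ℝ {a})ᗮ.reflection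

lemma rho_apply {d : ℕ} (a x : Rd d) :
    rho a x = x + (-2 * inner ℝ x a / ‖a‖ ^ 2) • a := by
  rw [rho, Submodule.reflection_orthogonal_apply, Submodule.reflection_singleton_apply]
  simp only [RCLike.ofReal_real_eq_id, id]
  rw [real_inner_comm, neg_sub, ← Nat.cast_smul_eq_nsmul ℝ, smul_smul, sub_eq_add_neg, ← neg_smul]
  congr 2
  push_cast
  ring

lemma sg_lim {d : ℕ} {a : Rd d} (ha : a ≠ 0) (x : Rd d) :
    Tendsto (fun s : ℝ => lam (s • a) x) atTop (𝓝 1) ∧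
    Tendsto (fun s : ℝ => sg (s • a) x) atTop (𝓝 (rho a x)) := by
  have ha' : 0 < ‖a‖ := norm_pos_iff.2 ha
  have h1 : Tendsto (fun s : ℝ => lam (s • a) x) atTop (𝓝 1) := by
    rw [Metric.tendsto_nhds]
    intro ε hε
    filter_upwards [lam_unif ha ‖x‖ (half_pos hε)] with s hs
    rw [Real.dist_eq]
    linarith [(hs x le_rfl).2]
  refine ⟨h1, ?_⟩
  have h2 : Tendsto (fun s : ℝ => (1 - lam (s • a) x) * s) atTop (𝓝 (-2 * inner ℝ x a / ‖a‖ ^ 2)) := by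
    have h3 : Tendsto (fun s : ℝ => (-2 * inner ℝ x a + (‖x‖ ^ 2 - 1) * s⁻¹) /
        (‖a‖ ^ 2 + (-2 * inner ℝ x a) * s⁻¹ + ‖x‖ ^ 2 * (s⁻¹ * s⁻¹))) atTop
        (𝓝 ((-2 * inner ℝ x a + (‖x‖ ^ 2 - 1) * 0) /
        (‖a‖ ^ 2 + (-2 * inner ℝ x a) * 0 + ‖x‖ ^ 2 * (0 * 0)))) := by
      have hi : Tendsto (fun s : ℝ => s⁻¹) atTop (𝓝 0) := tendsto_inv_atTop_zero
      apply Tendsto.div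
      · exact tendsto_const_nhds.add (hi.const_mul _)
      · exact (tendsto_const_nhds.add (hi.const_mul _)).add ((hi.mul hi).const_mul _)
      · simp [ha]
    simp only [mul_zero, add_zero] at h3
    refine h3.congr' ?_
    filter_upwards [eventually_gt_atTop 0, lam_unif ha ‖x‖ one_pos] with s hs hs'
    have hne := (hs' x le_rfl).1
    have h6 : 0 < ‖x - s • a‖ := norm_pos_iff.2 (sub_ne_zero.2 hne)
    have hD := norm_sub_sq_real x (s • a)
    rw [inner_smul_right, norm_smul, mul_pow, Real.norm_eq_abs, sq_abs] at hD
    have h7 : ‖a‖ ^ 2 + (-2 * inner ℝ x a) * s⁻¹ + ‖x‖ ^ 2 * (s⁻¹ * s⁻¹) = ‖x - s • a‖ ^ 2 / s ^ 2 := by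
      rw [hD]; field_simp; ring
    have h8 : 1 - lam (s • a) x = (‖x - s • a‖ ^ 2 - (1 + s ^ 2 * ‖a‖ ^ 2)) / ‖x - s • a‖ ^ 2 := by
      unfold lam
      rw [norm_smul, mul_pow, Real.norm_eq_abs, sq_abs]
      field_simp
    rw [h7, h8]
    have h9 : ‖x - s • a‖ ^ 2 - (1 + s ^ 2 * ‖a‖ ^ 2) = ‖x‖ ^ 2 - 2 * (s * inner ℝ x a) - 1 := by
      rw [hD]; ring
    rw [h9]
    field_simp
    ring
  have h3 : ∀ s : ℝ, sg (s • a) x = lam (s • a) x • x + ((1 - lam (s • a) x) * s) • a := by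
    intro s
    rw [sg_eq]
    module
  simp_rw [h3]
  rw [rho_apply]
  have := (h1.smul_const x).add (h2.smul_const a)
  rwa [one_smul] at this

structure GoodF {d : ℕ} (X : Rd d → Rd d) : Prop where
  cd : ContDiff ℝ 2 X
  cs : HasCompactSupport X
  ct : ∃ r > 0, ∀ x, ‖x‖ < r → X x = X 0

lemma GoodF.test {d : ℕ} {X : Rd d → Rd d} (h : GoodF X) : IsTest univ X :=
  ⟨h.cd.of_le (by norm_num), h.cs, subset_univ _⟩

lemma const_of_conv {d : ℕ} {u : Rd d → ℝ} (hu : LocallyIntegrable u)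
    (h : ∀ φ : Rd d → ℝ, ContDiff ℝ 2 φ → HasCompactSupport φ → ∀ v x : Rd d,
      ∫ y, u y * fderiv ℝ φ (x - y) v = 0) :
    ∃ c, ∀ᵐ x, u x = c := by
  let φ : ℕ → ContDiffBump (0 : Rd d) := fun n =>
    ⟨1 / ((n : ℝ) + 1), 2 * (1 / ((n : ℝ) + 1)), by positivity, by
      have : (0:ℝ) < 1 / ((n : ℝ) + 1) := by positivity
      linarith⟩
  have hlim := ContDiffBump.ae_convolution_tendsto_right_of_locallyIntegrable (g := u) (μ := volume)
    (φ := φ) (l := atTop) (K := 2) (by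
      have := tendsto_one_div_add_atTop_nhds_zero_nat (𝕜 := ℝ)
      simpa [φ] using this.const_mul 2) (by simp [φ]) hu
  have hconst : ∀ n x y, (convolution ((φ n).normed volume) u (ContinuousLinearMap.lsmul ℝ ℝ) volume) x =
      (convolution ((φ n).normed volume) u (ContinuousLinearMap.lsmul ℝ ℝ) volume) y := by
    intro n
    have hcd : ContDiff ℝ 2 ((φ n).normed volume) := (φ n).contDiff_normed
    have hcs : HasCompactSupport ((φ n).normed volume) := (φ n).hasCompactSupport_normed
    have hd := fun x => hcs.hasFDerivAt_convolution_left (ContinuousLinearMap.lsmul ℝ ℝ)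
      (hcd.of_le (by norm_num)) hu x
    have h0 : ∀ x, fderiv ℝ (convolution ((φ n).normed volume) u (ContinuousLinearMap.lsmul ℝ ℝ) volume) x = 0 := by
      intro x
      rw [(hd x).fderiv]
      ext v
      rw [convolution, ContinuousLinearMap.integral_apply]
      · have := h _ hcd hcs v x
        rw [← integral_sub_left_eq_self _ volume x] at this
        simp only [sub_sub_cancel] at this
        rw [zero_apply, ← this]
        congr 1; ext t
        simp [ContinuousLinearMap.precompL_apply, mul_comm]
      · have := (hcs.fderiv ℝ).convolutionExists_left
          ((ContinuousLinearMap.lsmul ℝ ℝ).precompL (Rd d)) (hcd.continuous_fderiv (by norm_num)) hu x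
        exact this
    exact is_const_of_fderiv_eq_zero (fun x => (hd x).differentiableAt) h0
  obtain ⟨x0, hx0⟩ := hlim.exists
  refine ⟨u x0, ?_⟩
  filter_upwards [hlim] with x hx
  refine tendsto_nhds_unique hx (hx0.congr fun n => ?_)
  exact hconst n x0 x

lemma good_approx {d : ℕ} {u : Rd (d+1) → ℝ} (hu : Measurable u) {M : ℝ} (hM : ∀ x, |u x| ≤ M)
    (h : ∀ X, GoodF X → ∫ x, u x * vdiv X x = 0) {X : Rd (d+1) → Rd (d+1)} (hX : ContDiff ℝ 2 X)
    (hc : HasCompactSupport X) : ∫ x, u x * vdiv X x = 0 := by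
  have hM0 : 0 ≤ M := (abs_nonneg _).trans (hM 0)
  let χ : ContDiffBump (0 : Rd (d+1)) := ⟨1, 2, by norm_num, by norm_num⟩
  have hχ : ContDiff ℝ 2 χ := χ.contDiff
  obtain ⟨C1, hC1⟩ := (χ.hasCompactSupport.fderiv ℝ).exists_bound_of_continuous
    (hχ.continuous_fderiv (by norm_num))
  obtain ⟨C2, hC2⟩ := (hc.fderiv ℝ).exists_bound_of_continuous
    (hX.continuous_fderiv (by norm_num))
  obtain ⟨C3, hC3⟩ := (vdiv_cs hc).exists_bound_of_continuous
    (vdiv_cont (hX.of_le (by norm_num)))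
  have hC10 : 0 ≤ C1 := (norm_nonneg _).trans (hC1 0)
  have hC20 : 0 ≤ C2 := (norm_nonneg _).trans (hC2 0)
  have hC30 : 0 ≤ C3 := (norm_nonneg _).trans (hC3 0)
  have hlip : ∀ x, ‖X x - X 0‖ ≤ C2 * ‖x‖ := by
    intro x
    have := Convex.norm_image_sub_le_of_norm_fderiv_le (𝕜 := ℝ) (f := X) (s := univ) (C := C2)
      (fun x _ => hX.differentiable (by norm_num) x) (fun x _ => hC2 x) convex_univ
      (mem_univ 0) (mem_univ x)
    simpa using this
  have key : ∀ ε : ℝ, 0 < ε → |∫ x, u x * vdiv X x| ≤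
      M * (C3 + C1 * C2 * 2) * volume.real (closedBall (0 : Rd (d+1)) (2 * ε)) := by
    intro ε hε
    set η : Rd (d+1) → ℝ := fun x => χ (ε⁻¹ • x) with hη
    have hηcd : ContDiff ℝ 2 η := hχ.comp (contDiff_const_smul _)
    have hη0 : ∀ x, 2 * ε ≤ ‖x‖ → η x = 0 := by
      intro x hx
      apply χ.zero_of_le_dist
      rw [dist_zero_right, norm_smul, norm_inv, Real.norm_eq_abs, abs_of_pos hε]
      change 2 ≤ _
      rw [inv_mul_eq_div, le_div_iff₀ hε]; exact hx
    have hη1 : ∀ x, ‖x‖ ≤ ε → η x = 1 := by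
      intro x hx
      apply χ.one_of_mem_closedBall
      rw [mem_closedBall, dist_zero_right, norm_smul, norm_inv, Real.norm_eq_abs, abs_of_pos hε]
      change _ ≤ (1:ℝ)
      rw [inv_mul_eq_div, div_le_one₀ hε]; exact hx
    have hηcs : HasCompactSupport η := by
      refine HasCompactSupport.intro (isCompact_closedBall 0 (2*ε)) fun x hx => hη0 x ?_
      rw [mem_closedBall, dist_zero_right, not_le] at hx
      exact hx.le
    have hηd : ∀ x, ‖fderiv ℝ η x‖ ≤ C1 * ε⁻¹ := by
      intro x
      have : HasFDerivAt η ((fderiv ℝ χ (ε⁻¹ • x)).comp (ε⁻¹ • ContinuousLinearMap.id ℝ _)) x := by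
        refine HasFDerivAt.comp (g := (χ : Rd (d+1) → ℝ)) (f := fun x => ε⁻¹ • x) x (hχ.differentiable (by norm_num) _).hasFDerivAt ?_
        exact (hasFDerivAt_id x).const_smul ε⁻¹
      rw [this.fderiv]
      refine (ContinuousLinearMap.opNorm_comp_le _ _).trans ?_
      gcongr
      · exact hC1 _
      · rw [norm_smul, norm_inv, Real.norm_eq_abs, abs_of_pos hε]
        have := ContinuousLinearMap.norm_id_le (𝕜 := ℝ) (E := Rd (d+1))
        have h2 : 0 < ε⁻¹ := by positivity
        nlinarith
    set Z : Rd (d+1) → Rd (d+1) := fun x => η x • (X x - X 0) with hZ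
    have hZcd : ContDiff ℝ 2 Z := hηcd.smul (hX.sub contDiff_const)
    have hZcs : HasCompactSupport Z := hηcs.smul_right
    have hY : GoodF (fun x => X x + (-1 : ℝ) • Z x) := by
      refine ⟨hX.add (hZcd.const_smul _), hc.add (hZcs.smul_left (f := fun _ => (-1:ℝ))), ε, hε, ?_⟩
      intro x hx
      simp [hZ, hη1 x hx.le]
    have hXd := hX.differentiable (by norm_num)
    have hZd := hZcd.differentiable (by norm_num)
    have h1 := h _ hY
    have hint : ∀ Y : Rd (d+1) → Rd (d+1), ContDiff ℝ 2 Y → HasCompactSupport Y →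
        Integrable (fun x => u x * vdiv Y x) := by
      intro Y hY hYc
      refine (vdiv_int (U := univ) ⟨hY.of_le (by norm_num), hYc, subset_univ _⟩).bdd_mul
        (c := M) hu.aestronglyMeasurable ?_
      exact Eventually.of_forall hM
    have h2 : ∫ x, u x * vdiv X x = ∫ x, u x * vdiv Z x := by
      rw [← sub_eq_zero, ← integral_sub (hint _ hX hc) (hint _ hZcd hZcs), ← h1]
      congr 1; ext x
      rw [vdiv_add (ψ := fun x => (-1:ℝ) • Z x) hXd (hZd.fun_const_smul _), vdiv_const_smul hZd]
      ring
    rw [h2]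
    have h3 : ∫ x, u x * vdiv Z x = ∫ x in closedBall (0 : Rd (d+1)) (2*ε), u x * vdiv Z x := by
      symm
      apply setIntegral_eq_integral_of_forall_compl_eq_zero
      intro x hx
      rw [vdiv_eq_zero, mul_zero]
      intro hx'
      apply hx
      refine closure_minimal ?_ isClosed_closedBall hx'
      intro y hy
      by_contra hy'
      rw [mem_closedBall, dist_zero_right, not_le] at hy'
      exact hy (by simp [hZ, hη0 y hy'.le])
    rw [h3, ← Real.norm_eq_abs]
    refine norm_setIntegral_le_of_norm_le_const ?_ ?_
    · exact (isCompact_closedBall _ _).measure_lt_top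
    · intro x hx
      rw [mem_closedBall, dist_zero_right] at hx
      rw [hZ, vdiv_smul (hηcd.differentiable (by norm_num) x) ((hXd x).sub_const _), norm_mul]
      have e1 : vdiv (fun x => X x - X 0) x = vdiv X x := by
        unfold vdiv; simp [fderiv_sub_const]
      rw [e1]
      have e2 : |η x| ≤ 1 := by
        rw [abs_of_nonneg χ.nonneg]; exact χ.le_one
      have e3 : ‖fderiv ℝ η x (X x - X 0)‖ ≤ C1 * C2 * 2 := by
        refine (ContinuousLinearMap.le_opNorm _ _).trans ?_
        calc _ ≤ (C1 * ε⁻¹) * (C2 * (2 * ε)) := by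
              gcongr
              · exact hηd x
              · exact (hlip x).trans (by gcongr)
          _ = _ := by field_simp
      gcongr
      · exact hM x
      refine (norm_add_le _ _).trans ?_
      gcongr
      rw [norm_mul]
      calc _ ≤ 1 * C3 := by
            gcongr
            · exact e2
            · exact hC3 x
        _ = _ := one_mul _
  have hvol : Tendsto (fun ε : ℝ => M * (C3 + C1 * C2 * 2) *
      volume.real (closedBall (0 : Rd (d+1)) (2 * ε))) (𝓝[>] 0) (𝓝 0) := by
    have e : ∀ ε : ℝ, 0 < ε → volume.real (closedBall (0 : Rd (d+1)) (2 * ε)) =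
        (2 * ε)^(d+1) * volume.real (ball (0 : Rd (d+1)) 1) := by
      intro ε hε
      rw [measureReal_def, Measure.addHaar_closedBall _ _ (by positivity), ENNReal.toReal_mul,
        ENNReal.toReal_ofReal (by positivity), finrank_euclideanSpace_fin, measureReal_def]
    have : Tendsto (fun ε : ℝ => M * (C3 + C1 * C2 * 2) *
      ((2 * ε)^(d+1) * volume.real (ball (0 : Rd (d+1)) 1))) (𝓝[>] 0) (𝓝 0) := by
      apply tendsto_nhdsWithin_of_tendsto_nhds
      have hc : Continuous (fun ε : ℝ => M * (C3 + C1 * C2 * 2) *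
        ((2 * ε)^(d+1) * volume.real (ball (0 : Rd (d+1)) 1))) := by fun_prop
      simpa using hc.tendsto 0
    refine this.congr' ?_
    filter_upwards [self_mem_nhdsWithin] with ε hε
    rw [e ε hε]
  have := ge_of_tendsto hvol (by
    filter_upwards [self_mem_nhdsWithin] with ε hε
    exact key ε hε)
  exact abs_nonpos_iff.1 this

lemma refl_zero {d : ℕ} {u : Rd (d+1) → ℝ}
    (hall : ∀ X : Rd (d+1) → Rd (d+1), ContDiff ℝ 2 X → HasCompactSupport X → ∫ x, u x * vdiv X x = 0)
    {φ : Rd (d+1) → ℝ} (hφ : ContDiff ℝ 2 φ) (hφc : HasCompactSupport φ) (v x : Rd (d+1)) :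
    ∫ y, u y * fderiv ℝ φ (x - y) v = 0 := by
  have hcd : ContDiff ℝ 2 (fun y => φ (x - y)) := hφ.comp (contDiff_const.sub contDiff_id)
  have hcs : HasCompactSupport (fun y => φ (x - y)) := by
    have := hφc.comp_homeomorph (Homeomorph.subLeft x)
    exact this
  have h1 := hall (fun y => φ (x - y) • v) (hcd.smul contDiff_const)
    hcs.smul_right
  have h0 : ∀ y, u y * vdiv (fun y => φ (x - y) • v) y = - (u y * fderiv ℝ φ (x - y) v) := by
   intro y
   have hd : HasFDerivAt (fun y => φ (x - y)) (-(fderiv ℝ φ (x - y))) y := by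
    have h2 : HasFDerivAt (fun y : Rd (d+1) => x - y) (-(ContinuousLinearMap.id ℝ _)) y :=
      (hasFDerivAt_id y).const_sub x
    have h3 := HasFDerivAt.comp (g := φ) (f := fun y : Rd (d+1) => x - y) y
      ((hφ.differentiable (by norm_num)) (x - y)).hasFDerivAt h2
    have h4 : (fderiv ℝ φ (x - y)).comp (-(ContinuousLinearMap.id ℝ (Rd (d+1)))) =
        -(fderiv ℝ φ (x - y)) := by
      rw [ContinuousLinearMap.comp_neg, ContinuousLinearMap.comp_id]
    rw [h4] at h3
    exact h3
   have h5 : vdiv (fun _ : Rd (d+1) => v) y = 0 := by simp [vdiv]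
   rw [vdiv_smul hd.differentiableAt (differentiableAt_const v), hd.fderiv, h5]
   simp
  simp_rw [h0] at h1
  rw [integral_neg] at h1
  exact neg_eq_zero.1 h1

lemma exists_fields {d : ℕ} {ι : Type*} [Fintype ι] [DecidableEq ι] (A : ι → Set (Rd (d+1)))
    (hA : ∀ k, MeasurableSet (A k)) (hpos : ∀ k, volume (A k) ≠ 0)
    (hdis : ∀ k j, k ≠ j → volume (A k ∩ A j) = 0) (hco : volume (⋃ k, A k)ᶜ ≠ 0) :
    ∃ X : ι → Rd (d+1) → Rd (d+1), (∀ j, GoodF (X j)) ∧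
      ∀ k j, ∫ x in A k, vdiv (X j) x = if k = j then 1 else 0 := by
  let S : Submodule ℝ (ι → ℝ) :=
    { carrier := {v | ∃ X : Rd (d+1) → Rd (d+1), GoodF X ∧ ∀ k, ∫ x in A k, vdiv X x = v k}
      zero_mem' := by
        refine ⟨fun _ => 0, ⟨contDiff_const, HasCompactSupport.zero, 1, one_pos, fun _ _ => rfl⟩, ?_⟩
        intro k
        simp [vdiv]
      add_mem' := by
        rintro v w ⟨X, hX, hXv⟩ ⟨Y, hY, hYw⟩
        refine ⟨fun x => X x + Y x, ⟨hX.cd.add hY.cd, hX.cs.add hY.cs, ?_⟩, ?_⟩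
        · obtain ⟨r, hr, h1⟩ := hX.ct
          obtain ⟨r', hr', h2⟩ := hY.ct
          refine ⟨min r r', lt_min hr hr', fun x hx => ?_⟩
          rw [h1 x (hx.trans_le (min_le_left _ _)), h2 x (hx.trans_le (min_le_right _ _))]
        · intro k
          rw [Pi.add_apply, ← hXv, ← hYw, ← integral_add (vdiv_int hX.test).integrableOn
            (vdiv_int hY.test).integrableOn]
          congr 1; ext x
          exact vdiv_add (hX.cd.differentiable (by norm_num)) (hY.cd.differentiable (by norm_num)) x
      smul_mem' := by
        rintro c v ⟨X, hX, hXv⟩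
        refine ⟨fun x => c • X x, ⟨hX.cd.const_smul c, hX.cs.smul_left (f := fun _ => c), ?_⟩, ?_⟩
        · obtain ⟨r, hr, h1⟩ := hX.ct
          exact ⟨r, hr, fun x hx => by rw [h1 x hx]⟩
        · intro k
          rw [Pi.smul_apply, ← hXv, smul_eq_mul, ← integral_const_mul]
          congr 1; ext x
          exact vdiv_const_smul (hX.cd.differentiable (by norm_num)) c x }
  have hS : S = ⊤ := by
    by_contra hne
    obtain ⟨f, hf, hle⟩ := Submodule.exists_le_ker_of_lt_top S (lt_top_iff_ne_top.2 hne)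
    set c : ι → ℝ := fun k => f (Pi.single k 1) with hc
    have hfc : ∀ v, f v = ∑ k, c k * v k := by
      intro v
      conv_lhs => rw [← Finset.univ_sum_single v, map_sum]
      refine Finset.sum_congr rfl fun k _ => ?_
      have : Pi.single k (v k) = v k • (Pi.single k 1 : ι → ℝ) := by
        rw [← Pi.single_smul]; simp
      rw [this, map_smul, smul_eq_mul, mul_comm]
    set u : Rd (d+1) → ℝ := fun x => ∑ k, c k * (A k).indicator 1 x with hu
    have hum : Measurable u := by
      refine Finset.measurable_fun_sum _ fun k _ => ?_
      exact (measurable_one.indicator (hA k)).const_mul _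
    have hub : ∀ x, |u x| ≤ ∑ k, |c k| := by
      intro x
      refine (Finset.abs_sum_le_sum_abs _ _).trans (Finset.sum_le_sum fun k _ => ?_)
      rw [abs_mul]
      refine mul_le_of_le_one_right (abs_nonneg _) ?_
      by_cases hx : x ∈ A k <;> simp [hx]
    have hgood : ∀ X, GoodF X → ∫ x, u x * vdiv X x = 0 := by
      intro X hX
      have h1 : f (fun k => ∫ x in A k, vdiv X x) = 0 := hle ⟨X, hX, fun k => rfl⟩
      rw [hfc] at h1
      rw [← h1]
      have e : ∀ x, u x * vdiv X x = ∑ k, c k * (A k).indicator (vdiv X) x := by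
        intro x
        rw [hu, Finset.sum_mul]
        refine Finset.sum_congr rfl fun k _ => ?_
        by_cases hx : x ∈ A k <;> simp [hx]
      simp_rw [e]
      rw [integral_finsetSum]
      · refine Finset.sum_congr rfl fun k _ => ?_
        rw [integral_const_mul, integral_indicator (hA k)]
      · intro k _
        exact ((vdiv_int hX.test).indicator (hA k)).const_mul _
    have hall := fun X hX hc => good_approx hum hub hgood (X := X) hX hc
    obtain ⟨b, hb⟩ := const_of_conv (u := u) (by
      refine (locallyIntegrable_const (∑ k, |c k|)).mono hum.aestronglyMeasurable ?_
      refine Eventually.of_forall fun x => ?_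
      rw [Real.norm_eq_abs, Real.norm_eq_abs]
      exact (hub x).trans (le_abs_self _)) (fun φ hφ hφc v x => refl_zero hall hφ hφc v x)
    have hb0 : b = 0 := by
      by_contra hb0
      apply hco
      refine measure_mono_null ?_ hb
      intro x hx hx'
      apply hb0
      rw [← (show u x = b from hx')]
      rw [hu]
      refine Finset.sum_eq_zero fun k _ => ?_
      have : x ∉ A k := fun h => hx (mem_iUnion.2 ⟨k, h⟩)
      simp [this]
    apply hf
    ext i
    have hci : c i = 0 := by
      by_contra hci
      apply hpos i
      have hN : volume (({x | u x = b}ᶜ) ∪ ⋃ j, ⋃ (_ : i ≠ j), A i ∩ A j) = 0 := by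
        rw [measure_union_null_iff]
        refine ⟨hb, ?_⟩
        rw [measure_iUnion_null_iff]; intro j
        rw [measure_iUnion_null_iff]; intro hj
        exact hdis i j hj
      refine measure_mono_null ?_ hN
      intro x hx
      by_contra hx'
      rw [mem_union, not_or] at hx'
      obtain ⟨h1, h2⟩ := hx'
      have h1 : u x = b := by simpa using h1
      rw [hb0, hu] at h1
      simp only at h1
      rw [Finset.sum_eq_single i] at h1
      · simp [hx] at h1; exact hci h1
      · intro j _ hj
        have : x ∉ A j := fun h => h2 (mem_iUnion₂.2 ⟨j, hj.symm, hx, h⟩)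
        simp [this]
      · simp
    simpa using hci
  have : ∀ j, ∃ X : Rd (d+1) → Rd (d+1), GoodF X ∧ ∀ k, ∫ x in A k, vdiv X x = (Pi.single j 1 : ι → ℝ) k := by
    intro j
    have : (Pi.single j 1 : ι → ℝ) ∈ S := by rw [hS]; trivial
    exact this
  choose X hX hXv using this
  refine ⟨X, hX, fun k j => ?_⟩
  rw [hXv j k, Pi.single_apply]

def tr {d : ℕ} (A : Rd d →L[ℝ] Rd d) : ℝ := ∑ i : Fin d, A (EuclideanSpace.single i (1 : ℝ)) i

lemma fderiv_det_one {d : ℕ} (A : Rd d →L[ℝ] Rd d) :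
    fderiv ℝ (fun A : Rd d →L[ℝ] Rd d => A.det) 1 A = tr A := by
  have h1 : DifferentiableAt ℝ (fun A : Rd d →L[ℝ] Rd d => A.det) 1 :=
    contDiff_clm_det.differentiable (by simp) 1
  have h2 : HasDerivAt (fun r : ℝ => (1 : Rd d →L[ℝ] Rd d) + r • A) A 0 := by
    have := ((hasDerivAt_id (0:ℝ)).smul_const A).const_add (1 : Rd d →L[ℝ] Rd d)
    simpa using this
  have h3 : HasDerivAt (fun r : ℝ => ((1 : Rd d →L[ℝ] Rd d) + r • A).det)
      (fderiv ℝ (fun A : Rd d →L[ℝ] Rd d => A.det) 1 A) 0 := by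
    have h1' : HasFDerivAt (fun A : Rd d →L[ℝ] Rd d => A.det)
      (fderiv ℝ (fun A : Rd d →L[ℝ] Rd d => A.det) 1) ((1 : Rd d →L[ℝ] Rd d) + (0:ℝ) • A) := by
      rw [zero_smul ℝ A, add_zero]; exact h1.hasFDerivAt
    exact HasFDerivAt.comp_hasDerivAt (0:ℝ) h1' h2
  set b := (EuclideanSpace.basisFun (Fin d) ℝ).toBasis with hb
  set M := LinearMap.toMatrix b b (A : Rd d →ₗ[ℝ] Rd d) with hM
  have h4 : ∀ r : ℝ, ((1 : Rd d →L[ℝ] Rd d) + r • A).det = (1 + r • M).det := by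
    intro r
    rw [ContinuousLinearMap.det, ← LinearMap.det_toMatrix b]
    congr 1
    rw [hM, ← LinearMap.toMatrix_one b, ← map_smul, ← map_add]
    rfl
  have h5 : M.trace = tr A := by
    simp [Matrix.trace, tr, hM, LinearMap.toMatrix_apply, hb]
  let q : Polynomial ℝ := (1 + (Polynomial.X : Polynomial ℝ) • M.map Polynomial.C).det
  have h6 : ∀ r : ℝ, (1 + r • M).det = q.eval r := by
    intro r
    rw [← Polynomial.coe_evalRingHom, RingHom.map_det]
    congr 1
    ext i j
    simp only [RingHom.mapMatrix_apply, Matrix.map_apply, Matrix.add_apply, Matrix.smul_apply, map_add]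
    simp [Matrix.one_apply, apply_ite]
    exact mul_comm _ _
  have h7 : HasDerivAt (fun r : ℝ => ((1 : Rd d →L[ℝ] Rd d) + r • A).det) (tr A) 0 := by
    simp_rw [h4, h6, ← h5, ← Matrix.derivative_det_one_add_X_smul]
    exact q.hasDerivAt 0
  exact h3.unique h7

lemma det_strict (d : ℕ) {κ : ℝ} (hκ : 0 < κ) : ∃ δ > 0, ∀ A A' : Rd d →L[ℝ] Rd d, ‖A‖ ≤ δ → ‖A'‖ ≤ δ →
    |(1 + A).det - (1 + A').det - (tr A - tr A')| ≤ κ * ‖A - A'‖ := by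
  have h1 : ContDiffAt ℝ 1 (fun A : Rd d →L[ℝ] Rd d => A.det) 1 :=
    (contDiff_clm_det.of_le (by exact_mod_cast le_top)).contDiffAt
  have h2 := h1.hasStrictFDerivAt (by norm_num)
  obtain ⟨s, hs, h⟩ := h2.approximates_deriv_on_nhds (c := ⟨κ, hκ.le⟩) (Or.inr hκ)
  obtain ⟨δ, hδ, hsub⟩ := Metric.nhds_basis_closedBall.mem_iff.1 hs
  refine ⟨δ, hδ, fun A A' hA hA' => ?_⟩
  have := h (1 + A) (hsub (by simpa using hA)) (1 + A') (hsub (by simpa using hA'))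
  rw [add_sub_add_left_eq_sub, map_sub, fderiv_det_one, fderiv_det_one] at this
  exact this

lemma near_id {d : ℕ} {g : Rd d → Rd d} (hg : ContDiff ℝ 2 g) (hb : ∀ x, ‖fderiv ℝ g x‖ ≤ 1/2)
    (hdet : ∀ x, (1 + fderiv ℝ g x).det ≠ 0) :
    ∃ Θ, DiffeoOn (fun x => x + g x) Θ univ univ ∧
      ∀ x v, ‖fderiv ℝ Θ (x + g x) v‖ ≤ (1 + 2 * ‖fderiv ℝ g x‖) * ‖v‖ := by
  have hgd := hg.differentiable (by norm_num)
  have hlip : ∀ x y, ‖g x - g y‖ ≤ 1/2 * ‖x - y‖ := fun x y =>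
    Convex.norm_image_sub_le_of_norm_fderiv_le (𝕜 := ℝ) (f := g) (s := univ)
      (fun x _ => hgd x) (fun x _ => hb x) convex_univ (mem_univ y) (mem_univ x)
  have hap : ApproximatesLinearOn (fun x => x + g x)
      ((ContinuousLinearEquiv.refl ℝ (Rd d) : Rd d ≃L[ℝ] Rd d) : Rd d →L[ℝ] Rd d) univ (1/2) := by
    intro x _ y _
    have := hlip x y
    simp only [ContinuousLinearEquiv.coe_refl, ContinuousLinearMap.coe_id', id]
    rw [show x + g x - (y + g y) - (x - y) = g x - g y by abel]
    simpa using this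
  have hc : Subsingleton (Rd d) ∨ (1/2 : NNReal) <
      ‖((ContinuousLinearEquiv.refl ℝ (Rd d)).symm : Rd d →L[ℝ] Rd d)‖₊⁻¹ := by
    rcases subsingleton_or_nontrivial (Rd d) with h | h
    · exact Or.inl h
    · right
      rw [ContinuousLinearEquiv.refl_symm, ContinuousLinearEquiv.coe_refl]
      have : ‖ContinuousLinearMap.id ℝ (Rd d)‖₊ = 1 := by
        ext; exact ContinuousLinearMap.norm_id
      rw [this, inv_one, ← NNReal.coe_lt_coe]
      norm_num
  let H := hap.toHomeomorph _ hc
  have hH : ∀ x, H x = x + g x := fun x => rfl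
  have hfd : ∀ x, HasFDerivAt (fun x => x + g x) (1 + fderiv ℝ g x) x := fun x =>
    (hasFDerivAt_id x).add (hgd x).hasFDerivAt
  have hcd : ContDiff ℝ 2 (fun x => x + g x) := contDiff_id.add hg
  have hsymm : ContDiff ℝ 2 H.symm := by
    refine Homeomorph.contDiff_symm H
      (f₀' := fun a => (1 + fderiv ℝ g a).toContinuousLinearEquivOfDetNeZero (hdet a)) ?_ hcd
    intro a
    rw [ContinuousLinearMap.coe_toContinuousLinearEquivOfDetNeZero]
    exact hfd a
  have hD : DiffeoOn (fun x => x + g x) H.symm univ univ :=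
    ⟨H.left_inv, H.right_inv, isOpen_univ, isOpen_univ,
      by rw [image_univ]; exact H.surjective.range_eq, hcd.contDiffOn, hsymm.contDiffOn⟩
  refine ⟨H.symm, hD, fun x v => ?_⟩
  have h1 := hD.symm.comp_id (mem_univ (x + g x))
  have h2 : H.symm (x + g x) = x := H.left_inv x
  rw [h2, (hfd x).fderiv] at h1
  set B := fderiv ℝ H.symm (x + g x) with hB
  have h3 : B v + fderiv ℝ g x (B v) = v := by
    have := congrArg (fun T => T v) h1
    simpa using this
  have h4 : ‖B v‖ ≤ ‖v‖ + ‖fderiv ℝ g x‖ * ‖B v‖ := by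
    calc ‖B v‖ = ‖v - fderiv ℝ g x (B v)‖ := by rw [← eq_sub_of_add_eq h3]
      _ ≤ _ := (norm_sub_le _ _).trans (by gcongr; exact ContinuousLinearMap.le_opNorm _ _)
  have h5 := hb x
  have h6 := norm_nonneg (fderiv ℝ g x)
  have h7 := norm_nonneg (B v)
  have h8 := norm_nonneg v
  set a := ‖fderiv ℝ g x‖
  have h9 : (1 - a) * ‖B v‖ ≤ ‖v‖ := by linarith
  have h10 : (1 + 2 * a) * ((1 - a) * ‖B v‖) ≤ (1 + 2 * a) * ‖v‖ := by gcongr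
  nlinarith [mul_nonneg (mul_nonneg h6 (by linarith : 0 ≤ 1 - 2 * a)) h7]

lemma abs_tr_le {d : ℕ} (A : Rd d →L[ℝ] Rd d) : |tr A| ≤ d * ‖A‖ := by
  unfold tr
  refine (Finset.abs_sum_le_sum_abs _ _).trans ?_
  have : ∀ i : Fin d, |A (EuclideanSpace.single i (1:ℝ)) i| ≤ ‖A‖ := by
    intro i
    have h1 := PiLp.norm_apply_le (A (EuclideanSpace.single i (1:ℝ))) i
    have h2 := A.le_opNorm (EuclideanSpace.single i (1:ℝ))
    simp at h1 h2
    exact h1.trans h2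
  refine (Finset.sum_le_sum fun i _ => this i).trans ?_
  simp

section
variable {d : ℕ} {ι : Type*} [Fintype ι] (X : ι → Rd d → Rd d)

def gX (t : ι → ℝ) (x : Rd d) : Rd d := ∑ j, t j • X j x

variable {X}

lemma gX_cd (hX : ∀ j, ContDiff ℝ 2 (X j)) (t : ι → ℝ) : ContDiff ℝ 2 (gX X t) :=
  ContDiff.sum fun j _ => (hX j).const_smul (t j)

lemma gX_fderiv (hX : ∀ j, ContDiff ℝ 2 (X j)) (t : ι → ℝ) (x : Rd d) :
    fderiv ℝ (gX X t) x = ∑ j, t j • fderiv ℝ (X j) x := by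
  have : HasFDerivAt (gX X t) (∑ j, t j • fderiv ℝ (X j) x) x := by
    refine HasFDerivAt.fun_sum fun j _ => ?_
    exact (((hX j).differentiable (by norm_num)) x).hasFDerivAt.const_smul (t j)
  exact this.fderiv

lemma gX_lip (hX : ∀ j, ContDiff ℝ 2 (X j)) {L : ℝ} (hL0 : 0 ≤ L)
    (hL : ∀ j x, ‖fderiv ℝ (X j) x‖ ≤ L) (t t' : ι → ℝ) (x : Rd d) :
    ‖fderiv ℝ (gX X t) x - fderiv ℝ (gX X t') x‖ ≤ Fintype.card ι * L * ‖t - t'‖ := by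
  rw [gX_fderiv hX, gX_fderiv hX, ← Finset.sum_sub_distrib]
  refine (norm_sum_le _ _).trans ?_
  have : ∀ j, ‖t j • fderiv ℝ (X j) x - t' j • fderiv ℝ (X j) x‖ ≤ L * ‖t - t'‖ := by
    intro j
    have e : t j • fderiv ℝ (X j) x - t' j • fderiv ℝ (X j) x = (t j - t' j) • fderiv ℝ (X j) x :=
      (sub_smul (t j) (t' j) (fderiv ℝ (X j) x)).symm
    rw [e, norm_smul, mul_comm]
    gcongr
    · exact hL j x
    · exact norm_le_pi_norm (t - t') j
  refine (Finset.sum_le_sum fun j _ => this j).trans ?_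
  simp [mul_assoc]

lemma gX_tr (hX : ∀ j, ContDiff ℝ 2 (X j)) (t : ι → ℝ) (x : Rd d) :
    tr (fderiv ℝ (gX X t) x) = ∑ j, t j * vdiv (X j) x := by
  rw [gX_fderiv hX]
  simp only [tr, vdiv, Finset.mul_sum]
  rw [Finset.sum_comm]
  refine Finset.sum_congr rfl fun i _ => ?_
  simp

lemma gX_zero (x : Rd d) : fderiv ℝ (gX X 0) x = 0 := by
  have : gX X 0 = fun _ => 0 := by ext; simp [gX]
  rw [this]; simp

def fV (X : ι → Rd d → Rd d) (S : ι → Set (Rd d)) (t : ι → ℝ) (k : ι) : ℝ :=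
  ∫ x in S k, ((1 + fderiv ℝ (gX X t) x).det - 1)

lemma gX_cont (hX : ∀ j, ContDiff ℝ 2 (X j)) (t : ι → ℝ) :
    Continuous (fun x => (1 + fderiv ℝ (gX X t) x).det - 1) := by
  have h1 := (gX_cd hX t).continuous_fderiv (by norm_num)
  have h2 : Continuous (fun A : Rd d →L[ℝ] Rd d => A.det) := contDiff_clm_det.continuous
  exact (h2.comp (continuous_const.add h1)).sub continuous_const

lemma intOn_ball {g : Rd d → ℝ} (hg : Continuous g) {D : ℝ} {S : Set (Rd d)} (hS : S ⊆ ball 0 D) :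
    IntegrableOn g S :=
  (hg.locallyIntegrable.integrableOn_isCompact (isCompact_closedBall (0 : Rd d) D)).mono_set
    (hS.trans ball_subset_closedBall)

lemma fV_approx [DecidableEq ι] (hX : ∀ j, GoodF (X j)) {L κ δ D c0 : ℝ} (hL0 : 0 ≤ L)
    (hL : ∀ j x, ‖fderiv ℝ (X j) x‖ ≤ L) (hκ0 : 0 ≤ κ)
    (hκ : ∀ A A' : Rd d →L[ℝ] Rd d, ‖A‖ ≤ δ → ‖A'‖ ≤ δ →
      |(1 + A).det - (1 + A').det - (tr A - tr A')| ≤ κ * ‖A - A'‖)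
    (hD : ∀ j, tsupport (X j) ⊆ ball 0 D) (hc0 : 0 ≤ c0)
    {G : ι → Set (Rd d)} (hG : ∀ k, MeasurableSet (G k))
    (hGX : ∀ k j, |(∫ x in G k, vdiv (X j) x) - (if k = j then 1 else 0)| ≤ c0)
    {t t' : ι → ℝ} (ht : Fintype.card ι * L * ‖t‖ ≤ δ) (ht' : Fintype.card ι * L * ‖t'‖ ≤ δ) :
    ‖fV X (fun k => G k ∩ ball 0 D) t - fV X (fun k => G k ∩ ball 0 D) t' - (t - t')‖ ≤
      (κ * (Fintype.card ι * L) * volume.real (ball (0 : Rd d) D) + Fintype.card ι * c0) * ‖t - t'‖ := by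
  have hXc := fun j => (hX j).cd
  have hnorm : ∀ (s : ι → ℝ) x, ‖fderiv ℝ (gX X s) x‖ ≤ Fintype.card ι * L * ‖s‖ := by
    intro s x
    have := gX_lip hXc hL0 hL s 0 x
    simpa [gX_zero] using this
  rw [pi_norm_le_iff_of_nonneg (by positivity)]
  intro k
  set S := G k ∩ ball 0 D with hS
  have hSm : MeasurableSet S := (hG k).inter measurableSet_ball
  have hSb : S ⊆ ball 0 D := inter_subset_right
  have hi := fun s => intOn_ball (gX_cont hXc s) hSb
  have hit : ∀ s, IntegrableOn (fun x => tr (fderiv ℝ (gX X s) x)) S := by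
    intro s
    simp_rw [gX_tr hXc]
    refine intOn_ball ?_ hSb
    have := fun j => vdiv_cont ((hX j).cd.of_le (by norm_num) : ContDiff ℝ 1 (X j))
    fun_prop
  have e1 : ∀ s, ∫ x in S, tr (fderiv ℝ (gX X s) x) = ∑ j, s j * ∫ x in G k, vdiv (X j) x := by
    intro s
    simp_rw [gX_tr hXc]
    rw [integral_finsetSum]
    · refine Finset.sum_congr rfl fun j _ => ?_
      rw [integral_const_mul]
      congr 1
      symm
      apply setIntegral_eq_of_subset_of_forall_sdiff_eq_zero (hG k) inter_subset_left
      rintro x ⟨hx, hx'⟩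
      exact vdiv_eq_zero fun h => hx' ⟨hx, hD j h⟩
    · intro j _
      exact ((vdiv_int (hX j).test).integrableOn).const_mul _
  have e2 : ‖∫ x in S, (((1 + fderiv ℝ (gX X t) x).det - 1) - ((1 + fderiv ℝ (gX X t') x).det - 1)
      - (tr (fderiv ℝ (gX X t) x) - tr (fderiv ℝ (gX X t') x)))‖ ≤
      κ * (Fintype.card ι * L * ‖t - t'‖) * volume.real (ball (0 : Rd d) D) := by
    have hfin : volume (ball (0 : Rd d) D) < ⊤ := measure_ball_lt_top
    refine (norm_setIntegral_le_of_norm_le_const (C := κ * (Fintype.card ι * L * ‖t - t'‖))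
      ((measure_mono hSb).trans_lt hfin) ?_).trans ?_
    · intro x _
      rw [sub_sub_sub_cancel_right, Real.norm_eq_abs]
      refine (hκ _ _ ((hnorm t x).trans ht) ((hnorm t' x).trans ht')).trans ?_
      gcongr
      exact gX_lip hXc hL0 hL t t' x
    · gcongr
      exact hfin.ne
  have a1 : IntegrableOn (fun x => ((1 + fderiv ℝ (gX X t) x).det - 1) -
    ((1 + fderiv ℝ (gX X t') x).det - 1)) S := (hi t).sub (hi t')
  have a2 : IntegrableOn (fun x => tr (fderiv ℝ (gX X t) x) - tr (fderiv ℝ (gX X t') x)) S :=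
    (hit t).sub (hit t')
  rw [integral_sub a1 a2, integral_sub (hi t) (hi t'),
    integral_sub (hit t) (hit t'), e1, e1] at e2
  have e3 : ∀ s : ι → ℝ, s k = ∑ j, s j * (if k = j then 1 else 0) := by
    intro s; simp
  have e4 : |∑ j, (t - t') j * ((∫ x in G k, vdiv (X j) x) - (if k = j then 1 else 0))| ≤
      Fintype.card ι * c0 * ‖t - t'‖ := by
    refine (Finset.abs_sum_le_sum_abs _ _).trans ?_
    have : ∀ j, |(t - t') j * ((∫ x in G k, vdiv (X j) x) - (if k = j then 1 else 0))| ≤ c0 * ‖t - t'‖ := by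
      intro j
      rw [abs_mul, mul_comm]
      gcongr
      · exact hGX k j
      · exact norm_le_pi_norm (t - t') j
    refine (Finset.sum_le_sum fun j _ => this j).trans ?_
    simp [mul_assoc]
  have e5 : (fV X (fun k => G k ∩ ball 0 D) t - fV X (fun k => G k ∩ ball 0 D) t' - (t - t')) k =
      (((∫ x in S, ((1 + fderiv ℝ (gX X t) x).det - 1)) - ∫ x in S, ((1 + fderiv ℝ (gX X t') x).det - 1))
      - ((∑ j, t j * ∫ x in G k, vdiv (X j) x) - ∑ j, t' j * ∫ x in G k, vdiv (X j) x)) +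
      ∑ j, (t - t') j * ((∫ x in G k, vdiv (X j) x) - (if k = j then 1 else 0)) := by
    simp only [Pi.sub_apply, fV]
    simp_rw [mul_sub, sub_mul, Finset.sum_sub_distrib]
    rw [← e3 t, ← e3 t']
    ring
  rw [e5]
  refine (norm_add_le _ _).trans ?_
  rw [Real.norm_eq_abs, Real.norm_eq_abs] at *
  linarith

end

lemma fV_solve {ι : Type*} [Fintype ι] {f : (ι → ℝ) → ι → ℝ} {ρ : ℝ} (h0 : f 0 = 0)
    (hf : ∀ t t', ‖t‖ ≤ ρ → ‖t'‖ ≤ ρ → ‖f t - f t' - (t - t')‖ ≤ 1/2 * ‖t - t'‖)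
    {w : ι → ℝ} (hw : 2 * ‖w‖ ≤ ρ) : ∃ t, ‖t‖ ≤ 2 * ‖w‖ ∧ f t = w := by
  have hap : ApproximatesLinearOn f (ContinuousLinearMap.id ℝ (ι → ℝ)) (closedBall 0 ρ) (1/2) := by
    intro x hx y hy
    have := hf x y (by simpa using hx) (by simpa using hy)
    simpa using this
  have h1 := hap.surjOn_closedBall_of_nonlinearRightInverse (b := 0) (ε := 2 * ‖w‖)
    ⟨id, 1, fun y => by simp, fun y => rfl⟩ (by positivity) (closedBall_subset_closedBall hw)
  obtain ⟨t, ht, htw⟩ := h1 (show w ∈ _ by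
    rw [h0, mem_closedBall, dist_zero_right]
    simp only [NNReal.coe_one, NNReal.coe_div, NNReal.coe_ofNat]
    apply le_of_eq; ring)
  exact ⟨t, by simpa using ht, htw⟩

lemma vol_fix {d : ℕ} {ι : Type*} [Fintype ι] [DecidableEq ι] {X : ι → Rd d → Rd d}
    (hX : ∀ j, GoodF (X j)) :
    ∃ D0 > 0, ∃ r0 > 0, ∃ ε0 > 0, ∃ c0 > 0, ∃ C > 0, ∀ G : ι → Set (Rd d), (∀ k, MeasurableSet (G k)) →
      (∀ k j, |(∫ x in G k, vdiv (X j) x) - (if k = j then 1 else 0)| ≤ c0) →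
      ∀ w : ι → ℝ, ‖w‖ ≤ ε0 → ∃ Ψ Θ : Rd d → Rd d, DiffeoOn Ψ Θ univ univ ∧
        (∀ x, D0 ≤ ‖x‖ → Ψ x = x) ∧ (∃ c, ∀ x, ‖x‖ < r0 → Ψ x = x + c) ∧
        (∀ k, volume.real (Ψ '' (G k ∩ ball 0 D0)) = volume.real (G k ∩ ball 0 D0) + w k) ∧
        ∀ x v, |(fderiv ℝ Ψ x).det| * ‖fderiv ℝ Θ (Ψ x) v‖ ≤ (1 + C * ‖w‖) * ‖v‖ := by
  have hXc := fun j => (hX j).cd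
  -- constants
  obtain ⟨D, hD0, hD⟩ : ∃ D > 0, ∀ j, tsupport (X j) ⊆ ball (0 : Rd d) D := by
    have hK : IsCompact (⋃ j, tsupport (X j)) := isCompact_iUnion fun j => (hX j).cs
    obtain ⟨D, hD, h⟩ := hK.isBounded.subset_ball_lt 0 0
    exact ⟨D, hD, fun j => (subset_iUnion _ j).trans h⟩
  obtain ⟨r0, hr0, hr⟩ : ∃ r > 0, ∀ j, ∀ x, ‖x‖ < r → X j x = X j 0 := by
    have : ∀ j, ∀ᶠ r in 𝓝[>] (0:ℝ), ∀ x, ‖x‖ < r → X j x = X j 0 := by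
      intro j
      obtain ⟨r, hr, h⟩ := (hX j).ct
      filter_upwards [Ioo_mem_nhdsGT hr] with s hs x hx
      exact h x (hx.trans hs.2)
    obtain ⟨r, h1, h2⟩ := ((eventually_all.2 this).and self_mem_nhdsWithin).exists
    exact ⟨r, h2, h1⟩
  obtain ⟨L, hL0, hL⟩ : ∃ L > 0, ∀ j x, ‖fderiv ℝ (X j) x‖ ≤ L := by
    have : ∀ j, ∃ L, ∀ x, ‖fderiv ℝ (X j) x‖ ≤ L := fun j =>
      ((hX j).cs.fderiv ℝ).exists_bound_of_continuous ((hXc j).continuous_fderiv (by norm_num))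
    choose L hL using this
    refine ⟨1 + ∑ j, |L j|, by positivity, fun j x => (hL j x).trans ?_⟩
    have := Finset.single_le_sum (f := fun j => |L j|) (fun _ _ => abs_nonneg _) (Finset.mem_univ j)
    have h2 := le_abs_self (L j)
    linarith
  set n : ℝ := (Fintype.card ι : ℝ) with hn
  have hn0 : 0 ≤ n := by positivity
  set V0 := volume.real (ball (0 : Rd d) D) with hV0
  have hV00 : 0 ≤ V0 := measureReal_nonneg
  set κ : ℝ := 1 / (4 * (n * L * V0 + 1)) with hκd
  have hκ0 : 0 < κ := by positivity
  obtain ⟨δ', hδ'0, hκ'⟩ := det_strict d hκ0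
  set T : ℝ := d + κ with hT
  have hT0 : 0 < T := by positivity
  set δ := min δ' (min (1/2) (1 / (2 * T))) with hδ
  have hδ0 : 0 < δ := by positivity
  have hκ : ∀ A A' : Rd d →L[ℝ] Rd d, ‖A‖ ≤ δ → ‖A'‖ ≤ δ →
      |(1 + A).det - (1 + A').det - (tr A - tr A')| ≤ κ * ‖A - A'‖ := fun A A' h h' =>
    hκ' A A' (h.trans (min_le_left _ _)) (h'.trans (min_le_left _ _))
  have hdet1 : ∀ A : Rd d →L[ℝ] Rd d, ‖A‖ ≤ δ → |(1 + A).det - 1| ≤ T * ‖A‖ := by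
    intro A hA
    have h1 := hκ A 0 hA (by simpa using hδ0.le)
    have h2 := abs_tr_le A
    have h3 : tr (0 : Rd d →L[ℝ] Rd d) = 0 := by simp [tr]
    have h4 : (1 : Rd d →L[ℝ] Rd d).det = 1 := by
      rw [ContinuousLinearMap.det]; exact LinearMap.det_id
    rw [h3, add_zero, h4, sub_zero, sub_zero] at h1
    rw [hT]
    rw [abs_le] at *
    constructor <;> nlinarith
  set ρ := δ / (n * L + 1) with hρ
  have hρ0 : 0 < ρ := by positivity
  have hρδ : ∀ s : ℝ, 0 ≤ s → s ≤ ρ → n * L * s ≤ δ := by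
    intro s hs0 hs
    rw [hρ, le_div_iff₀ (by positivity)] at hs
    nlinarith
  refine ⟨D, hD0, r0, hr0, ρ / 2, by positivity, 1 / (4 * (n + 1)), by positivity,
    (2 * T + 2) * (n * L * 2) + 1, by positivity, ?_⟩
  intro G hG hGX w hw
  obtain ⟨t, ht, htw⟩ := fV_solve (f := fV X (fun k => G k ∩ ball 0 D)) (ρ := ρ) (by
      ext k; simp only [fV, gX_zero]
      have h4 : (1 : Rd d →L[ℝ] Rd d).det = 1 := by
        rw [ContinuousLinearMap.det]; exact LinearMap.det_id
      simp [h4]) (by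
      intro t t' ht ht'
      refine (fV_approx hX hL0.le hL hκ0.le hκ hD (by positivity) hG hGX
        (hρδ _ (norm_nonneg _) ht) (hρδ _ (norm_nonneg _) ht')).trans ?_
      gcongr
      have e1 : κ * (n * L) * V0 ≤ 1/4 := by
        rw [hκd, div_mul_eq_mul_div, div_mul_eq_mul_div, div_le_iff₀ (by positivity)]
        linarith
      have e2 : n * (1 / (4 * (n + 1))) ≤ 1/4 := by
        rw [mul_one_div, div_le_iff₀ (by positivity)]
        linarith
      linarith) (w := w) (by linarith)
  have hnorm : ∀ x, ‖fderiv ℝ (gX X t) x‖ ≤ n * L * ‖t‖ := by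
    intro x
    have := gX_lip hXc hL0.le hL t 0 x
    simpa [gX_zero] using this
  have hnδ : ∀ x, ‖fderiv ℝ (gX X t) x‖ ≤ δ := fun x => (hnorm x).trans
    (hρδ _ (norm_nonneg _) (ht.trans (by linarith)))
  have hδ12 : δ ≤ 1/2 := (min_le_right _ _).trans (min_le_left _ _)
  have hδT : T * δ ≤ 1/2 := by
    have : δ ≤ 1 / (2 * T) := (min_le_right _ _).trans (min_le_right _ _)
    calc T * δ ≤ T * (1 / (2 * T)) := by gcongr
      _ = 1/2 := by field_simp
  have hdpos : ∀ x, 1/2 ≤ (1 + fderiv ℝ (gX X t) x).det := by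
    intro x
    have h1 := (abs_le.1 (hdet1 _ (hnδ x))).1
    have h2 : T * ‖fderiv ℝ (gX X t) x‖ ≤ T * δ := by gcongr; exact hnδ x
    linarith
  obtain ⟨Θ, hΘ, hΘb⟩ := near_id (gX_cd hXc t) (fun x => (hnδ x).trans hδ12)
    (fun x => (by linarith [hdpos x] : (0:ℝ) < _).ne')
  have hfd : ∀ x, fderiv ℝ (fun x => x + gX X t x) x = 1 + fderiv ℝ (gX X t) x := by
    intro x
    exact ((hasFDerivAt_id x).add
      ((gX_cd hXc t).differentiable (by norm_num) x).hasFDerivAt).fderiv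
  refine ⟨fun x => x + gX X t x, Θ, hΘ, ?_, ⟨gX X t 0, ?_⟩, ?_, ?_⟩
  · intro x hx
    have : gX X t x = 0 := by
      refine Finset.sum_eq_zero fun j _ => ?_
      rw [image_eq_zero_of_notMem_tsupport (f := X j) (x := x), smul_zero]
      intro h
      have := hD j h
      rw [mem_ball, dist_zero_right] at this
      linarith
    simp [this]
  · intro x hx
    have : gX X t x = gX X t 0 := Finset.sum_congr rfl fun j _ => by rw [hr j x hx]
    simp [this]
  · intro k
    have hSm : MeasurableSet (G k ∩ ball 0 D) := (hG k).inter measurableSet_ball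
    have h1 := hΘ.cv hSm (subset_univ _) (fun _ => 1)
    have h2 := congrFun htw k
    rw [← h2]
    have h3 : ∫ x in (fun x => x + gX X t x) '' (G k ∩ ball 0 D), (1:ℝ) =
      volume.real ((fun x => x + gX X t x) '' (G k ∩ ball 0 D)) := by simp
    rw [h3] at h1
    rw [h1]
    have h4 : volume.real (G k ∩ ball 0 D) = ∫ x in G k ∩ ball 0 D, (1:ℝ) := by simp
    have h5 : IntegrableOn (fun _ => (1:ℝ)) (G k ∩ ball 0 D) :=
      intOn_ball continuous_const inter_subset_right
    rw [h4, fV, ← integral_add h5 (intOn_ball (gX_cont hXc t) inter_subset_right)]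
    congr 1
    ext x
    rw [hfd, abs_of_pos (by linarith [hdpos x])]
    ring
  · intro x v
    rw [hfd, abs_of_pos (by linarith [hdpos x])]
    have h1 := (abs_le.1 (hdet1 _ (hnδ x))).2
    have h2 := hΘb x v
    have h3 := (hnδ x).trans hδ12
    have h4 : ‖fderiv ℝ (gX X t) x‖ ≤ n * L * (2 * ‖w‖) := (hnorm x).trans (by gcongr)
    have h5 := norm_nonneg (fderiv ℝ (gX X t) x)
    set a := ‖fderiv ℝ (gX X t) x‖
    have h7 : (1 + T * a) * (1 + 2 * a) ≤ 1 + ((2 * T + 2) * (n * L * 2) + 1) * ‖w‖ := by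
      have e1 : (1 + T * a) * (1 + 2 * a) ≤ 1 + (2 * T + 2) * a := by
        nlinarith [mul_nonneg (mul_nonneg hT0.le h5) (by linarith : 0 ≤ 1 - 2 * a)]
      have e2 : (2 * T + 2) * a ≤ (2 * T + 2) * (n * L * (2 * ‖w‖)) := by gcongr
      have e3 := norm_nonneg w
      nlinarith
    calc _ ≤ (1 + T * a) * ((1 + 2 * a) * ‖v‖) := by
          gcongr
          linarith
      _ = ((1 + T * a) * (1 + 2 * a)) * ‖v‖ := by ring
      _ ≤ _ := by gcongr

/-! ### Limits of inversions -/

lemma sg_self {d : ℕ} (z : Rd d) : sg z z = z := by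
  by_contra h
  exact (sg_ne.1 h) rfl

lemma sg_int {d : ℕ} (z : Rd (d + 1)) {S : Set (Rd (d + 1))} (hS : MeasurableSet S)
    (g : Rd (d + 1) → ℝ) :
    ∫ y in sg z '' S, g y = ∫ x in S, lam z x ^ (d + 1) * g (sg z x) := by
  have hd := sg_diffeo (z := z) (U := {z}ᶜ) isOpen_compl_singleton (by simp)
  have h1 := hd.cv (S := S \ {z}) (hS.diff (measurableSet_singleton z)) (fun x hx => hx.2) g
  have h2 : sg z '' (S \ {z}) = sg z '' S \ {z} := by
    rw [image_sdiff (sg_inv z).injective, image_singleton, sg_self]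
  have ae1 : (S \ {z} : Set _) =ᵐ[volume] S := sdiff_null_ae_eq_self (by simp)
  have ae2 : (sg z '' S \ {z} : Set _) =ᵐ[volume] sg z '' S := sdiff_null_ae_eq_self (by simp)
  rw [h2, setIntegral_congr_set ae2] at h1
  rw [h1, ← setIntegral_congr_set ae1]
  refine setIntegral_congr_fun (hS.diff (measurableSet_singleton z)) (fun x hx => ?_)
  have hx2 : x ≠ z := hx.2
  simp only [sg_det hx2]

lemma lam_meas {d : ℕ} (z : Rd d) : Measurable (lam z) := by
  unfold lam
  fun_prop

lemma sg_int_tendsto {d : ℕ} {a : Rd (d + 1)} (ha : a ≠ 0) {F : Set (Rd (d + 1))}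
    (hF : MeasurableSet F) {h : Rd (d + 1) → ℝ} (hc : Continuous h) (hs : HasCompactSupport h) :
    Tendsto (fun s : ℝ => ∫ y in sg (s • a) '' F, h y) atTop (𝓝 (∫ y in rho a '' F, h y)) := by
  have h1 : ∫ y in rho a '' F, h y = ∫ x in F, h (rho a x) := by
    exact (rho a).measurePreserving.setIntegral_image_emb
      (rho a).toHomeomorph.measurableEmbedding h F
  rw [h1]
  simp_rw [sg_int _ hF]
  obtain ⟨M, hM⟩ := hs.exists_bound_of_continuous hc
  obtain ⟨D, hD⟩ := hs.isCompact.isBounded.subset_closedBall (0 : Rd (d + 1))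
  have hM0 : 0 ≤ M := (norm_nonneg _).trans (hM 0)
  set D' := max D 0
  refine tendsto_integral_filter_of_dominated_convergence
    ((ball 0 (D' + 1)).indicator (fun _ => 2 ^ (d + 1) * M)) ?_ ?_ ?_ ?_
  · refine Eventually.of_forall fun s => ?_
    exact (((lam_meas _).pow_const _).mul (hc.measurable.comp (sg_meas _))).aestronglyMeasurable
  · filter_upwards [lam_unif ha (D' + 1) (ε := 1) one_pos, sg_ball ha (R := D') (le_max_right _ _)]
      with s h2 h3
    refine Eventually.of_forall fun x => ?_
    by_cases hx : x ∈ ball (0 : Rd (d + 1)) (D' + 1)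
    · rw [indicator_of_mem hx, norm_mul, norm_pow]
      have hx' := (mem_ball_zero_iff.1 hx).le
      have h4 := (abs_le.1 (h2 x hx').2).2
      have h5 := lam_pos (h2 x hx').1
      rw [Real.norm_of_nonneg h5.le]
      gcongr
      · linarith
      · exact hM _
    · rw [indicator_of_notMem hx]
      have : h (sg (s • a) x) = 0 := by
        by_contra hne
        have h4 := hD (subset_tsupport h hne)
        rw [mem_closedBall_zero_iff] at h4
        have h5 := h3 _ (h4.trans (le_max_left _ _))
        rw [sg_inv] at h5
        exact hx (mem_ball_zero_iff.2 h5)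
      simp [this]
  · apply Integrable.integrableOn
    rw [integrable_indicator_iff measurableSet_ball]
    exact integrableOn_const (measure_ball_lt_top.ne)
  · refine Eventually.of_forall fun x => ?_
    have h2 := sg_lim ha x
    have h3 := (h2.1.pow (d + 1)).mul ((hc.tendsto _).comp h2.2)
    simpa using h3

lemma vol_sg {d : ℕ} (z : Rd (d + 1)) {S : Set (Rd (d + 1))} (hS : MeasurableSet S) :
    volume.real (sg z '' S) = ∫ x in S, lam z x ^ (d + 1) := by
  have := sg_int z hS (fun _ => 1)
  simpa using this

lemma vol_sg_tendsto {d : ℕ} {a : Rd (d + 1)} (ha : a ≠ 0) {S : Set (Rd (d + 1))}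
    (hS : MeasurableSet S) {R : ℝ} (hR : S ⊆ ball 0 R) :
    Tendsto (fun s : ℝ => volume.real (sg (s • a) '' S)) atTop (𝓝 (volume.real S)) := by
  simp_rw [vol_sg _ hS]
  have h1 : volume.real S = ∫ x in S, (1 : ℝ) := by simp
  rw [h1]
  have hfin : volume S ≠ ⊤ := ((measure_mono hR).trans_lt measure_ball_lt_top).ne
  refine tendsto_integral_filter_of_dominated_convergence (fun _ => 2 ^ (d + 1)) ?_ ?_ ?_ ?_
  · exact Eventually.of_forall fun s => ((lam_meas _).pow_const _).aestronglyMeasurable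
  · filter_upwards [lam_unif ha R (ε := 1) one_pos] with s h2
    rw [ae_restrict_iff' hS]
    refine Eventually.of_forall fun x hx => ?_
    have hx' := (mem_ball_zero_iff.1 (hR hx)).le
    have h4 := (abs_le.1 (h2 x hx').2).2
    have h5 := lam_pos (h2 x hx').1
    rw [norm_pow, Real.norm_of_nonneg h5.le]
    gcongr
    linarith
  · exact integrableOn_const hfin
  · refine Eventually.of_forall fun x => ?_
    simpa using (sg_lim ha x).1.pow (d + 1)

lemma lam_mul {d : ℕ} {z x : Rd d} (h : x ≠ z) : lam z (sg z x) * lam z x = 1 := by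
  have h1 := sg_norm h
  have h2 := sg_norm (sg_ne.2 h)
  rw [sg_inv] at h2
  rw [h1] at h2
  have : 0 < 1 + ‖x‖ ^ 2 := by positivity
  have h3 : (lam z (sg z x) * lam z x - 1) * (1 + ‖x‖ ^ 2) = 0 := by linarith
  rcases mul_eq_zero.1 h3 with h | h
  · linarith
  · exact absurd h this.ne'

/-- perimeter change under the inversion -/
lemma sg_perim {d : ℕ} {z : Rd d} {U : Set (Rd d)} (hU : IsOpen U) {q : ℝ} (hq : 0 < q)
    (h : ∀ x ∈ U, x ≠ z ∧ lam z x ≤ q ∧ lam z (sg z x) ≤ q) {F : Set (Rd d)}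
    (hF : MeasurableSet F) :
    perimOpen (sg z '' F) (sg z '' U) ≤ ENNReal.ofReal (q ^ d * q) * perimOpen F U := by
  have hd := sg_diffeo hU (z := z) (fun hz => (h z hz).1 rfl)
  refine hd.perimOpen_image_le (by positivity) (fun x hx v => ?_) hF (sg_image_meas z hF)
  obtain ⟨h1, h2, h3⟩ := h x hx
  rw [sg_det h1, sg_fderiv_norm (sg_ne.2 h1), ← mul_assoc]
  have h5 := lam_pos h1
  have h6 := lam_pos (sg_ne.2 h1)
  gcongr

/-! ### Compactly supported diffeomorphisms -/

section
variable {d : ℕ} {Ψ Θ : Rd d → Rd d} {D0 : ℝ}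

lemma psi_image (h : DiffeoOn Ψ Θ univ univ) (S : Set (Rd d)) : Ψ '' S = Θ ⁻¹' S :=
  congrFun (image_eq_preimage_of_inverse h.li h.ri) S

lemma psi_meas (h : DiffeoOn Ψ Θ univ univ) {S : Set (Rd d)} (hS : MeasurableSet S) :
    MeasurableSet (Ψ '' S) := by
  rw [psi_image h]
  exact (contDiffOn_univ.1 h.cΘ).continuous.measurable hS

lemma psi_null (h : DiffeoOn Ψ Θ univ univ) (S : Set (Rd d)) (hS : volume S = 0) :
    volume (Ψ '' S) = 0 := by
  apply addHaar_image_eq_zero_of_differentiableOn_of_addHaar_eq_zero _ _ hS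
  exact ((contDiffOn_univ.1 h.cΦ).differentiable (by norm_num)).differentiableOn

lemma psi_ball (h : DiffeoOn Ψ Θ univ univ) (ho : ∀ x, D0 ≤ ‖x‖ → Ψ x = x) (x : Rd d) :
    ‖Ψ x‖ < D0 ↔ ‖x‖ < D0 := by
  constructor
  · intro h1
    by_contra h2
    rw [ho x (not_lt.1 h2)] at h1
    exact h2 h1
  · intro h1
    by_contra h2
    have h3 := h.li.injective (ho (Ψ x) (not_lt.1 h2))
    rw [h3] at h2
    exact h2 h1

lemma theta_out (h : DiffeoOn Ψ Θ univ univ) (ho : ∀ x, D0 ≤ ‖x‖ → Ψ x = x) (x : Rd d)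
    (hx : D0 ≤ ‖x‖) : Θ x = x := by
  conv_lhs => rw [← ho x hx]
  exact h.li x

lemma psi_W (h : DiffeoOn Ψ Θ univ univ) (ho : ∀ x, D0 ≤ ‖x‖ → Ψ x = x) {W : Set (Rd d)}
    (hW : ball 0 D0 ⊆ W) : Ψ '' W = W := by
  ext y
  rw [psi_image h, mem_preimage]
  by_cases hy : D0 ≤ ‖y‖
  · rw [theta_out h ho y hy]
  · have h1 : ‖Θ y‖ < D0 := by
      rw [← psi_ball h ho, h.ri]; exact not_le.1 hy
    exact ⟨fun _ => hW (mem_ball_zero_iff.2 (not_le.1 hy)), fun _ => hW (mem_ball_zero_iff.2 h1)⟩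

lemma psi_diffeo (h : DiffeoOn Ψ Θ univ univ) (ho : ∀ x, D0 ≤ ‖x‖ → Ψ x = x) {W : Set (Rd d)}
    (hW : ball 0 D0 ⊆ W) (hWo : IsOpen W) : DiffeoOn Ψ Θ W W :=
  ⟨h.li, h.ri, hWo, hWo, psi_W h ho hW, h.cΦ.mono (subset_univ _), h.cΘ.mono (subset_univ _)⟩

lemma psi_mem_out (h : DiffeoOn Ψ Θ univ univ) (ho : ∀ x, D0 ≤ ‖x‖ → Ψ x = x) (S : Set (Rd d))
    {x : Rd d} (hx : D0 ≤ ‖x‖) : x ∈ Ψ '' S ↔ x ∈ S := by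
  rw [psi_image h, mem_preimage, theta_out h ho x hx]

lemma psi_inter (h : DiffeoOn Ψ Θ univ univ) (ho : ∀ x, D0 ≤ ‖x‖ → Ψ x = x) (S : Set (Rd d)) :
    Ψ '' S ∩ ball 0 D0 = Ψ '' (S ∩ ball 0 D0) := by
  rw [image_inter h.li.injective, psi_W h ho subset_rfl]

lemma psi_diff (h : DiffeoOn Ψ Θ univ univ) (ho : ∀ x, D0 ≤ ‖x‖ → Ψ x = x) (S : Set (Rd d)) :
    Ψ '' S \ ball 0 D0 = S \ ball 0 D0 := by
  ext x
  simp only [Set.mem_sdiff, mem_ball_zero_iff, not_lt]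
  exact and_congr_left (psi_mem_out h ho S)

lemma psi_part {N : ℕ} (h : DiffeoOn Ψ Θ univ univ) {F : Fin N → Set (Rd d)}
    (hF : IsPartition univ F) : IsPartition univ (fun k => Ψ '' F k) :=
  part_image hF ⟨h.li.injective, h.ri.surjective⟩ (fun k => psi_meas h (hF.1 k)) (psi_null h)

lemma psi_vol (h : DiffeoOn Ψ Θ univ univ) (ho : ∀ x, D0 ≤ ‖x‖ → Ψ x = x) {S : Set (Rd d)}
    (hS : volume S ≠ ⊤) :
    volume (Ψ '' S) ≠ ⊤ ∧
    volume.real (Ψ '' S) = volume.real (Ψ '' (S ∩ ball 0 D0)) + volume.real (S \ ball 0 D0) := by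
  have hfin : volume (Ψ '' S) ≠ ⊤ := by
    rw [← inter_union_sdiff (Ψ '' S) (ball 0 D0), psi_diff h ho]
    refine ((measure_union_le _ _).trans_lt (ENNReal.add_lt_top.2 ⟨?_, ?_⟩)).ne
    · exact (measure_mono inter_subset_right).trans_lt measure_ball_lt_top
    · exact (measure_mono sdiff_subset).trans_lt hS.lt_top
  refine ⟨hfin, ?_⟩
  rw [← measureReal_inter_add_sdiff (s := Ψ '' S) (t := ball 0 D0) measurableSet_ball hfin,
    psi_inter h ho, psi_diff h ho]

end

lemma sg_W {d : ℕ} {z : Rd d} {R1 : ℝ}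
    (hsg : ∀ x, ‖x‖ ≤ R1 → ‖sg z x‖ < R1 + 1) :
    closedBall 0 R1 ⊆ sg z '' ball 0 (R1 + 2) := by
  intro x hx
  rw [sg_image, mem_preimage, mem_ball_zero_iff]
  have := hsg x (mem_closedBall_zero_iff.1 hx)
  linarith

lemma claim2_step {d N : ℕ} (hyp : Hyp (d + 1) N) {p : Fin N → Rd (d + 1 + 1)} (hp : goodP p)
    (hpart : IsPartition univ (cell p)) {k₁ : Fin N} {z : Rd (d + 1)} (hz : z ∈ cell p k₁)
    {R D0 R1 q C : ℝ} (hRR : R + 1 ≤ R1) (hDR : D0 ≤ R1) (hq : 0 < q) (hC : 0 < C)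
    (hlam : ∀ x, ‖x‖ ≤ R1 + 2 → x ≠ z ∧ lam z x ≤ q ∧ lam z (sg z x) ≤ q)
    (hsg1 : ∀ x, ‖x‖ ≤ R1 → ‖sg z x‖ < R1 + 1) (hsgR : ∀ x, ‖x‖ ≤ R → ‖sg z x‖ < R + 1)
    {F : Fin N → Set (Rd (d + 1))} (hF : IsPartition univ F)
    (hEF : ∀ k x, R ≤ ‖x‖ → (x ∈ F k ↔ x ∈ cell p k))
    {Ψ Θ : Rd (d + 1) → Rd (d + 1)} (hΨ : DiffeoOn Ψ Θ univ univ)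
    (ho : ∀ x, D0 ≤ ‖x‖ → Ψ x = x)
    (hv : ∀ k, k ≠ k₁ → volume.real (Ψ '' (sg z '' F k ∩ ball 0 D0)) =
      volume.real (sg z '' F k ∩ ball 0 D0) + (volume.real (sg z '' (cell p k ∩ ball 0 R)) -
        volume.real (sg z '' (F k ∩ ball 0 R))))
    (hb : ∀ x v, |(fderiv ℝ Ψ x).det| * ‖fderiv ℝ Θ (Ψ x) v‖ ≤ C * ‖v‖) :
    ∑ k, perimOpen (cell p k) (ball 0 (R1 + 2)) ≤
      ENNReal.ofReal (q ^ (d + 1) * q) * (ENNReal.ofReal C * (ENNReal.ofReal (q ^ (d + 1) * q) *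
        ∑ k, perimOpen (F k) (ball 0 (R1 + 2)))) := by
  set V := ball (0 : Rd (d + 1)) (R1 + 2) with hV
  set W := sg z '' V with hW
  set p' : Fin N → Rd (d + 1 + 1) := fun k => Qr z (p k) with hp'
  have hVo : IsOpen V := isOpen_ball
  have hzV : z ∉ V := fun h => (hlam z (mem_ball_zero_iff.1 h).le).1 rfl
  have hWo : IsOpen W := (sg_diffeo hVo hzV).oW
  have hBW : closedBall 0 R1 ⊆ W := sg_W hsg1
  have hDW : ball 0 D0 ⊆ W := (ball_subset_ball hDR).trans (ball_subset_closedBall.trans hBW)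
  have hVW : sg z '' W = V := by
    rw [hW, image_image]; simp [sg_inv z _]
  have hpb : ∀ j, j ≠ k₁ → pb (p' j) < pb (p' k₁) := by
    intro j hj
    simp only [hp', pb_Qr]
    have := hz j hj
    gcongr
  have hinj := (sg_inv z).injective
  -- step A
  have hA : ∀ k, perimOpen (cell p k) V ≤
      ENNReal.ofReal (q ^ (d + 1) * q) * perimOpen (cell p' k) W := by
    intro k
    have h1 := sg_perim (z := z) hWo hq (F := sg z '' cell p k) (by
      rintro _ ⟨x, hx, rfl⟩
      obtain ⟨h1, h2, h3⟩ := hlam x (mem_ball_zero_iff.1 hx).le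
      rw [sg_inv]
      exact ⟨sg_ne.2 h1, h3, h2⟩) (sg_image_meas z (cell_meas p k))
    rw [hVW, image_image] at h1
    simp only [sg_inv z _, image_id'] at h1
    refine h1.trans_eq ?_
    congr 1
    refine perimOpen_congr (sg_image_meas z (cell_meas p k)) (cell_meas _ k) ?_
    refine measure_mono_null inter_subset_left ?_
    rw [symmDiff_comm]
    exact cell_sg_ae p z k
  -- step C
  have hCc : ∀ k, perimOpen (Ψ '' (sg z '' F k)) W ≤
      ENNReal.ofReal C * perimOpen (sg z '' F k) W := fun k =>
    (psi_diffeo hΨ ho hDW hWo).perimOpen_image_le hC (fun x _ v => hb x v)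
      (sg_image_meas z (hF.1 k)) (psi_meas hΨ (sg_image_meas z (hF.1 k)))
  -- step D
  have hD : ∀ k, perimOpen (sg z '' F k) W ≤
      ENNReal.ofReal (q ^ (d + 1) * q) * perimOpen (F k) V := fun k =>
    sg_perim hVo hq (fun x hx => hlam x (mem_ball_zero_iff.1 hx).le) (hF.1 k)
  -- step B
  have hG : IsPartition univ (fun k => sg z '' F k) :=
    part_image hF (sg_inv z).bijective (fun k => sg_image_meas z (hF.1 k)) (fun S => sg_null z)
  have hF' : IsPartition univ (fun k => Ψ '' (sg z '' F k)) := psi_part hΨ hG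
  have hout : ∀ k, volume ((cell p' k ∆ (Ψ '' (sg z '' F k))) \ closedBall 0 R1) = 0 := by
    intro k
    refine measure_mono_null (t := cell p' k ∆ (sg z '' cell p k)) ?_ (cell_sg_ae p z k)
    rintro x ⟨hx, hxR⟩
    rw [mem_closedBall_zero_iff, not_le] at hxR
    have h1 := psi_mem_out hΨ ho (sg z '' F k) (x := x) (hDR.trans hxR.le)
    have h2 : R ≤ ‖sg z x‖ := by
      by_contra h3
      have := hsgR _ (not_le.1 h3).le
      rw [sg_inv] at this
      linarith
    have h3 := hEF k _ h2
    rw [mem_symmDiff, h1, sg_image, mem_preimage, h3] at hx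
    rw [mem_symmDiff, sg_image, mem_preimage]
    exact hx
  have hvol : ∀ k, k ≠ k₁ → volume (Ψ '' (sg z '' F k)) = volume (cell p' k) := by
    intro k hk
    have hae : volume (cell p' k) = volume (sg z '' cell p k) :=
      measure_congr (measure_symmDiff_eq_zero_iff.1 (cell_sg_ae p z k))
    have hcf : volume (sg z '' cell p k) ≠ ⊤ := by
      rw [← hae]
      obtain ⟨R', hR'⟩ := (cell_bdd (hpb k hk)).exists
      exact ((measure_mono hR').trans_lt measure_ball_lt_top).ne
    have hdiff : F k \ ball 0 R = cell p k \ ball 0 R := by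
      ext x
      simp only [Set.mem_sdiff, mem_ball_zero_iff, not_lt]
      exact and_congr_left (hEF k x)
    have hsub : ∀ S : Set (Rd (d + 1)), sg z '' (S ∩ ball 0 R) ⊆ ball 0 (R + 1) := by
      rintro S _ ⟨x, hx, rfl⟩
      exact mem_ball_zero_iff.2 (hsgR x (mem_ball_zero_iff.1 hx.2).le)
    have hsf : ∀ S : Set (Rd (d + 1)), volume (sg z '' (S ∩ ball 0 R)) ≠ ⊤ := fun S =>
      ((measure_mono (hsub S)).trans_lt measure_ball_lt_top).ne
    have hdf : volume (sg z '' (cell p k \ ball 0 R)) ≠ ⊤ :=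
      ((measure_mono (image_mono sdiff_subset)).trans_lt hcf.lt_top).ne
    have hsplit : ∀ S : Set (Rd (d + 1)), MeasurableSet S →
        volume (sg z '' (S \ ball 0 R)) ≠ ⊤ →
        volume (sg z '' S) ≠ ⊤ ∧ volume.real (sg z '' S) =
        volume.real (sg z '' (S ∩ ball 0 R)) + volume.real (sg z '' (S \ ball 0 R)) := by
      intro S hS hSd
      have h1 : sg z '' S = sg z '' (S ∩ ball 0 R) ∪ sg z '' (S \ ball 0 R) := by
        rw [← image_union, inter_union_sdiff]
      have h2 : Disjoint (sg z '' (S ∩ ball 0 R)) (sg z '' (S \ ball 0 R)) := by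
        rw [disjoint_image_iff hinj]
        exact disjoint_sdiff_right.mono_left inter_subset_right
      rw [h1]
      refine ⟨((measure_union_le _ _).trans_lt
        (ENNReal.add_lt_top.2 ⟨(hsf S).lt_top, hSd.lt_top⟩)).ne, ?_⟩
      exact measureReal_union h2 (sg_image_meas z (hS.diff measurableSet_ball)) (hsf S) hSd
    obtain ⟨-, e1⟩ := hsplit (cell p k) (cell_meas p k) hdf
    obtain ⟨f2, e2⟩ := hsplit (F k) (hF.1 k) (by rw [hdiff]; exact hdf)
    obtain ⟨f3, e3⟩ := psi_vol hΨ ho f2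
    have e4 := measureReal_inter_add_sdiff (μ := volume) (s := sg z '' F k) (t := ball 0 D0)
      measurableSet_ball f2
    rw [hdiff] at e2
    have e5 := hv k hk
    rw [hae, ← ENNReal.toReal_eq_toReal_iff' f3 hcf]
    change volume.real _ = volume.real _
    linarith
  have hmin := cluster_min hyp (hp.Qr z) (part_cell_Qr hpart z) hpb isClosed_closedBall hF' hout hvol
  have hB := perimOpen_le_of_perim_le isClosed_closedBall hWo hBW (cell_meas p') hF'.1 hout hmin
  calc ∑ k, perimOpen (cell p k) V
      ≤ ∑ k, ENNReal.ofReal (q ^ (d + 1) * q) * perimOpen (cell p' k) W :=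
        Finset.sum_le_sum fun k _ => hA k
    _ = ENNReal.ofReal (q ^ (d + 1) * q) * ∑ k, perimOpen (cell p' k) W := by
        rw [Finset.mul_sum]
    _ ≤ ENNReal.ofReal (q ^ (d + 1) * q) * ∑ k, perimOpen (Ψ '' (sg z '' F k)) W := by gcongr
    _ ≤ ENNReal.ofReal (q ^ (d + 1) * q) * (ENNReal.ofReal C * (ENNReal.ofReal (q ^ (d + 1) * q) *
        ∑ k, perimOpen (F k) V)) := by
        gcongr
        rw [Finset.mul_sum, Finset.mul_sum]
        exact Finset.sum_le_sum fun k _ => (hCc k).trans (by gcongr; exact hD k)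

/-! ### Claim 2 -/

lemma inner_cone_pos {d N : ℕ} {p : Fin N → Rd (d + 1)} (hp : goodP p) {i j : Fin N} (hij : i ≠ j)
    (hb : pb (p i) = pb (p j)) : 0 < inner ℝ (pa (p i)) (pa (p i) - pa (p j)) := by
  have h1 := norm_split (p i)
  have h2 := norm_split (p j)
  rw [hp.2.1] at h1 h2
  have h3 : pa (p i) - pa (p j) ≠ 0 := by
    intro h
    exact hij (hp.1 (ext_split (sub_eq_zero.1 h) hb))
  have h4 : 0 < ‖pa (p i) - pa (p j)‖ := norm_pos_iff.2 h3
  have h5 := norm_sub_sq_real (pa (p i)) (pa (p j))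
  rw [inner_sub_right, real_inner_self_eq_norm_sq]
  rw [hb] at h1
  nlinarith

lemma z_in_cell {d N : ℕ} {p : Fin N → Rd (d + 1)} (hp : goodP p) {k₁ : Fin N}
    (hmax : ∀ j, pb (p j) ≤ pb (p k₁)) (ha : pa (p k₁) ≠ 0) :
    ∀ᶠ s : ℝ in atTop, s • pa (p k₁) ∈ cell p k₁ := by
  have : ∀ j, ∀ᶠ s : ℝ in atTop, j ≠ k₁ → ff (p j) (s • pa (p k₁)) < ff (p k₁) (s • pa (p k₁)) := by
    intro j
    by_cases hj : j = k₁
    · simp [hj]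
    rcases (hmax j).lt_or_eq with h | h
    · have ht : Tendsto (fun s : ℝ => s * ‖pa (p k₁)‖) atTop atTop :=
        tendsto_id.atTop_mul_const (norm_pos_iff.2 ha)
      filter_upwards [ht.eventually (ff_dom h), eventually_ge_atTop 0] with s hs hs0 _
      apply hs
      rw [norm_smul, Real.norm_of_nonneg hs0]
    · filter_upwards [eventually_gt_atTop 0] with s hs _
      have h1 := ff_sub (p k₁) (p j) (s • pa (p k₁))
      rw [h, sub_self, mul_zero, add_zero, inner_smul_left] at h1
      simp only [conj_trivial] at h1
      have h2 := inner_cone_pos hp (Ne.symm hj) h.symm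
      have h3 := mul_pos hs h2
      linarith
  filter_upwards [eventually_all.2 this] with s hs j hj using hs j hj

lemma cell_pos {d N : ℕ} {p : Fin N → Rd (d + 1)} (hp : goodP p) (k : Fin N)
    (hk : p k ≠ northPole d) : volume (cell p k) ≠ 0 := by
  refine ((cell_open p k).measure_pos volume ⟨stereoProj d (p k), fun j hj => ?_⟩).ne'
  rw [ff_stereo (hp.2.1 k) hk, ff_stereo (hp.2.1 k) hk]
  have h1 := pb_lt_one (hp.2.1 k) hk
  have h2 : inner ℝ (p k) (p j) < 1 :=
    (inner_lt_one_iff_real_of_norm_eq_one (hp.2.1 k) (hp.2.1 j)).2 (fun h => hj (hp.1 h).symm)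
  have h3 : inner ℝ (p k) (p k) = 1 := by
    rw [real_inner_self_eq_norm_sq, hp.2.1 k]; norm_num
  rw [h3]
  have : 0 < 2 / (1 - pb (p k)) := div_pos two_pos (by linarith)
  gcongr

lemma ne_pole {d N : ℕ} {p : Fin N → Rd (d + 1)} (hp : goodP p) {k₁ : Fin N}
    (hmax : ∀ j, pb (p j) ≤ pb (p k₁)) (ha : pa (p k₁) ≠ 0) (k : Fin N) : p k ≠ northPole d := by
  intro h
  have h1 := hmax k
  rw [h, pole_mk, pb_mk] at h1
  have h2 := norm_split (p k₁)
  rw [hp.2.1] at h2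
  have h3 : 0 < ‖pa (p k₁)‖ := norm_pos_iff.2 ha
  nlinarith

lemma ennreal_limit {A P : ℝ≥0∞} {n : ℕ} {C : ℝ}
    (h : ∀ ε : ℝ, 0 < ε → A ≤ ENNReal.ofReal ((1 + ε) ^ n * (1 + ε)) * (ENNReal.ofReal (1 + C * ε) *
      (ENNReal.ofReal ((1 + ε) ^ n * (1 + ε)) * P))) : A ≤ P := by
  have h1 : Tendsto (fun ε : ℝ => ENNReal.ofReal ((1 + ε) ^ n * (1 + ε))) (𝓝[>] 0) (𝓝 1) := by
    have : Continuous (fun ε : ℝ => ENNReal.ofReal ((1 + ε) ^ n * (1 + ε))) :=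
      ENNReal.continuous_ofReal.comp (by fun_prop)
    have := (this.tendsto 0).mono_left (nhdsWithin_le_nhds (s := Ioi 0))
    simpa using this
  have h2 : Tendsto (fun ε : ℝ => ENNReal.ofReal (1 + C * ε)) (𝓝[>] 0) (𝓝 1) := by
    have : Continuous (fun ε : ℝ => ENNReal.ofReal (1 + C * ε)) :=
      ENNReal.continuous_ofReal.comp (by fun_prop)
    have := (this.tendsto 0).mono_left (nhdsWithin_le_nhds (s := Ioi 0))
    simpa using this
  have h3 := ENNReal.Tendsto.mul_const (b := P) (ENNReal.Tendsto.mul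
    (ENNReal.Tendsto.mul h1 (by simp) h2 (by simp)) (by simp) h1 (by simp)) (by simp)
  simp only [mul_one, one_mul] at h3
  refine ge_of_tendsto h3 ?_
  filter_upwards [self_mem_nhdsWithin] with ε hε
  refine (h ε hε).trans_eq ?_
  ring

lemma claim2 {d N : ℕ} (hyp : Hyp (d + 1) N) {p : Fin N → Rd (d + 1 + 1)} (hp : goodP p)
    (hpart : IsPartition univ (cell p)) {k₁ : Fin N} (hmax : ∀ j, pb (p j) ≤ pb (p k₁))
    (ha : pa (p k₁) ≠ 0) {R : ℝ} (hR : 0 < R)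
    {F : Fin N → Set (Rd (d + 1))} (hF : IsPartition univ F)
    (hEF : ∀ k x, R ≤ ‖x‖ → (x ∈ F k ↔ x ∈ cell p k))
    (hv : ∀ k, k ≠ k₁ → volume (F k ∩ ball 0 R) = volume (cell p k ∩ ball 0 R)) :
    ∑ k, perim (cell p k) (closedBall 0 R) ≤ ∑ k, perim (F k) (closedBall 0 R) := by
  set a := pa (p k₁) with hadef
  have hdiff : ∀ k, F k \ ball 0 R = cell p k \ ball 0 R := by
    intro k
    ext x
    simp only [Set.mem_sdiff, mem_ball_zero_iff, not_lt]
    exact and_congr_left (hEF k x)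
  have hFpos : ∀ k, k ≠ k₁ → volume (F k) ≠ 0 := by
    intro k hk
    rw [← measure_inter_add_sdiff (F k) (measurableSet_ball (x := (0 : Rd (d + 1))) (ε := R)),
      hv k hk, hdiff, measure_inter_add_sdiff _ measurableSet_ball]
    exact cell_pos hp k (ne_pole hp hmax ha k)
  have hrm : ∀ S : Set (Rd (d + 1)), volume (rho a '' S) = volume S := by
    intro S
    have := (rho a).symm.measurePreserving.measure_preimage_emb
      (rho a).symm.toHomeomorph.measurableEmbedding S
    rw [← this]
    congr 1
    exact (rho a).toEquiv.image_eq_preimage_symm S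
  -- fields
  obtain ⟨X, hX, hXint⟩ := exists_fields (ι := {k : Fin N // k ≠ k₁}) (fun k => rho a '' F k)
    (fun k => (rho a).toHomeomorph.measurableEmbedding.measurableSet_image.2 (hF.1 k))
    (fun k => by rw [hrm]; exact hFpos k k.2)
    (fun k j hkj => by
      rw [← image_inter (rho a).injective, hrm]
      have := hF.2.1 k j (fun h => hkj (Subtype.ext h))
      rwa [inter_univ] at this) (by
      have h1 : rho a '' (cell p k₁ \ closedBall 0 R) ⊆
          (⋃ k : {k : Fin N // k ≠ k₁}, rho a '' F k)ᶜ := by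
        rintro _ ⟨x, hx, rfl⟩ h
        obtain ⟨k, x', hx', hxx⟩ := mem_iUnion.1 h
        have : x' = x := (rho a).injective hxx
        subst this
        have h2 := hx.2
        rw [mem_closedBall_zero_iff, not_le] at h2
        exact cell_disj p k.2 ((hEF k x' h2.le).1 hx') hx.1
      intro h2
      have h3 := measure_mono_null h1 h2
      rw [hrm] at h3
      have h4 : IsOpen (cell p k₁ \ closedBall 0 R) := (cell_open p k₁).sdiff isClosed_closedBall
      have ht : Tendsto (fun s : ℝ => s * ‖a‖) atTop atTop :=
        tendsto_id.atTop_mul_const (norm_pos_iff.2 ha)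
      obtain ⟨s, hs1, hs2, hs3⟩ := ((z_in_cell hp hmax ha).and
        ((ht.eventually_gt_atTop R).and (eventually_ge_atTop 0))).exists
      refine (h4.measure_pos volume ⟨s • a, hs1, ?_⟩).ne' h3
      rw [mem_closedBall_zero_iff, norm_smul, Real.norm_of_nonneg hs3, not_le]
      exact hs2)
  obtain ⟨D0, hD0, r0, hr0, ε0, hε0, c0, hc0, C, hC, hfix⟩ := vol_fix hX
  set R1 := max D0 (R + 1) with hR1
  have hR1p : 0 < R1 := hD0.trans_le (le_max_left _ _)
  have key : ∑ k, perimOpen (cell p k) (ball 0 (R1 + 2)) ≤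
      ∑ k, perimOpen (F k) (ball 0 (R1 + 2)) := by
    refine ennreal_limit (n := d + 1) (C := C) fun ε hε => ?_
    have hη : 0 < ε / (1 + ε) := by positivity
    have hint : ∀ᶠ s : ℝ in atTop, ∀ k j : {k : Fin N // k ≠ k₁},
        |(∫ x in sg (s • a) '' F k, vdiv (X j) x) - (if k = j then 1 else 0)| ≤ c0 := by
      rw [eventually_all]; intro k
      rw [eventually_all]; intro j
      have h1 := sg_int_tendsto ha (hF.1 k) (vdiv_cont (hX j).test.cd) (vdiv_cs (hX j).test.cs)
      rw [hXint k j, Metric.tendsto_nhds] at h1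
      filter_upwards [h1 c0 hc0] with s hs
      rw [Real.dist_eq] at hs
      exact hs.le
    set w : ℝ → {k : Fin N // k ≠ k₁} → ℝ := fun s k =>
      volume.real (sg (s • a) '' (cell p k ∩ ball 0 R)) -
        volume.real (sg (s • a) '' (F k ∩ ball 0 R)) with hw
    have hwlim : Tendsto w atTop (𝓝 0) := by
      rw [tendsto_pi_nhds]
      intro k
      have h1 := vol_sg_tendsto ha ((cell_meas p k).inter measurableSet_ball)
        (inter_subset_right (s := cell p k) (t := ball 0 R))
      have h2 := vol_sg_tendsto ha ((hF.1 k).inter measurableSet_ball)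
        (inter_subset_right (s := F k) (t := ball 0 R))
      have h3 := h1.sub h2
      have h4 : volume.real (F k ∩ ball 0 R) = volume.real (cell p k ∩ ball 0 R) := by
        simp only [measureReal_def, hv k k.2]
      rw [h4, sub_self] at h3
      exact h3
    have hwn : ∀ᶠ s : ℝ in atTop, ‖w s‖ < min ε ε0 := by
      have := hwlim.norm
      rw [norm_zero] at this
      exact this.eventually_lt_const (lt_min hε hε0)
    obtain ⟨s, hs1, hs2, hs3, hs4, hs5, hs6⟩ := (hint.and (hwn.and ((z_in_cell hp hmax ha).and
      ((lam_unif ha (R1 + 2) hη).and ((sg_ball ha hR1p.le).and (sg_ball ha hR.le)))))).exists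
    obtain ⟨Ψ, Θ, hΨ, ho, -, hvol, hb⟩ := hfix (fun k => sg (s • a) '' F k)
      (fun k => sg_image_meas _ (hF.1 k)) hs1 (w s) (hs2.le.trans (min_le_right _ _))
    refine claim2_step hyp hp hpart hs3 (R := R) (D0 := D0) (R1 := R1) (le_max_right _ _)
      (le_max_left _ _) (by positivity) (by positivity) ?_ hs5 hs6 hF hEF hΨ ho
      (fun k hk => hvol ⟨k, hk⟩) ?_
    · intro x hx
      obtain ⟨h1, h2⟩ := hs4 x hx
      have h3 := abs_le.1 h2
      have h4 := lam_mul h1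
      have h5 := lam_pos h1
      have h6 := lam_pos (sg_ne.2 h1)
      have h7 : ε / (1 + ε) * (1 + ε) = ε := by field_simp
      have h8 : 1 ≤ lam (s • a) x * (1 + ε) := by nlinarith
      refine ⟨h1, ?_, ?_⟩
      · have : ε / (1 + ε) ≤ ε := div_le_self hε.le (by linarith)
        linarith
      · nlinarith
    · intro x v
      refine (hb x v).trans ?_
      have : ‖w s‖ ≤ ε := hs2.le.trans (min_le_left _ _)
      gcongr
  have h0 : R < R1 + 2 := by have := le_max_right D0 (R + 1); linarith
  have := perim_le_of_perimOpen_le (δ := 0) isClosed_closedBall isOpen_ball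
    (closedBall_subset_ball h0) (cell_meas p) hF.1 (fun k => ?_) (fun k => cell_perim_ball p k _)
    (by rw [add_zero]; exact key)
  · rwa [add_zero] at this
  · refine measure_mono_null (t := ∅) ?_ measure_empty
    rintro x ⟨hx, hxR⟩
    rw [mem_closedBall_zero_iff, not_le] at hxR
    have := hEF k x hxR.le
    rw [mem_symmDiff] at hx
    tauto

/-! ### Scaling and blow-down cones -/

lemma scale_diffeo {d : ℕ} {Ψ Θ : Rd d → Rd d} (h : DiffeoOn Ψ Θ univ univ) {n : ℝ} (hn : 0 < n) :
    DiffeoOn (fun x => n • Ψ (n⁻¹ • x)) (fun x => n • Θ (n⁻¹ • x)) univ univ := by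
  have hli : Function.LeftInverse (fun x => n • Θ (n⁻¹ • x)) (fun x => n • Ψ (n⁻¹ • x)) := by
    intro x
    simp only [inv_smul_smul₀ hn.ne', h.li _, smul_inv_smul₀ hn.ne']
  have hri : Function.RightInverse (fun x => n • Θ (n⁻¹ • x)) (fun x => n • Ψ (n⁻¹ • x)) := by
    intro x
    simp only [inv_smul_smul₀ hn.ne', h.ri _, smul_inv_smul₀ hn.ne']
  have h1 := contDiffOn_univ.1 h.cΦ
  have h2 := contDiffOn_univ.1 h.cΘ
  refine ⟨hli, hri, isOpen_univ, isOpen_univ, image_univ_of_surjective hri.surjective, ?_, ?_⟩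
  · rw [contDiffOn_univ]; fun_prop
  · rw [contDiffOn_univ]; fun_prop

lemma scale_fderiv {d : ℕ} {Ψ : Rd d → Rd d} (h : Differentiable ℝ Ψ) {n : ℝ} (hn : 0 < n)
    (x : Rd d) : fderiv ℝ (fun x => n • Ψ (n⁻¹ • x)) x = fderiv ℝ Ψ (n⁻¹ • x) := by
  have h1 : HasFDerivAt (fun x : Rd d => n⁻¹ • x) (n⁻¹ • ContinuousLinearMap.id ℝ (Rd d)) x :=
    (hasFDerivAt_id x).const_smul n⁻¹
  have h2 := (HasFDerivAt.comp (g := Ψ) (f := fun x : Rd d => n⁻¹ • x) x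
    (h (n⁻¹ • x)).hasFDerivAt h1).const_smul n
  have h3 := h2.fderiv
  have e : (n • (Ψ ∘ fun x : Rd d => n⁻¹ • x)) = fun x => n • Ψ (n⁻¹ • x) := rfl
  rw [e] at h3
  rw [h3]
  ext1 v
  simp [smul_smul, hn.ne']

lemma vol_scale {d : ℕ} {n : ℝ} (hn : 0 < n) (S : Set (Rd d)) :
    volume.real ((fun x => n • x) ⁻¹' S) = (n ^ d)⁻¹ * volume.real S := by
  have := Measure.addHaar_preimage_smul (volume : Measure (Rd d)) hn.ne' S
  rw [measureReal_def, this, ENNReal.toReal_mul, measureReal_def]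
  simp [abs_of_pos hn]
  left; positivity

def cone {d N : ℕ} (p : Fin N → Rd (d + 1)) (k : Fin N) : Set (Rd d) :=
  {x | ∀ j, j ≠ k → pb (p j) = pb (p k) → 0 < inner ℝ x (pa (p k) - pa (p j))}

lemma cone_open {d N : ℕ} (p : Fin N → Rd (d + 1)) (k : Fin N) : IsOpen (cone p k) := by
  have : cone p k = ⋂ j, {x | j ≠ k → pb (p j) = pb (p k) →
      0 < inner ℝ x (pa (p k) - pa (p j))} := by ext x; simp [cone]
  rw [this]
  refine isOpen_iInter_of_finite fun j => ?_
  by_cases h : j ≠ k ∧ pb (p j) = pb (p k)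
  · simp only [h.1, h.2, ne_eq, not_false_eq_true, forall_const]
    exact isOpen_lt continuous_const (by fun_prop)
  · have : {x : Rd d | j ≠ k → pb (p j) = pb (p k) →
      0 < inner ℝ x (pa (p k) - pa (p j))} = univ := by
      ext x; simp only [mem_ofPred_eq, mem_univ, iff_true]; tauto
    rw [this]; exact isOpen_univ

lemma cone_pos {d N : ℕ} {p : Fin N → Rd (d + 1)} (hp : goodP p) (k : Fin N) :
    volume (cone p k) ≠ 0 :=
  ((cone_open p k).measure_pos volume
    ⟨pa (p k), fun _ hj hb => inner_cone_pos hp (Ne.symm hj) hb.symm⟩).ne'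

lemma cone_disj {d N : ℕ} (p : Fin N → Rd (d + 1)) {k j : Fin N} (h : k ≠ j)
    (hb : pb (p k) = pb (p j)) {x} (hk : x ∈ cone p k) (hj : x ∈ cone p j) : False := by
  have h1 := hk j h.symm hb.symm
  have h2 := hj k h hb
  rw [← neg_sub, inner_neg_right] at h2
  linarith

lemma hyperplane_null {d : ℕ} {v : Rd d} (hv : v ≠ 0) : volume {x : Rd d | inner ℝ x v = 0} = 0 := by
  have h := Measure.addHaar_submodule (volume : Measure (Rd d)) (Submodule.span ℝ {v})ᗮ (by
    intro h
    have h1 : v ∈ (Submodule.span ℝ {v})ᗮ := by rw [h]; trivial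
    rw [Submodule.mem_orthogonal_singleton_iff_inner_right] at h1
    exact hv (inner_self_eq_zero.1 h1))
  convert h using 2
  ext x
  simp only [mem_ofPred_eq, SetLike.mem_coe]
  rw [Submodule.mem_orthogonal_singleton_iff_inner_left]

lemma cone_lim {d N : ℕ} {p : Fin N → Rd (d + 1 + 1)} (hp : goodP p) {k : Fin N}
    (hmax : ∀ j, pb (p j) ≤ pb (p k)) {F : Set (Rd (d + 1))} {r : ℝ}
    (hEF : ∀ x, r ≤ ‖x‖ → (x ∈ F ↔ x ∈ cell p k)) :
    ∀ᵐ x : Rd (d + 1), ∀ᶠ n : ℝ in atTop, (n • x ∈ F ↔ x ∈ cone p k) := by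
  have h0 : ∀ᵐ x : Rd (d + 1), x ≠ 0 := by
    rw [ae_iff]; simp
  have h1 : ∀ᵐ x : Rd (d + 1), ∀ j, j ≠ k → pb (p j) = pb (p k) →
      inner ℝ x (pa (p k) - pa (p j)) ≠ 0 := by
    rw [ae_all_iff]; intro j
    by_cases h : j ≠ k ∧ pb (p j) = pb (p k)
    · have hv : pa (p k) - pa (p j) ≠ 0 := by
        intro h'
        exact h.1 (hp.1 (ext_split (sub_eq_zero.1 h') h.2.symm)).symm
      have := hyperplane_null hv
      rw [ae_iff]
      simpa [h.1, h.2] using this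
    · exact Eventually.of_forall fun x ha hb => absurd ⟨ha, hb⟩ h
  filter_upwards [h0, h1] with x hx0 hx1
  have ht : Tendsto (fun n : ℝ => n * ‖x‖) atTop atTop :=
    tendsto_id.atTop_mul_const (norm_pos_iff.2 hx0)
  have hdom : ∀ᶠ n : ℝ in atTop, ∀ j, pb (p j) ≠ pb (p k) →
      ∀ y : Rd (d + 1), n * ‖x‖ ≤ ‖y‖ → ff (p j) y < ff (p k) y := by
    rw [eventually_all]; intro j
    by_cases h : pb (p j) = pb (p k)
    · simp [h]
    · filter_upwards [ht.eventually (ff_dom (lt_of_le_of_ne (hmax j) h))] with n hn _ using hn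
  filter_upwards [hdom, ht.eventually_ge_atTop r, eventually_gt_atTop 0] with n hn hr hn0
  have hnx : ‖n • x‖ = n * ‖x‖ := by rw [norm_smul, Real.norm_of_nonneg hn0.le]
  rw [hEF _ (hnx ▸ hr)]
  refine forall_congr' fun j => imp_congr_right fun hj => ?_
  by_cases hb : pb (p j) = pb (p k)
  · have h2 := ff_sub (p k) (p j) (n • x)
    rw [hb, sub_self, mul_zero, add_zero, inner_smul_left] at h2
    simp only [conj_trivial] at h2
    constructor
    · intro h _
      have : 0 < n * inner ℝ x (pa (p k) - pa (p j)) := by linarith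
      exact (mul_pos_iff_of_pos_left hn0).1 this
    · intro h
      have := mul_pos hn0 (h hb)
      linarith
  · exact ⟨fun _ h => absurd h hb, fun _ => hn j hb _ hnx.ge⟩

lemma cone_int_tendsto {d N : ℕ} {p : Fin N → Rd (d + 1 + 1)} (hp : goodP p) {k : Fin N}
    (hmax : ∀ j, pb (p j) ≤ pb (p k)) {F : Set (Rd (d + 1))} (hF : MeasurableSet F) {r : ℝ}
    (hEF : ∀ x, r ≤ ‖x‖ → (x ∈ F ↔ x ∈ cell p k))
    {h : Rd (d + 1) → ℝ} (hc : Continuous h) (hs : HasCompactSupport h) :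
    Tendsto (fun n : ℝ => ∫ y in (fun x => n • x) ⁻¹' F, h y) atTop (𝓝 (∫ y in cone p k, h y)) := by
  have hm : ∀ n : ℝ, MeasurableSet ((fun x : Rd (d + 1) => n • x) ⁻¹' F) := fun n =>
    (measurable_const_smul n) hF
  simp_rw [← integral_indicator (hm _), ← integral_indicator (cone_open p k).measurableSet]
  have hint : Integrable h := hc.integrable_of_hasCompactSupport hs
  refine tendsto_integral_filter_of_dominated_convergence (fun x => ‖h x‖) ?_ ?_ hint.norm ?_
  · exact Eventually.of_forall fun n => hc.aestronglyMeasurable.indicator (hm n)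
  · exact Eventually.of_forall fun n => Eventually.of_forall fun x => norm_indicator_le_norm_self _ _
  · filter_upwards [cone_lim hp hmax hEF] with x hx
    refine tendsto_const_nhds.congr' ?_
    filter_upwards [hx] with n hn
    by_cases hxc : x ∈ cone p k
    · rw [indicator_of_mem hxc, indicator_of_mem (s := (fun x => n • x) ⁻¹' F) (hn.2 hxc)]
    · rw [indicator_of_notMem hxc, indicator_of_notMem (s := (fun x => n • x) ⁻¹' F)]
      exact fun h => hxc (hn.1 h)

/-! ### The blow-down step -/

lemma symm_out {d N : ℕ} {p : Fin N → Rd (d + 1)} {F : Fin N → Set (Rd d)} {r : ℝ}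
    (hEF : ∀ k x, r ≤ ‖x‖ → (x ∈ F k ↔ x ∈ cell p k)) (k : Fin N) :
    volume ((cell p k ∆ F k) \ closedBall 0 r) = 0 := by
  refine measure_mono_null (t := ∅) ?_ measure_empty
  rintro x ⟨hx, hxR⟩
  rw [mem_closedBall_zero_iff, not_le] at hxR
  have := hEF k x hxR.le
  rw [mem_symmDiff] at hx
  tauto

lemma step1_n {d N : ℕ} (hyp : Hyp (d + 1) N) {p : Fin N → Rd (d + 1 + 1)} (hp : goodP p)
    (hpart : IsPartition univ (cell p)) {k₁ : Fin N} (hmax : ∀ j, pb (p j) ≤ pb (p k₁))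
    (ha : pa (p k₁) ≠ 0) {r : ℝ}
    {F : Fin N → Set (Rd (d + 1))} (hF : IsPartition univ F)
    (hEF : ∀ k x, r ≤ ‖x‖ → (x ∈ F k ↔ x ∈ cell p k))
    (hbd : ∀ k, pb (p k) ≠ pb (p k₁) → cell p k ⊆ ball 0 r)
    (hv : ∀ k, volume (F k) = volume (cell p k))
    {Φ Θ : Rd (d + 1) → Rd (d + 1)} (hΦ : DiffeoOn Φ Θ univ univ) {T rr C : ℝ}
    (ho : ∀ x, T ≤ ‖x‖ → Φ x = x) (hT : 0 < T) (hrT : r ≤ T)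
    (htr : ∃ c, ∀ x, ‖x‖ < rr → Φ x = x + c) (hrr : r ≤ rr)
    (hvol : ∀ k, k ≠ k₁ → pb (p k) = pb (p k₁) → volume.real (Φ '' (F k ∩ ball 0 T)) =
      volume.real (F k ∩ ball 0 T) + (volume.real (cell p k ∩ ball 0 r) -
        volume.real (F k ∩ ball 0 r))) (hC : 0 < C)
    (hb : ∀ x v, |(fderiv ℝ Φ x).det| * ‖fderiv ℝ Θ (Φ x) v‖ ≤ C * ‖v‖) :
    ∑ k, perimOpen (cell p k) (ball 0 (2 * T)) ≤
      ENNReal.ofReal C * ∑ k, perimOpen (F k) (ball 0 (2 * T)) := by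
  have hF' := psi_part hΦ hF
  have hEF' : ∀ k x, T ≤ ‖x‖ → (x ∈ Φ '' F k ↔ x ∈ cell p k) := fun k x hx => by
    rw [psi_mem_out hΦ ho (F k) hx]
    exact hEF k x (hrT.trans hx)
  have hfb : ∀ S : Set (Rd (d + 1)), ∀ T : ℝ, volume (S ∩ ball 0 T) ≠ ⊤ := fun S T =>
    ((measure_mono inter_subset_right).trans_lt measure_ball_lt_top).ne
  have hvv : ∀ k, k ≠ k₁ → volume (Φ '' F k ∩ ball 0 T) = volume (cell p k ∩ ball 0 T) := by
    intro k hk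
    by_cases hkK : pb (p k) = pb (p k₁)
    · have h1 := hvol k hk hkK
      have hsplit : ∀ S : Set (Rd (d + 1)), volume.real (S ∩ ball 0 T) =
          volume.real (S ∩ ball 0 r) + volume.real ((S ∩ ball 0 T) \ ball 0 r) := by
        intro S
        rw [← measureReal_inter_add_sdiff (s := S ∩ ball 0 T) (t := ball 0 r) measurableSet_ball
          (hfb S T), inter_assoc, inter_eq_self_of_subset_right (ball_subset_ball hrT)]
      have h2 : (F k ∩ ball 0 T) \ ball 0 r = (cell p k ∩ ball 0 T) \ ball 0 r := by
        ext x
        simp only [Set.mem_sdiff, mem_inter_iff, mem_ball_zero_iff, not_lt]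
        exact and_congr_left fun hx => and_congr_left fun _ => hEF k x hx
      have h3 := hsplit (F k)
      have h4 := hsplit (cell p k)
      rw [h2] at h3
      rw [← ENNReal.toReal_eq_toReal_iff' (hfb _ _) (hfb _ _), psi_inter hΦ ho]
      change volume.real _ = volume.real _
      linarith
    · have hcs := hbd k hkK
      have hFs : F k ⊆ ball 0 r := by
        intro x hx
        by_contra h
        rw [mem_ball_zero_iff, not_lt] at h
        have := hcs ((hEF k x h).1 hx)
        rw [mem_ball_zero_iff] at this
        linarith
      rw [psi_inter hΦ ho, inter_eq_self_of_subset_left (hFs.trans (ball_subset_ball hrT)),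
        inter_eq_self_of_subset_left (hcs.trans (ball_subset_ball hrT)), ← hv k]
      obtain ⟨c, hc⟩ := htr
      have : Φ '' F k = (fun x => x + c) '' F k := by
        apply image_congr
        intro x hx
        exact hc x ((mem_ball_zero_iff.1 (hFs hx)).trans_le hrr)
      rw [this, image_add_right, measure_preimage_add_right]
  have h1 := claim2 hyp hp hpart hmax ha hT hF' hEF' hvv
  have h2 := perimOpen_le_of_perim_le isClosed_closedBall isOpen_ball
    (closedBall_subset_ball (show T < 2 * T by linarith)) (cell_meas p) hF'.1 (symm_out hEF') h1
  refine h2.trans ?_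
  rw [Finset.mul_sum]
  refine Finset.sum_le_sum fun k _ => ?_
  exact (psi_diffeo hΦ ho (ball_subset_ball (by linarith)) isOpen_ball).perimOpen_image_le hC
    (fun x _ v => hb x v) (hF.1 k) (psi_meas hΦ (hF.1 k))

lemma F_growth {d N : ℕ} {p : Fin N → Rd (d + 1 + 1)} {F : Fin N → Set (Rd (d + 1))}
    (hF : ∀ k, MeasurableSet (F k)) {r : ℝ}
    (hEF : ∀ k x, r ≤ ‖x‖ → (x ∈ F k ↔ x ∈ cell p k)) {S : ℝ} (hS : 0 < S) (hrS : r < S) :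
    ∑ k, perimOpen (F k) (ball 0 S) ≤ ∑ k, perim (F k) (closedBall 0 r) +
      ENNReal.ofReal (N * ((d + 1) * (2 ^ N * 2 * 2 ^ d) * S ^ d)) := by
  rw [Finset.sum_congr rfl fun k _ => perimOpen_eq_add (F k) (B := closedBall 0 r)
    isClosed_closedBall isOpen_ball (closedBall_subset_ball hrS), Finset.sum_add_distrib]
  gcongr
  have h1 : ∀ k, perimOpen (F k) (ball 0 S \ closedBall 0 r) ≤
      ENNReal.ofReal ((d + 1) * (2 ^ N * 2 * 2 ^ d) * S ^ d) := by
    intro k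
    refine le_trans ?_ (quad_perim (cell_meas p k) (cell_quad p k) hS)
    rw [perimOpen_congr (hF k) (cell_meas p k)]
    · exact perimOpen_mono sdiff_subset
    · rw [symmDiff_comm]
      refine measure_mono_null ?_ (symm_out hEF k)
      exact fun x hx => ⟨hx.1, hx.2.2⟩
  refine (Finset.sum_le_sum fun k _ => h1 k).trans ?_
  rw [Finset.sum_const, Finset.card_univ, Fintype.card_fin, nsmul_eq_mul,
    ENNReal.ofReal_mul (p := (N : ℝ)) (by positivity), ENNReal.ofReal_natCast]

lemma step1 {d N : ℕ} (hyp : Hyp (d + 1) N) {p : Fin N → Rd (d + 1 + 1)} (hp : goodP p)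
    (hpart : IsPartition univ (cell p)) {k₁ : Fin N} (hmax : ∀ j, pb (p j) ≤ pb (p k₁))
    (ha : pa (p k₁) ≠ 0) {r : ℝ} (hr : 0 < r)
    {F : Fin N → Set (Rd (d + 1))} (hF : IsPartition univ F)
    (hEF : ∀ k x, r ≤ ‖x‖ → (x ∈ F k ↔ x ∈ cell p k))
    (hbd : ∀ k, pb (p k) ≠ pb (p k₁) → cell p k ⊆ ball 0 r)
    (hv : ∀ k, volume (F k) = volume (cell p k)) :
    ∑ k, perim (cell p k) (closedBall 0 r) ≤ ∑ k, perim (F k) (closedBall 0 r) := by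
  classical
  set Q := ∑ k, perim (F k) (closedBall 0 r) with hQ
  by_cases hQt : Q = ⊤
  · rw [hQt]; exact le_top
  obtain ⟨X, hX, hXint⟩ := exists_fields (ι := {k : Fin N // k ≠ k₁ ∧ pb (p k) = pb (p k₁)})
    (fun k => cone p k) (fun k => (cone_open p k).measurableSet) (fun k => cone_pos hp k)
    (fun k j hkj => by
      refine measure_mono_null (t := ∅) ?_ measure_empty
      rintro x ⟨h1, h2⟩
      exact cone_disj p (fun h => hkj (Subtype.ext h)) (k.2.2.trans j.2.2.symm) h1 h2) (by
      intro h
      refine cone_pos hp k₁ (measure_mono_null ?_ h)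
      intro x hx hx'
      obtain ⟨k, hk⟩ := mem_iUnion.1 hx'
      exact cone_disj p k.2.1 k.2.2 hk hx)
  obtain ⟨D0, hD0, r0, hr0, ε0, hε0, c0, hc0, C, hC, hfix⟩ := vol_fix hX
  set w0 : {k : Fin N // k ≠ k₁ ∧ pb (p k) = pb (p k₁)} → ℝ := fun k =>
    volume.real (cell p k ∩ ball 0 r) - volume.real (F k ∩ ball 0 r) with hw0
  set M : ℝ := N * ((d + 1) * (2 ^ N * 2 * 2 ^ d) * (2 * D0) ^ d) with hM
  have hM0 : 0 ≤ M := by positivity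
  have hint : ∀ᶠ n : ℝ in atTop, ∀ k j : {k : Fin N // k ≠ k₁ ∧ pb (p k) = pb (p k₁)},
      |(∫ x in (fun x => n • x) ⁻¹' F k, vdiv (X j) x) - (if k = j then 1 else 0)| ≤ c0 := by
    rw [eventually_all]; intro k
    rw [eventually_all]; intro j
    have h1 := cone_int_tendsto hp (k := k) (fun j => by rw [k.2.2]; exact hmax j) (hF.1 k)
      (hEF k) (vdiv_cont (hX j).test.cd) (vdiv_cs (hX j).test.cs)
    rw [hXint k j, Metric.tendsto_nhds] at h1
    filter_upwards [h1 c0 hc0] with s hs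
    rw [Real.dist_eq] at hs
    exact hs.le
  have hmain : ∀ᶠ n : ℝ in atTop, ∑ k, perim (cell p k) (closedBall 0 r) ≤ Q +
      (ENNReal.ofReal (C * ‖w0‖ * n⁻¹) * Q + ENNReal.ofReal (C * ‖w0‖ * M * n⁻¹)) := by
    have hinv : Tendsto (fun n : ℝ => n⁻¹ * ‖w0‖) atTop (𝓝 0) := by
      simpa using tendsto_inv_atTop_zero.mul_const ‖w0‖
    have hTT : Tendsto (fun n : ℝ => n * D0) atTop atTop := tendsto_id.atTop_mul_const hD0
    have hTr : Tendsto (fun n : ℝ => n * r0) atTop atTop := tendsto_id.atTop_mul_const hr0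
    filter_upwards [hint, hinv.eventually_lt_const hε0, eventually_ge_atTop 1,
      hTT.eventually_ge_atTop r, hTr.eventually_ge_atTop r] with n hn1 hn2 hn3 hn4 hn5
    have hn : 0 < n := by linarith
    have hnd : 0 < n ^ (d + 1) := by positivity
    have hpi : (n ^ (d + 1))⁻¹ ≤ n⁻¹ := by
      gcongr
      exact le_self_pow₀ hn3 (by omega)
    have hwn : ‖(n ^ (d + 1))⁻¹ • w0‖ = (n ^ (d + 1))⁻¹ * ‖w0‖ := by
      rw [norm_smul, Real.norm_of_nonneg (by positivity)]
    obtain ⟨Ψ, Θ, hΨ, ho, ⟨c, hc⟩, hvol, hb⟩ := hfix (fun k => (fun x => n • x) ⁻¹' F k)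
      (fun k => (measurable_const_smul n) (hF.1 k)) hn1 ((n ^ (d + 1))⁻¹ • w0) (by
        rw [hwn]
        refine le_trans ?_ hn2.le
        gcongr)
    have hnorm : ∀ x : Rd (d + 1), ‖n⁻¹ • x‖ = n⁻¹ * ‖x‖ := fun x => by
      rw [norm_smul, Real.norm_of_nonneg (by positivity)]
    have hΨd : Differentiable ℝ Ψ := (contDiffOn_univ.1 hΨ.cΦ).differentiable (by norm_num)
    have hΘd : Differentiable ℝ Θ := (contDiffOn_univ.1 hΨ.cΘ).differentiable (by norm_num)
    have hpre : ∀ S : Set (Rd (d + 1)), (fun x => n • x) ⁻¹' (S ∩ ball 0 (n * D0)) =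
        ((fun x => n • x) ⁻¹' S) ∩ ball 0 D0 := by
      intro S
      ext x
      simp only [mem_preimage, mem_inter_iff, mem_ball_zero_iff]
      rw [norm_smul, Real.norm_of_nonneg hn.le, mul_lt_mul_iff_right₀ hn]
    have hstep := step1_n hyp hp hpart hmax ha hF hEF hbd hv (scale_diffeo hΨ hn)
      (T := n * D0) (rr := n * r0) (C := 1 + C * ‖(n ^ (d + 1))⁻¹ • w0‖)
      (fun x hx => by
        rw [ho, smul_inv_smul₀ hn.ne']
        rw [hnorm, inv_mul_eq_div, le_div_iff₀ hn]
        linarith) (by positivity) hn4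
      ⟨n • c, fun x hx => by
        rw [hc, smul_add, smul_inv_smul₀ hn.ne']
        rw [hnorm, inv_mul_eq_div, div_lt_iff₀ hn]
        linarith⟩ hn5
      (fun k hk hkK => by
        have h1 := hvol ⟨k, hk, hkK⟩
        have h2 : (fun x => n • x) ⁻¹' ((fun x => n • Ψ (n⁻¹ • x)) '' (F k ∩ ball 0 (n * D0))) =
            Ψ '' (((fun x => n • x) ⁻¹' F k) ∩ ball 0 D0) := by
          rw [psi_image (scale_diffeo hΨ hn), psi_image hΨ, ← hpre]
          ext x
          simp only [mem_preimage, inv_smul_smul₀ hn.ne']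
        have h3 := vol_scale hn ((fun x => n • Ψ (n⁻¹ • x)) '' (F k ∩ ball 0 (n * D0)))
        have h4 := vol_scale hn (F k ∩ ball 0 (n * D0))
        rw [h2] at h3
        rw [hpre] at h4
        simp only at h1
        rw [h3, h4] at h1
        simp only [Pi.smul_apply, smul_eq_mul, hw0] at h1
        have hne : (n ^ (d + 1))⁻¹ ≠ 0 := by positivity
        rw [← mul_add] at h1
        exact mul_left_cancel₀ hne h1)
      (by positivity)
      (fun x v => by
        rw [scale_fderiv hΨd hn, scale_fderiv hΘd hn, inv_smul_smul₀ hn.ne']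
        exact hb _ v)
    rw [hwn] at hstep
    have hS : 0 < 2 * (n * D0) := by positivity
    have hg := F_growth hF.1 hEF hS (by nlinarith)
    have hδ : ∑ k, perimOpen (cell p k) (ball 0 (2 * (n * D0))) ≤
        ∑ k, perimOpen (F k) (ball 0 (2 * (n * D0))) +
        (ENNReal.ofReal (C * ‖w0‖ * n⁻¹) * Q + ENNReal.ofReal (C * ‖w0‖ * M * n⁻¹)) := by
      refine hstep.trans ?_
      rw [ENNReal.ofReal_add zero_le_one (by positivity), ENNReal.ofReal_one, add_mul, one_mul]
      gcongr
      refine (mul_le_mul_right hg _).trans ?_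
      rw [mul_add]
      gcongr ?_ + ?_
      · refine mul_le_mul_left (ENNReal.ofReal_le_ofReal ?_) _
        have := mul_le_mul_of_nonneg_left hpi (show 0 ≤ C * ‖w0‖ by positivity)
        linarith
      · rw [← ENNReal.ofReal_mul (by positivity)]
        refine ENNReal.ofReal_le_ofReal (le_of_eq ?_)
        rw [hM, pow_succ]
        have : (2 * (n * D0)) ^ d = n ^ d * (2 * D0) ^ d := by rw [← mul_pow]; ring
        rw [this]
        have hnd0 : n ^ d ≠ 0 := by positivity
        field_simp
    exact perim_le_of_perimOpen_le isClosed_closedBall isOpen_ball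
      (closedBall_subset_ball (by nlinarith)) (cell_meas p) hF.1 (symm_out hEF)
      (fun k => cell_perim_ball p k _) hδ
  have hl : ∀ c : ℝ, Tendsto (fun n : ℝ => ENNReal.ofReal (c * n⁻¹)) atTop (𝓝 0) := by
    intro c
    have h1 : Tendsto (fun n : ℝ => c * n⁻¹) atTop (𝓝 0) := by
      simpa using tendsto_inv_atTop_zero.const_mul c
    simpa using ENNReal.tendsto_ofReal h1
  have hlim : Tendsto (fun n : ℝ => Q + (ENNReal.ofReal (C * ‖w0‖ * n⁻¹) * Q +
      ENNReal.ofReal (C * ‖w0‖ * M * n⁻¹))) atTop (𝓝 Q) := by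
    have h1 := ENNReal.Tendsto.mul_const (b := Q) (hl (C * ‖w0‖)) (Or.inr hQt)
    have h2 := (tendsto_const_nhds (x := Q)).add (h1.add (hl (C * ‖w0‖ * M)))
    simpa using h2
  exact ge_of_tendsto hlim hmain

/-! ### Conclusion -/

lemma main_cell {d N : ℕ} (hyp : Hyp (d + 1) N) {p : Fin N → Rd (d + 1 + 1)} (hp : goodP p)
    (hpart : IsPartition univ (cell p)) {B : Set (Rd (d + 1))} (hB : IsCompact B)
    {F : Fin N → Set (Rd (d + 1))} (hF : IsPartition univ F)
    (hEF : ∀ k, volume ((cell p k ∆ F k) \ B) = 0)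
    (hv : ∀ k, volume (F k) = volume (cell p k)) :
    ∑ k, perim (cell p k) B ≤ ∑ k, perim (F k) B := by
  rcases isEmpty_or_nonempty (Fin N) with hN | hN
  · simp
  obtain ⟨k₁, hmax⟩ := Finite.exists_max (fun k => pb (p k))
  by_cases hs : ∀ j, j ≠ k₁ → pb (p j) < pb (p k₁)
  · exact cluster_min hyp hp hpart hs hB.isClosed hF hEF (fun k _ => hv k)
  push Not at hs
  obtain ⟨j, hj, hjb⟩ := hs
  have hjb' : pb (p j) = pb (p k₁) := le_antisymm (hmax j) hjb
  have ha : pa (p k₁) ≠ 0 := by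
    intro h
    have := inner_cone_pos hp (Ne.symm hj) hjb'.symm
    rw [h, inner_zero_left] at this
    exact lt_irrefl _ this
  have hbdE : ∀ᶠ r : ℝ in atTop, ∀ k, pb (p k) ≠ pb (p k₁) → cell p k ⊆ ball 0 r := by
    rw [eventually_all]; intro k
    by_cases hk : pb (p k) = pb (p k₁)
    · simp [hk]
    · filter_upwards [cell_bdd (lt_of_le_of_ne (hmax k) hk)] with r hr _ using hr
  obtain ⟨r1, hr1⟩ := hB.isBounded.subset_ball (0 : Rd (d + 1))
  obtain ⟨r, hbd, hrr, hr⟩ := (hbdE.and ((eventually_ge_atTop r1).and (eventually_gt_atTop 0))).exists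
  have hBr : B ⊆ ball 0 r := hr1.trans (ball_subset_ball hrr)
  set F2 : Fin N → Set (Rd (d + 1)) := fun k => (F k ∩ B) ∪ (cell p k \ B) with hF2
  have hFF : ∀ k, volume (F k ∆ F2 k) = 0 := by
    intro k
    refine measure_mono_null ?_ (hEF k)
    intro x hx
    simp only [hF2, mem_symmDiff, mem_union, mem_inter_iff, Set.mem_sdiff] at hx ⊢
    tauto
  have hF2m : ∀ k, MeasurableSet (F2 k) := fun k =>
    ((hF.1 k).inter hB.measurableSet).union ((cell_meas p k).diff hB.measurableSet)
  have hF2p : IsPartition univ F2 := part_congr hF hF2m hFF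
  have hF2v : ∀ k, volume (F2 k) = volume (cell p k) := fun k => by
    rw [← hv k]
    exact (measure_congr (measure_symmDiff_eq_zero_iff.1 (hFF k))).symm
  have hEF2 : ∀ k x, r ≤ ‖x‖ → (x ∈ F2 k ↔ x ∈ cell p k) := by
    intro k x hx
    have : x ∉ B := fun h => by
      have := mem_ball_zero_iff.1 (hBr h)
      linarith
    simp only [hF2, mem_union, mem_inter_iff, Set.mem_sdiff]
    tauto
  have h1 := step1 hyp hp hpart hmax ha hr hF2p hEF2 hbd hF2v
  have h2 := perimOpen_le_of_perim_le (V := ball 0 (r + 1)) isClosed_closedBall isOpen_ball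
    (closedBall_subset_ball (by linarith)) (cell_meas p) hF2m (symm_out hEF2) h1
  have h3 : ∑ k, perimOpen (F2 k) (ball 0 (r + 1)) = ∑ k, perimOpen (F k) (ball 0 (r + 1)) :=
    Finset.sum_congr rfl fun k _ => (perimOpen_congr (hF.1 k) (hF2m k)
      (measure_mono_null inter_subset_left (hFF k))).symm
  rw [h3] at h2
  have := perim_le_of_perimOpen_le (δ := 0) (V := ball 0 (r + 1)) hB.isClosed isOpen_ball
    (hBr.trans (ball_subset_ball (by linarith))) (cell_meas p) hF.1 hEF
    (fun k => cell_perim_ball p k _) (by rwa [add_zero])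
  rwa [add_zero] at this

lemma perim_congr_ae {d : ℕ} {E F : Set (Rd d)} (hE : MeasurableSet E) (hF : MeasurableSet F)
    (h : volume (E ∆ F) = 0) (B : Set (Rd d)) : perim E B = perim F B := by
  unfold perim
  exact iInf_congr fun U => iInf_congr fun _ => iInf_congr fun _ =>
    perimOpen_congr hE hF (measure_mono_null inter_subset_left h)

lemma perim_zero_dim (E B : Set (Rd 0)) : perim E B = 0 := by
  refine le_antisymm ?_ zero_le
  refine (iInf_le_of_le univ (iInf_le_of_le isOpen_univ (iInf_le_of_le (subset_univ _) ?_)))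
  apply perimOpen_le
  intro φ _ _
  have : vdiv φ = fun _ => 0 := by
    ext x; simp [vdiv]
  simp [this]

theorem standard_partitions_locally_isoperimetric (d N : ℕ) (hN : N ≤ d + 2)
    (hyp : ∀ E : Fin N → Set (Rd d),
      IsPartition Set.univ E → IsStandardPartition E →
      (∃! i : Fin N, volume (E i) = ⊤) →
      ∀ F : Fin N → Set (Rd d), IsPartition Set.univ F →
        (∀ k, volume (E k) ≠ ⊤ → volume (F k) = volume (E k)) →
        partPerim E Set.univ ≤ partPerim F Set.univ) :
    ∀ E : Fin N → Set (Rd d), IsPartition Set.univ E → IsStandardPartition E →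
      LocallyIsoperimetric Set.univ E := by
  intro E hE hstd
  refine ⟨hE, fun B hB _ F hF hEF hv => ?_⟩
  unfold partPerim
  refine ENNReal.div_le_div_right ?_ 2
  cases d with
  | zero => simp [perim_zero_dim]
  | succ d =>
    obtain ⟨p, hp, hEp⟩ := std_cell hstd
    have hpart : IsPartition univ (cell p) := part_congr hE (cell_meas p) hEp
    rw [Finset.sum_congr rfl fun k _ => perim_congr_ae (hE.1 k) (cell_meas p k) (hEp k) B]
    refine main_cell hyp hp hpart hB hF (fun k => ?_) (fun k => ?_)
    · refine measure_mono_null (t := ((E k ∆ F k) \ B) ∪ (E k ∆ cell p k)) ?_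
        (measure_union_null (hEF k) (hEp k))
      intro x hx
      simp only [mem_symmDiff, mem_union, Set.mem_sdiff] at hx ⊢
      tauto
    · rw [hv k]
      exact measure_congr (measure_symmDiff_eq_zero_iff.1 (hEp k))
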